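/- arXiv:1101.1939 — 3 statements merged into one kernel-verified Lean document; each statement's English description precedes it below -/
import Mathlib

section
/- Let p be an odd prime, f ≥ 1, q = p^f, and d = q + 1. Let k be an algebraically closed field of characteristic p, ζ ∈ k a primitive d-th root of unity, K_d = k(u), and E the elliptic curve over K_d defined by y² + xy + u^d y = x³ + u^d x². For 0 ≤ i ≤ d − 1 let P_i = P(ζ^i u) ∈ E(K_d), where P(u) = (u^q(u^q − u)/(1 + 4u)^q, u^{2q}(1 + 2u + 2u^q)/(2(1 + 4u)^{(3q−1)/2}) − u^{2q}/(2(1 + 4u)^{q−1})). Then the subgroup of E(K_d) generated by P_0, …, P_{d−1} has finite index in E(K_d), and its quotient by its torsion subgroup is a free abelian group of rank d − 2. -/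
/-- The `x`-coordinate of Ulmer's explicit point `P(v)` on `y² + xy + ty = x³ + tx²`,
namely `v^q (v^q − v) / (1 + 4v)^q`. -/
def ulmerX {K : Type*} [Field K] (q : ℕ) (v : K) : K :=
  v ^ q * (v ^ q - v) / (1 + 4 * v) ^ q

/-- The `y`-coordinate of Ulmer's explicit point `P(v)`, namely
`v^{2q}(1 + 2v + 2v^q) / (2(1 + 4v)^{(3q−1)/2}) − v^{2q} / (2(1 + 4v)^{q−1})`. -/
def ulmerY {K : Type*} [Field K] (q : ℕ) (v : K) : K :=
  v ^ (2 * q) * (1 + 2 * v + 2 * v ^ q) / (2 * (1 + 4 * v) ^ ((3 * q - 1) / 2))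
    - v ^ (2 * q) / (2 * (1 + 4 * v) ^ (q - 1))


namespace Ulm
open WeierstrassCurve WeierstrassCurve.Affine

/-- Three points on a line, with multiplicities. -/
def Coll {F : Type*} [Field F] (W : WeierstrassCurve F) (x₁ y₁ x₂ y₂ x₃ y₃ : F) : Prop :=
  ∃ l n : F, y₁ = l * x₁ + n ∧ y₂ = l * x₂ + n ∧ y₃ = l * x₃ + n ∧
    x₁ + x₂ + x₃ = l ^ 2 + W.a₁ * l - W.a₂ ∧
    x₁ * x₂ + x₁ * x₃ + x₂ * x₃ = W.a₄ - 2 * l * n - W.a₁ * n - W.a₃ * l ∧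
    x₁ * x₂ * x₃ = n ^ 2 + W.a₃ * n - W.a₆

variable {F : Type*} [Field F] [DecidableEq F] {W : WeierstrassCurve F}

theorem coll_of_sum {x₁ y₁ x₂ y₂ x₃ y₃ : F} {h₁ : W.toAffine.Nonsingular x₁ y₁}
    {h₂ : W.toAffine.Nonsingular x₂ y₂} {h₃ : W.toAffine.Nonsingular x₃ y₃}
    (h : Point.some _ _ h₁ + Point.some _ _ h₂ + Point.some _ _ h₃ = 0) :
    Coll W x₁ y₁ x₂ y₂ x₃ y₃ := by
  by_cases hxy : x₁ = x₂ ∧ y₁ = W.toAffine.negY x₂ y₂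
  · rw [Point.add_of_Y_eq hxy.1 hxy.2, zero_add] at h
    exact absurd h (Point.some_ne_zero _)
  rw [Point.add_some hxy, add_eq_zero_iff_eq_neg, Point.neg_some] at h
  simp only [Point.some.injEq] at h
  have key := addPolynomial_slope h₁.1 h₂.1 hxy
  obtain ⟨hx, hy⟩ := h
  set l := W.toAffine.slope x₁ x₂ y₁ y₂ with hl
  rw [addPolynomial_eq, neg_inj, Cubic.prod_X_sub_C_eq, Cubic.toPoly_injective, hx] at key
  simp only [Cubic.mk.injEq] at key
  obtain ⟨-, k1, k2, k3⟩ := key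
  have hy2 : y₂ = l * (x₂ - x₁) + y₁ := by
    by_cases hx' : x₁ = x₂
    · have := Y_eq_of_Y_ne h₁.1 h₂.1 hx' (fun h => hxy ⟨hx', h⟩)
      subst hx'; rw [this]; ring
    · rw [hl, slope_of_X_ne hx']
      have := sub_ne_zero.mpr hx'
      field_simp; ring
  have hy3 : y₃ = l * (x₃ - x₁) + y₁ := by
    simp only [addY, negAddY, negY, hx] at hy
    linear_combination hy
  refine ⟨l, y₁ - l * x₁, by ring, by rw [hy2]; ring, by rw [hy3]; ring, ?_, ?_, ?_⟩
  · linear_combination k1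
  · linear_combination -k2
  · linear_combination k3

theorem sum_of_coll {x₁ y₁ x₂ y₂ x₃ y₃ : F} (h₁ : W.toAffine.Nonsingular x₁ y₁)
    (h₂ : W.toAffine.Nonsingular x₂ y₂) (h₃ : W.toAffine.Nonsingular x₃ y₃)
    (h : Coll W x₁ y₁ x₂ y₂ x₃ y₃) :
    Point.some _ _ h₁ + Point.some _ _ h₂ + Point.some _ _ h₃ = 0 := by
  obtain ⟨l, n, e1, e2, e3, k1, k2, k3⟩ := h
  have hxy : ¬ (x₁ = x₂ ∧ y₁ = W.toAffine.negY x₂ y₂) := by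
    rintro ⟨hx, hy⟩
    subst hx
    have e : y₂ = y₁ := by rw [e1, e2]
    subst e
    rw [nonsingular_iff] at h₁
    simp only [negY] at hy
    rcases h₁.2 with h | h
    · apply h
      subst e1
      have hy' : 2 * (l * x₁ + n) + W.a₁ * x₁ + W.a₃ = 0 := by linear_combination hy
      linear_combination (-l) * hy' - 2 * x₁ * k1 + k2
    · apply h
      simpa using hy
  have hl : W.toAffine.slope x₁ x₂ y₁ y₂ = l := by
    by_cases hx' : x₁ = x₂
    · have hne : y₁ ≠ W.toAffine.negY x₂ y₂ := fun h => hxy ⟨hx', h⟩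
      have hy := Y_eq_of_Y_ne h₁.1 h₂.1 hx' hne
      subst hx'; subst hy
      rw [slope_of_Y_ne rfl hne]
      have hne' : y₁ - W.toAffine.negY x₁ y₁ ≠ 0 := sub_ne_zero.mpr hne
      rw [div_eq_iff hne', negY]
      subst e1
      linear_combination (2 * x₁) * k1 - k2
    · rw [slope_of_X_ne hx', div_eq_iff (sub_ne_zero.mpr hx'), e1, e2]; ring
  rw [Point.add_some hxy, add_eq_zero_iff_eq_neg, Point.neg_some]
  simp only [Point.some.injEq, hl]
  have hx : W.toAffine.addX x₁ x₂ l = x₃ := by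
    simp only [addX]; linear_combination -k1
  refine ⟨hx, ?_⟩
  simp only [addY, negAddY, hx]
  congr 1
  rw [e1, e3]; ring

end Ulm


namespace Ulm
open WeierstrassCurve WeierstrassCurve.Affine

theorem hom_of {A B : Type*} [AddCommGroup A] [AddCommGroup B] (f : A → B) (f0 : f 0 = 0)
    (fneg : ∀ P, f (-P) = -f P)
    (h : ∀ P Q R, P ≠ 0 → Q ≠ 0 → R ≠ 0 → P + Q + R = 0 → f P + f Q + f R = 0) (P Q : A) :
    f (P + Q) = f P + f Q := by
  by_cases hP : P = 0
  · subst hP; simp [f0]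
  by_cases hQ : Q = 0
  · subst hQ; simp [f0]
  by_cases hR : P + Q = 0
  · rw [eq_neg_of_add_eq_zero_right hR, fneg]; simp [f0]
  have := h P Q (-(P + Q)) hP hQ (neg_ne_zero.mpr hR) (by abel)
  rw [fneg] at this
  exact (eq_of_sub_eq_zero (by rw [← this]; abel)).symm

/-- The Legendre curve `y² = x (x + 1) (x + s)`. -/
def Leg {F : Type*} [Field F] (s : F) : WeierstrassCurve F := ⟨0, 1 + s, 0, s, 0⟩

/-- Ulmer's curve. -/
def UE {F : Type*} [Field F] (t : F) : WeierstrassCurve F := ⟨1, t, t, 0, 0⟩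

section
variable {F : Type*} [Field F]

theorem leg_eq {s x y : F} : (Leg s).toAffine.Equation x y ↔ y ^ 2 = x * (x + 1) * (x + s) := by
  rw [equation_iff]
  simp only [Leg]
  constructor <;> intro h <;> linear_combination h

theorem leg_ns (h2 : (2 : F) ≠ 0) {s x y : F} (hs0 : s ≠ 0) (hs1 : s ≠ 1)
    (h : y ^ 2 = x * (x + 1) * (x + s)) : (Leg s).toAffine.Nonsingular x y := by
  rw [← equation_iff_nonsingular_of_Δ_ne_zero, leg_eq]
  · exact h
  · have : (Leg s).Δ = 2 ^ 4 * s ^ 2 * (s - 1) ^ 2 := by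
      simp only [Leg, WeierstrassCurve.Δ, WeierstrassCurve.b₂, WeierstrassCurve.b₄,
        WeierstrassCurve.b₆, WeierstrassCurve.b₈]; ring
    rw [toAffine, this]
    have := sub_ne_zero.mpr hs1
    positivity

theorem leg_negY {s x y : F} : (Leg s).toAffine.negY x y = -y := by
  simp [Leg, negY]

theorem ue_eq {t x y : F} (h : (UE t).toAffine.Equation x y) :
    (2 * y + (x + t)) ^ 2 = (x + t) * (4 * x ^ 2 + x + t) := by
  rw [equation_iff] at h
  simp only [UE] at h
  linear_combination 4 * h
end

variable {F : Type*} [Field F]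

theorem iso_alg {l n a b k X₁ X₂ X₃ m₁ m₂ m₃ : F} (hn : n ≠ 0) (hk : k * n = b)
    (h1 : X₁ * m₁ = n) (h2 : X₂ * m₂ = n) (h3 : X₃ * m₃ = n)
    (e1 : X₁ + X₂ + X₃ = l ^ 2 - a) (e2 : X₁ * X₂ + X₁ * X₃ + X₂ * X₃ = b - 2 * l * n)
    (e3 : X₁ * X₂ * X₃ = n ^ 2) :
    m₁ + m₂ + m₃ = k - 2 * l ∧ m₁ * m₂ + m₁ * m₃ + m₂ * m₃ = l ^ 2 - a ∧ m₁ * m₂ * m₃ = n := by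
  have hm : m₁ * m₂ * m₃ = n := by
    have : n ^ 2 * (m₁ * m₂ * m₃) = n ^ 2 * n := by
      rw [← e3]; linear_combination m₂ * m₃ * X₂ * X₃ * h1 + n * m₃ * X₃ * h2 + n * n * h3 - n * e3
    exact mul_left_cancel₀ (pow_ne_zero 2 hn) this
  have a1 : m₁ * m₂ = X₃ := by
    have : n * (m₁ * m₂) = n * X₃ := by linear_combination -m₁ * m₂ * h3 + X₃ * hm
    exact mul_left_cancel₀ hn this
  have a2 : m₁ * m₃ = X₂ := by
    have : n * (m₁ * m₃) = n * X₂ := by linear_combination -m₁ * m₃ * h2 + X₂ * hm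
    exact mul_left_cancel₀ hn this
  have a3 : m₂ * m₃ = X₁ := by
    have : n * (m₂ * m₃) = n * X₁ := by linear_combination -m₂ * m₃ * h1 + X₁ * hm
    exact mul_left_cancel₀ hn this
  refine ⟨?_, by rw [a1, a2, a3]; linear_combination e1, hm⟩
  have : n * (m₁ + m₂ + m₃) = n * (k - 2 * l) := by
    have : n * (m₁ + m₂ + m₃) = X₁ * X₂ + X₁ * X₃ + X₂ * X₃ := by
      rw [← a1, ← a2, ← a3]; linear_combination -(m₁ + m₂ + m₃) * hm
    rw [this, e2]; linear_combination -hk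
  exact mul_left_cancel₀ hn this

theorem iso_coll (h20 : (2 : F) ≠ 0) {l n t g₁ g₂ g₃ X₁ X₂ X₃ m₁ m₂ m₃ : F} (hn : n ≠ 0)
    (h1 : X₁ * m₁ = n) (h2 : X₂ * m₂ = n) (h3 : X₃ * m₃ = n)
    (e1 : X₁ + X₂ + X₃ = l ^ 2 - (1 / 4 - 2 * t))
    (e2 : X₁ * X₂ + X₁ * X₃ + X₂ * X₃ = t ^ 2 - 2 * l * n)
    (e3 : X₁ * X₂ * X₃ = n ^ 2) (d1 : g₁ = l + m₁) (d2 : g₂ = l + m₂) (d3 : g₃ = l + m₃) :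
    Coll (Leg (16 * t)) (4 * g₁ ^ 2 - 1) (8 * (g₁ * (X₁ - t ^ 2 / X₁)))
      (4 * g₂ ^ 2 - 1) (8 * (g₂ * (X₂ - t ^ 2 / X₂)))
      (4 * g₃ ^ 2 - 1) (8 * (g₃ * (X₃ - t ^ 2 / X₃))) := by
  obtain ⟨k, hk⟩ : ∃ k, k * n = t ^ 2 := ⟨t ^ 2 / n, by field_simp⟩
  obtain ⟨r1, r2, r3⟩ := iso_alg hn hk h1 h2 h3 e1 e2 e3
  have n4 : (4 : F) ≠ 0 := by rw [show (4 : F) = 2 * 2 by norm_num]; exact mul_ne_zero h20 h20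
  obtain ⟨a, ha⟩ : ∃ a : F, a = 1 / 4 - 2 * t := ⟨_, rfl⟩
  have ha' : 4 * a = 1 - 8 * t := by rw [ha]; field_simp; ring
  rw [← ha] at e1 r2
  have G1 : g₁ + g₂ + g₃ = l + k := by linear_combination r1 + d1 + d2 + d3
  have G2 : g₁ * g₂ + g₁ * g₃ + g₂ * g₃ = 2 * l * k - a := by
    subst d1 d2 d3; linear_combination r2 + 2 * l * r1
  have G3 : g₁ * g₂ * g₃ = l ^ 2 * k - a * l + n := by
    subst d1 d2 d3; linear_combination r3 + l * r2 + l ^ 2 * r1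
  have key : ∀ X m g : F, X * m = n → g = l + m →
      (m = m₁ ∨ m = m₂ ∨ m = m₃) →
      (X - t ^ 2 / X) * g = (l - k) * g ^ 2 + (l ^ 2 * k - a * l + n) := by
    intro X m g hX hg hm
    have hm0 : m ≠ 0 := by rintro rfl; simp_all
    have hX0 : X ≠ 0 := by rintro rfl; simp_all
    have c : g ^ 3 - (l + k) * g ^ 2 + (2 * l * k - a) * g - (l ^ 2 * k - a * l + n) = 0 := by
      rw [← G1, ← G2, ← G3]
      rcases hm with rfl | rfl | rfl
      · rw [show g = g₁ by rw [hg, d1]]; ring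
      · rw [show g = g₂ by rw [hg, d2]]; ring
      · rw [show g = g₃ by rw [hg, d3]]; ring
    have hb : t ^ 2 / X = k * m := by rw [div_eq_iff hX0, ← hk, ← hX]; ring
    have cm : m ^ 3 - (k - 2 * l) * m ^ 2 + (l ^ 2 - a) * m - n = 0 := by
      rw [hg] at c; linear_combination c
    have hXX : X = g ^ 2 - a - k * m := by
      have : m * X = m * (g ^ 2 - a - k * m) := by
        rw [hg]; linear_combination hX - cm
      exact mul_left_cancel₀ hm0 this
    rw [hb, hXX]
    have hm' : m = g - l := by rw [hg]; ring
    rw [hm']; linear_combination c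
  refine ⟨2 * (l - k), 2 * (l - k) + 8 * (l ^ 2 * k - a * l + n), ?_, ?_, ?_, ?_, ?_, ?_⟩
  · linear_combination 8 * key X₁ m₁ g₁ h1 d1 (by simp)
  · linear_combination 8 * key X₂ m₂ g₂ h2 d2 (by simp)
  · linear_combination 8 * key X₃ m₃ g₃ h3 d3 (by simp)
  all_goals
    have q1 : g₁ ^ 2 + g₂ ^ 2 + g₃ ^ 2 = (l - k) ^ 2 + 2 * a := by
      linear_combination (g₁ + g₂ + g₃ + l + k) * G1 - 2 * G2
    have q2 : g₁ ^ 2 * g₂ ^ 2 + g₁ ^ 2 * g₃ ^ 2 + g₂ ^ 2 * g₃ ^ 2 =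
        a ^ 2 - 4 * t ^ 2 - 2 * (l - k) * (l ^ 2 * k - a * l + n) := by
      rw [← hk]
      linear_combination (g₁ * g₂ + g₁ * g₃ + g₂ * g₃ + 2 * l * k - a) * G2
        - 2 * (g₁ * g₂ * g₃) * G1 - 2 * (l + k) * G3
    have q3 : g₁ ^ 2 * g₂ ^ 2 * g₃ ^ 2 = (l ^ 2 * k - a * l + n) ^ 2 := by
      rw [← G3]; ring
    simp only [Leg]
  · linear_combination 4 * q1 + 2 * ha'
  · linear_combination 16 * q2 - 8 * q1 + (4 * a + 1 - 8 * t - 4) * ha'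
  · linear_combination 64 * q3 - 16 * q2 + 4 * q1 - (4 * a + (1 - 8 * t) - 2) * ha'

theorem iso_eqn (h20 : (2 : F) ≠ 0) {t X g : F} (hX : X ≠ 0)
    (h : g ^ 2 = X + (1 / 4 - 2 * t) + t ^ 2 / X) :
    (8 * (g * (X - t ^ 2 / X))) ^ 2 =
      (4 * g ^ 2 - 1) * (4 * g ^ 2 - 1 + 1) * (4 * g ^ 2 - 1 + 16 * t) := by
  have n4 : (4 : F) ≠ 0 := by rw [show (4 : F) = 2 * 2 by norm_num]; exact mul_ne_zero h20 h20
  obtain ⟨a, ha⟩ : ∃ a : F, a = 1 / 4 - 2 * t := ⟨_, rfl⟩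
  have ha' : 4 * a = 1 - 8 * t := by rw [ha]; field_simp; ring
  rw [← ha] at h
  have : (X - t ^ 2 / X) ^ 2 = (g ^ 2 - a) ^ 2 - 4 * t ^ 2 := by
    rw [h]; field_simp; ring
  linear_combination 64 * g ^ 2 * this - 4 * g ^ 2 * (8 * g ^ 2 - 4 * a - (1 - 8 * t)) * ha'

theorem ue_g (h20 : (2 : F) ≠ 0) {t x y : F} (h : (UE t).toAffine.Equation x y) (hx : x + t ≠ 0) :
    ((2 * y + (x + t)) / (2 * (x + t))) ^ 2 =
      (x + t) + (1 / 4 - 2 * t) + t ^ 2 / (x + t) := by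
  have n4 : (4 : F) ≠ 0 := by rw [show (4 : F) = 2 * 2 by norm_num]; exact mul_ne_zero h20 h20
  rw [div_pow, ue_eq h]
  field_simp
  ring

open Classical in
/-- The isogeny from Ulmer's curve to the Legendre curve. -/
noncomputable def iso (h20 : (2 : F) ≠ 0) {t : F} (ht0 : t ≠ 0) (ht1 : 16 * t ≠ 1) :
    (UE t).toAffine.Point → (Leg (16 * t)).toAffine.Point
  | .zero => 0
  | .some x y h => if hx : x + t = 0 then 0 else
      .some (4 * ((2 * y + (x + t)) / (2 * (x + t))) ^ 2 - 1)
        (8 * ((2 * y + (x + t)) / (2 * (x + t)) * ((x + t) - t ^ 2 / (x + t))))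
        (leg_ns h20 (mul_ne_zero (by
          rw [show (16 : F) = 2 ^ 4 by norm_num]; exact pow_ne_zero 4 h20) ht0) ht1
          (iso_eqn h20 hx (ue_g h20 h.1 hx)))

section
variable (h20 : (2 : F) ≠ 0) {t : F} (ht0 : t ≠ 0) (ht1 : 16 * t ≠ 1)

theorem iso_zero : iso h20 ht0 ht1 0 = 0 := rfl

theorem iso_some_zero {x y : F} (h : (UE t).toAffine.Nonsingular x y) (hx : x + t = 0) :
    iso h20 ht0 ht1 (.some x y h) = 0 := by simp [iso, hx]

theorem iso_some {x y : F} (h : (UE t).toAffine.Nonsingular x y) (hx : x + t ≠ 0) {z v : F}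
    (hz : z = 4 * ((2 * y + (x + t)) / (2 * (x + t))) ^ 2 - 1)
    (hv : v = 8 * ((2 * y + (x + t)) / (2 * (x + t)) * ((x + t) - t ^ 2 / (x + t)))) :
    ∃ h', iso h20 ht0 ht1 (.some x y h) = .some z v h' := by
  subst hz hv
  exact ⟨_, dif_neg hx⟩

theorem iso_neg (P : (UE t).toAffine.Point) : iso h20 ht0 ht1 (-P) = - iso h20 ht0 ht1 P := by
  rcases P with _ | ⟨x, y, h⟩
  · exact (Point.neg_zero (W' := (Leg (16 * t)).toAffine)).symm
  rw [Point.neg_some]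
  by_cases hx : x + t = 0
  · rw [iso_some_zero _ _ _ _ hx, iso_some_zero _ _ _ _ hx, Point.neg_zero]
  obtain ⟨h', e⟩ := iso_some h20 ht0 ht1 h hx rfl rfl
  have hn : 2 * (UE t).toAffine.negY x y + (x + t) = -(2 * y + (x + t)) := by
    simp only [negY, UE]; ring
  obtain ⟨h'', e'⟩ := iso_some h20 ht0 ht1 ((nonsingular_neg ..).mpr h) hx rfl rfl
  rw [e, e', Point.neg_some]
  simp only [Point.some.injEq, leg_negY, hn]
  constructor <;> ring

theorem iso_triple_zero [DecidableEq F] {x₁ y₁ x₂ y₂ x₃ y₃ : F}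
    (h₁ : (UE t).toAffine.Nonsingular x₁ y₁)
    (h₂ : (UE t).toAffine.Nonsingular x₂ y₂) (h₃ : (UE t).toAffine.Nonsingular x₃ y₃)
    (h : Point.some _ _ h₁ + Point.some _ _ h₂ + Point.some _ _ h₃ = 0) (hx : x₁ + t = 0) :
    iso h20 ht0 ht1 (.some _ _ h₁) + iso h20 ht0 ht1 (.some _ _ h₂)
      + iso h20 ht0 ht1 (.some _ _ h₃) = 0 := by
  obtain ⟨l, n, e1, e2, e3, k1, k2, k3⟩ := coll_of_sum h
  simp only [UE] at k1 k2 k3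
  have hx1 : x₁ = -t := eq_neg_of_add_eq_zero_left hx
  have hnl : n = l * t := by
    have : (n - l * t) ^ 2 = 0 := by
      linear_combination -k3 - t * k2 - t ^ 2 * k1 + (x₂ * x₃ + t * (x₂ + x₃) + t ^ 2) * hx
    exact sub_eq_zero.mp (pow_eq_zero_iff (two_ne_zero) |>.mp this)
  have hb : (x₂ + t) * (x₃ + t) = t ^ 2 := by
    subst hx1 hnl; linear_combination k2 + 2 * t * k1
  have hx2 : x₂ + t ≠ 0 := by
    intro h0; rw [h0, zero_mul] at hb; exact ht0 (pow_eq_zero_iff two_ne_zero |>.mp hb.symm)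
  have hx3 : x₃ + t ≠ 0 := by
    intro h0; rw [h0, mul_zero] at hb; exact ht0 (pow_eq_zero_iff two_ne_zero |>.mp hb.symm)
  obtain ⟨h', e⟩ := iso_some h20 ht0 ht1 h₂ hx2 rfl rfl
  obtain ⟨h'', e'⟩ := iso_some h20 ht0 ht1 h₃ hx3 rfl rfl
  rw [iso_some_zero _ _ _ _ hx, zero_add, e, e']
  have g2 : (2 * y₂ + (x₂ + t)) / (2 * (x₂ + t)) = (2 * l + 1) / 2 := by
    rw [e2, hnl]; field_simp
  have g3 : (2 * y₃ + (x₃ + t)) / (2 * (x₃ + t)) = (2 * l + 1) / 2 := by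
    rw [e3, hnl]; field_simp
  apply Point.add_of_Y_eq
  · rw [g2, g3]
  · rw [leg_negY, g2, g3, ← hb]
    field_simp
    ring

theorem iso_add [DecidableEq F] (P Q : (UE t).toAffine.Point) :
    iso h20 ht0 ht1 (P + Q) = iso h20 ht0 ht1 P + iso h20 ht0 ht1 Q := by
  refine hom_of (iso h20 ht0 ht1) (iso_zero ..) (iso_neg h20 ht0 ht1) ?_ P Q
  clear P Q
  intro P Q R hP hQ hR h
  rcases P with _ | ⟨x₁, y₁, h₁⟩
  · exact absurd rfl hP
  rcases Q with _ | ⟨x₂, y₂, h₂⟩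
  · exact absurd rfl hQ
  rcases R with _ | ⟨x₃, y₃, h₃⟩
  · exact absurd rfl hR
  by_cases hx1 : x₁ + t = 0
  · exact iso_triple_zero h20 ht0 ht1 h₁ h₂ h₃ h hx1
  by_cases hx2 : x₂ + t = 0
  · have := iso_triple_zero h20 ht0 ht1 h₂ h₁ h₃ (by rw [← h]; abel) hx2
    rw [← this]; abel
  by_cases hx3 : x₃ + t = 0
  · have := iso_triple_zero h20 ht0 ht1 h₃ h₁ h₂ (by rw [← h]; abel) hx3
    rw [← this]; abel
  obtain ⟨l, n, e1, e2, e3, k1, k2, k3⟩ := coll_of_sum h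
  simp only [UE] at k1 k2 k3
  obtain ⟨i1, j1⟩ := iso_some h20 ht0 ht1 h₁ hx1 rfl rfl
  obtain ⟨i2, j2⟩ := iso_some h20 ht0 ht1 h₂ hx2 rfl rfl
  obtain ⟨i3, j3⟩ := iso_some h20 ht0 ht1 h₃ hx3 rfl rfl
  rw [j1, j2, j3]
  apply sum_of_coll
  have n4 : (4 : F) ≠ 0 := by rw [show (4 : F) = 2 * 2 by norm_num]; exact mul_ne_zero h20 h20
  have E3 : (x₁ + t) * (x₂ + t) * (x₃ + t) = (n - l * t) ^ 2 := by
    linear_combination k3 + t * k2 + t ^ 2 * k1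
  have hn : n - l * t ≠ 0 := by
    intro h0; rw [h0] at E3
    have := mul_ne_zero (mul_ne_zero hx1 hx2) hx3
    exact this (by rw [E3]; ring)
  refine iso_coll h20 (l := l + 1 / 2) (n := n - l * t) (m₁ := (n - l * t) / (x₁ + t))
    (m₂ := (n - l * t) / (x₂ + t)) (m₃ := (n - l * t) / (x₃ + t)) hn (by field_simp)
    (by field_simp) (by field_simp) ?_ ?_ E3 ?_ ?_ ?_
  · field_simp; linear_combination 16 * k1
  · field_simp; linear_combination k2 + 2 * t * k1
  · rw [e1]; field_simp; ring
  · rw [e2]; field_simp; ring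
  · rw [e3]; field_simp; ring

theorem iso_ker {P : (UE t).toAffine.Point} (h : iso h20 ht0 ht1 P = 0) :
    P = 0 ∨ ∃ y hh, P = .some (-t) y hh ∧ 2 * y = 0 := by
  rcases P with _ | ⟨x, y, hh⟩
  · exact Or.inl rfl
  by_cases hx : x + t = 0
  · right
    have := ue_eq hh.1
    rw [hx] at this
    obtain rfl : x = -t := eq_neg_of_add_eq_zero_left hx
    refine ⟨y, hh, rfl, ?_⟩
    have h3 : (2 * y) ^ 2 = 0 := by linear_combination this
    exact pow_eq_zero_iff two_ne_zero |>.mp h3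
  · obtain ⟨i, j⟩ := iso_some h20 ht0 ht1 hh hx rfl rfl
    rw [j] at h
    exact absurd h (Point.some_ne_zero _)
end

end Ulm


namespace Ulm
open WeierstrassCurve WeierstrassCurve.Affine

section
variable {F : Type*} [Field F] [DecidableEq F]

theorem leg_half (h2 : (2 : F) ≠ 0) {s x y : F} (hs0 : s ≠ 0) (hs1 : s ≠ 1)
    (h : (Leg s).toAffine.Nonsingular x y) {a b c : F} (ha : x = a ^ 2) (hb : x + 1 = b ^ 2)
    (hc : x + s = c ^ 2) (hy : y = a * b * c) :
    ∃ Q : (Leg s).toAffine.Point, Q + Q = .some x y h := by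
  have h1 : (1 : F) = b ^ 2 - a ^ 2 := by linear_combination hb - ha
  have hs : s = c ^ 2 - a ^ 2 := by linear_combination hc - ha
  have e : ((a + b) * (b + c) * (c + a)) ^ 2 = ((a + b) * (a + c)) * ((a + b) * (a + c) + 1)
      * ((a + b) * (a + c) + s) := by
    rw [h1, hs]; ring
  have hQ := leg_ns h2 hs0 hs1 e
  refine ⟨.some _ _ hQ, ?_⟩
  rw [← sub_eq_zero, sub_eq_add_neg, Point.neg_some]
  apply sum_of_coll
  refine ⟨a + b + c, (a + b) * (b + c) * (c + a) - (a + b + c) * ((a + b) * (a + c)),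
    by ring, by ring, ?_, ?_, ?_, ?_⟩
  · rw [leg_negY, hy, ha]; ring
  · simp only [Leg]; rw [h1, hs, ha]; ring
  · simp only [Leg]; rw [hs, ha]; linear_combination (a ^ 2 - c ^ 2) * h1
  · simp only [Leg]; rw [ha]; ring

theorem leg_dbl {s x y : F} (h2 : (2 : F) ≠ 0)
    (h : (Leg s).toAffine.Nonsingular x y) (hy : y ≠ 0) :
    ∃ X Y h', Point.some x y h + Point.some x y h = .some X Y h' ∧
      X * (4 * (x * (x + 1) * (x + s))) = (x ^ 2 - s) ^ 2 := by
  have hy' : y ≠ (Leg s).toAffine.negY x y := by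
    rw [leg_negY]; intro h0
    apply mul_ne_zero h2 hy; linear_combination h0
  rcases hR : -(Point.some x y h + Point.some x y h) with _ | ⟨X, Y, h'⟩
  · exfalso
    rw [Point.add_self_of_Y_ne hy', Point.neg_some] at hR
    exact absurd hR (Point.some_ne_zero _)
  refine ⟨X, _, (nonsingular_neg ..).mpr h', by rw [← Point.neg_some h', ← hR, neg_neg], ?_⟩
  have := coll_of_sum (h₁ := h) (h₂ := h) (h₃ := h') (by rw [← hR]; abel)
  obtain ⟨l, n, e1, -, -, k1, k2, k3⟩ := this
  simp only [Leg] at k1 k2 k3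
  have E := leg_eq.mp h.1
  have : 2 * l * y = 3 * x ^ 2 + 2 * (1 + s) * x + s := by
    rw [e1]; linear_combination -2 * x * k1 + k2
  rw [← E]
  linear_combination (2 * l * y + (3 * x ^ 2 + 2 * (1 + s) * x + s)) * this
    + 4 * y ^ 2 * k1 - 4 * (1 + s + 2 * x) * E

theorem leg_dbl_zero {s x y : F} 
    (h : (Leg s).toAffine.Nonsingular x y) (hy : y = 0) :
    Point.some x y h + Point.some x y h = 0 := by
  apply Point.add_self_of_Y_eq
  rw [leg_negY, hy, neg_zero]

theorem leg_add {s x₁ y₁ x₂ y₂ : F}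
    (h₁ : (Leg s).toAffine.Nonsingular x₁ y₁) (h₂ : (Leg s).toAffine.Nonsingular x₂ y₂)
    (hx : x₁ ≠ x₂) :
    ∃ X Y h', Point.some _ _ h₁ + Point.some _ _ h₂ = .some X Y h' ∧
      (x₁ - x₂) ^ 2 * X ^ 2 - 2 * ((x₁ + x₂) * (x₁ * x₂ + s) + 2 * (1 + s) * x₁ * x₂) * X
        + (x₁ * x₂ - s) ^ 2 = 0 ∧
      ∀ e, e * (e + 1) * (e + s) = 0 → (X - e) * ((x₁ - e) * (x₂ - e) * (x₁ - x₂) ^ 2) =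
        (y₁ * (x₂ - e) - y₂ * (x₁ - e)) ^ 2 := by
  rcases hR : -(Point.some _ _ h₁ + Point.some _ _ h₂) with _ | ⟨X, Y, h'⟩
  · exfalso
    rw [Point.add_of_X_ne hx, Point.neg_some] at hR
    exact absurd hR (Point.some_ne_zero _)
  refine ⟨X, _, (nonsingular_neg ..).mpr h', by rw [← Point.neg_some h', ← hR, neg_neg], ?_⟩
  have := coll_of_sum (h₁ := h₁) (h₂ := h₂) (h₃ := h') (by rw [← hR]; abel)
  obtain ⟨l, n, e1, e2, -, k1, k2, k3⟩ := this
  simp only [Leg] at k1 k2 k3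
  have E1 := leg_eq.mp h₁.1
  have E2 := leg_eq.mp h₂.1
  constructor
  · have hd : (x₁ - x₂) ^ 2 ≠ 0 := pow_ne_zero 2 (sub_ne_zero.mpr hx)
    apply mul_left_cancel₀ hd
    have hl : l * (x₁ - x₂) = y₁ - y₂ := by rw [e1, e2]; ring
    have hT : X * (x₁ - x₂) ^ 2 = (x₁ + x₂) * (x₁ * x₂ + s) + 2 * (1 + s) * x₁ * x₂ 
        - 2 * y₁ * y₂ := by
      linear_combination (x₁ - x₂) ^ 2 * k1 + (l * (x₁ - x₂) + (y₁ - y₂)) * hl + E1 + E2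
    obtain ⟨A, hA⟩ : ∃ A, A = (x₁ + x₂) * (x₁ * x₂ + s) + 2 * (1 + s) * x₁ * x₂ := ⟨_, rfl⟩
    have hA2 : A ^ 2 - 4 * (x₁ * (x₁ + 1) * (x₁ + s)) * (x₂ * (x₂ + 1) * (x₂ + s)) =
      (x₁ - x₂) ^ 2 * (x₁ * x₂ - s) ^ 2 := by rw [hA]; ring
    rw [← hA] at hT ⊢
    linear_combination (X * (x₁ - x₂) ^ 2 - A - 2 * y₁ * y₂) * hT - hA2 + 
      4 * y₁ ^ 2 * E2 + 4 * (x₂ * (x₂ + 1) * (x₂ + s)) * E1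
  · intro e he
    have : (x₁ - e) * (x₂ - e) * (X - e) = (l * e + n) ^ 2 := by
      linear_combination k3 - e * k2 + e ^ 2 * k1 - he
    rw [e1, e2]
    linear_combination (x₁ - x₂) ^ 2 * this
end
end Ulm


namespace Ulm
open Polynomial

/-- A discrete valuation with unspecified value at zero. -/
structure OrdVal (F : Type*) [Field F] where
  v : F → ℤ
  mul' : ∀ x y, x ≠ 0 → y ≠ 0 → v (x * y) = v x + v y
  add' : ∀ x y, x ≠ 0 → y ≠ 0 → x + y ≠ 0 → min (v x) (v y) ≤ v (x + y)

namespace OrdVal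
variable {F : Type*} [Field F] (o : OrdVal F)

theorem mul {x y : F} (hx : x ≠ 0) (hy : y ≠ 0) : o.v (x * y) = o.v x + o.v y := o.mul' x y hx hy

theorem one : o.v 1 = 0 := by
  have := o.mul (one_ne_zero (α := F)) one_ne_zero
  rw [mul_one] at this; omega

theorem neg_one : o.v (-1) = 0 := by
  have := o.mul (neg_ne_zero.mpr (one_ne_zero (α := F))) (neg_ne_zero.mpr (one_ne_zero (α := F)))
  rw [neg_mul_neg, mul_one, o.one] at this; omega

theorem neg (x : F) : o.v (-x) = o.v x := by
  by_cases h : x = 0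
  · rw [h, neg_zero]
  rw [← neg_one_mul, o.mul (neg_ne_zero.mpr one_ne_zero) h, o.neg_one, zero_add]

theorem inv {x : F} (hx : x ≠ 0) : o.v x⁻¹ = - o.v x := by
  have := o.mul hx (inv_ne_zero hx)
  rw [mul_inv_cancel₀ hx, o.one] at this; omega

theorem div {x y : F} (hx : x ≠ 0) (hy : y ≠ 0) : o.v (x / y) = o.v x - o.v y := by
  rw [div_eq_mul_inv, o.mul hx (inv_ne_zero hy), o.inv hy]; ring

theorem sq {x : F} (hx : x ≠ 0) : o.v (x ^ 2) = 2 * o.v x := by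
  rw [pow_two, o.mul hx hx]; ring

theorem pow {x : F} (hx : x ≠ 0) (n : ℕ) : o.v (x ^ n) = n * o.v x := by
  induction n with
  | zero => simp [o.one]
  | succ n ih => rw [pow_succ, o.mul (pow_ne_zero n hx) hx, ih]; push_cast; ring

theorem add_ge {x y : F} {m : ℤ} (hx : x ≠ 0 → m ≤ o.v x) (hy : y ≠ 0 → m ≤ o.v y)
    (h : x + y ≠ 0) : m ≤ o.v (x + y) := by
  by_cases h1 : x = 0
  · rw [h1, zero_add] at h ⊢; exact hy h
  by_cases h2 : y = 0
  · rw [h2, add_zero] at h ⊢; exact hx h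
  have := o.add' x y h1 h2 h
  have := hx h1; have := hy h2
  omega

/-- If `v x < v y` then `x + y ≠ 0` and `v (x + y) = v x`. -/
theorem add_lt {x y : F} (hx : x ≠ 0) (hy : y ≠ 0 → o.v x < o.v y) :
    x + y ≠ 0 ∧ o.v (x + y) = o.v x := by
  by_cases h2 : y = 0
  · simp [h2, hx]
  have hy' := hy h2
  have h : x + y ≠ 0 := by
    intro h0
    rw [eq_neg_of_add_eq_zero_left h0, o.neg] at hy'; omega
  refine ⟨h, ?_⟩
  have a := o.add' x y hx h2 h
  have b := o.add' (x + y) (-y) h (neg_ne_zero.mpr h2) (by simpa using hx)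
  rw [add_neg_cancel_right, o.neg] at b
  omega

theorem add_lt' {x y : F} (hx : x ≠ 0) (hy : y ≠ 0 → o.v x < o.v y) :
    y + x ≠ 0 ∧ o.v (y + x) = o.v x := by
  rw [add_comm]; exact o.add_lt hx hy
end OrdVal

section
variable {k : Type*} [Field k]

/-- order at a finite point -/
noncomputable def ordF (c : k) (f : RatFunc k) : ℤ :=
  (rootMultiplicity c f.num : ℤ) - rootMultiplicity c f.denom

theorem ordF_eq (c : k) {f : RatFunc k} {a b : k[X]} (ha : a ≠ 0) (hb : b ≠ 0)
    (h : f = algebraMap _ (RatFunc k) a / algebraMap _ (RatFunc k) b) :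
    ordF c f = (rootMultiplicity c a : ℤ) - rootMultiplicity c b := by
  have hb' : algebraMap _ (RatFunc k) b ≠ 0 := by simpa using hb
  have ha' : algebraMap _ (RatFunc k) a ≠ 0 := by simpa using ha
  have hf : f ≠ 0 := by rw [h]; exact div_ne_zero ha' hb'
  have hd : algebraMap _ (RatFunc k) f.denom ≠ 0 := by simpa using f.denom_ne_zero
  have e : f.num * b = a * f.denom := by
    apply RatFunc.algebraMap_injective k
    have := f.num_div_denom
    rw [h, div_eq_div_iff (by rw [← h]; exact hd) hb'] at this
    rw [map_mul, map_mul, h]; exact this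
  have hn : f.num ≠ 0 := RatFunc.num_ne_zero hf
  have := congrArg (rootMultiplicity c) e
  rw [rootMultiplicity_mul (mul_ne_zero hn hb),
    rootMultiplicity_mul (mul_ne_zero ha f.denom_ne_zero)] at this
  unfold ordF
  omega

theorem exists_frac {f : RatFunc k} (hf : f ≠ 0) : ∃ a b : k[X], a ≠ 0 ∧ b ≠ 0 ∧
    f = algebraMap _ (RatFunc k) a / algebraMap _ (RatFunc k) b :=
  ⟨f.num, f.denom, RatFunc.num_ne_zero hf, f.denom_ne_zero, f.num_div_denom.symm⟩

/-- order at a finite point, as a valuation -/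
noncomputable def ordC (c : k) : OrdVal (RatFunc k) where
  v := ordF c
  mul' x y hx hy := by
    obtain ⟨a, b, ha, hb, rfl⟩ := exists_frac hx
    obtain ⟨a', b', ha', hb', rfl⟩ := exists_frac hy
    rw [ordF_eq c ha hb rfl, ordF_eq c ha' hb' rfl,
      ordF_eq c (mul_ne_zero ha ha') (mul_ne_zero hb hb') (by rw [map_mul, map_mul]; field_simp),
      rootMultiplicity_mul (mul_ne_zero ha ha'), rootMultiplicity_mul (mul_ne_zero hb hb')]
    push_cast; ring
  add' x y hx hy h := by
    obtain ⟨a, b, ha, hb, rfl⟩ := exists_frac hx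
    obtain ⟨a', b', ha', hb', rfl⟩ := exists_frac hy
    have n1 : algebraMap _ (RatFunc k) b ≠ 0 := by simpa using hb
    have n2 : algebraMap _ (RatFunc k) b' ≠ 0 := by simpa using hb'
    have e : algebraMap _ (RatFunc k) a / algebraMap _ (RatFunc k) b +
      algebraMap _ (RatFunc k) a' / algebraMap _ (RatFunc k) b' =
        algebraMap _ (RatFunc k) (a * b' + b * a') / algebraMap _ (RatFunc k) (b * b') := by
      rw [map_add, map_mul, map_mul, map_mul]; field_simp
    have h0 : a * b' + b * a' ≠ 0 := by
      intro h0; rw [e, h0] at h; simp at h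
    rw [ordF_eq c ha hb rfl, ordF_eq c ha' hb' rfl,
      ordF_eq c h0 (mul_ne_zero hb hb') e, rootMultiplicity_mul (mul_ne_zero hb hb')]
    have := rootMultiplicity_add (p := a * b') (q := b * a') c h0
    rw [rootMultiplicity_mul (mul_ne_zero ha hb'), rootMultiplicity_mul (mul_ne_zero hb ha')] at this
    push_cast; omega

theorem ordC_eq (c : k) {f : RatFunc k} {a b : k[X]} (ha : a ≠ 0) (hb : b ≠ 0)
    (h : f = algebraMap _ (RatFunc k) a / algebraMap _ (RatFunc k) b) :
    (ordC c).v f = (rootMultiplicity c a : ℤ) - rootMultiplicity c b := ordF_eq c ha hb h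

theorem ordC_poly (c : k) {a : k[X]} (ha : a ≠ 0) :
    (ordC c).v (algebraMap _ (RatFunc k) a) = (rootMultiplicity c a : ℤ) := by
  rw [ordC_eq c ha one_ne_zero (by simp),
    show rootMultiplicity c (1 : k[X]) = 0 from rootMultiplicity_eq_zero (by simp)]; simp

/-- order at infinity -/
noncomputable def ordInf : OrdVal (RatFunc k) where
  v f := - f.intDegree
  mul' x y hx hy := by rw [RatFunc.intDegree_mul hx hy]; ring
  add' x y hx hy h := by
    have := RatFunc.intDegree_add_le (x := x) hy h
    omega

theorem isSquare_poly [IsAlgClosed k] {g : k[X]}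
    (h : ∀ c, Even (rootMultiplicity c g)) : IsSquare g := by
  have hs := (IsAlgClosed.splits g).eq_prod_roots
  classical
  have : g.roots = 2 • (∑ c ∈ g.roots.toFinset, Multiset.replicate (g.roots.count c / 2) c) := by
    conv_lhs => rw [← Multiset.toFinset_sum_count_nsmul_eq g.roots]
    rw [Finset.smul_sum]
    refine Finset.sum_congr rfl fun c _ => ?_
    rw [← Multiset.nsmul_singleton, smul_smul, count_roots, Nat.mul_div_cancel' (h c).two_dvd]
  obtain ⟨l, hl⟩ := IsAlgClosed.exists_pow_nat_eq g.leadingCoeff (n := 2) (by norm_num)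
  rw [hs, this, Multiset.map_nsmul, Multiset.prod_nsmul, ← hl, C_pow, ← mul_pow]
  exact ⟨_, pow_two _⟩

theorem isSquare_poly' [IsAlgClosed k] {g : k[X]} (h0 : g ≠ 0)
    (h : ∀ c, c ≠ 0 → Even (rootMultiplicity c g)) (hd : Even g.natDegree) : IsSquare g := by
  obtain ⟨q, hq, hn⟩ := exists_eq_pow_rootMultiplicity_mul_and_not_dvd g h0 0
  have hq0 : q ≠ 0 := by rintro rfl; simp at hn
  set m := rootMultiplicity 0 g
  have hX : (X - C (0 : k)) ^ m ≠ 0 := pow_ne_zero _ (X_sub_C_ne_zero _)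
  have sq : IsSquare q := by
    apply isSquare_poly
    intro c
    by_cases hc : c = 0
    · rw [hc, rootMultiplicity_eq_zero (by rwa [dvd_iff_isRoot] at hn)]; simp
    · have := h c hc
      rw [hq, rootMultiplicity_mul (mul_ne_zero hX hq0), rootMultiplicity_eq_zero, zero_add] at this
      · exact this
      · simp [hc]
  obtain ⟨r, rfl⟩ := sq
  have hr : r ≠ 0 := by rintro rfl; simp at hq0
  rw [hq, natDegree_mul hX hq0, natDegree_mul hr hr, natDegree_pow, natDegree_X_sub_C] at hd
  have hm : Even m := by
    rcases hd with ⟨w, hw⟩; exact ⟨w - r.natDegree, by omega⟩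
  obtain ⟨w, hw⟩ := hm
  refine ⟨(X - C (0 : k)) ^ w * r, ?_⟩
  rw [hq, hw, pow_add]; ring

theorem isSquare_frac {f : RatFunc k} (h : IsSquare (f.num * f.denom)) : IsSquare f := by
  obtain ⟨r, hr⟩ := h
  have hd : algebraMap _ (RatFunc k) f.denom ≠ 0 := by simpa using f.denom_ne_zero
  refine ⟨algebraMap _ (RatFunc k) r / algebraMap _ (RatFunc k) f.denom, ?_⟩
  have := congrArg (algebraMap _ (RatFunc k)) hr
  rw [map_mul, map_mul] at this
  conv_lhs => rw [← f.num_div_denom]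
  rw [div_mul_div_comm, ← this]; field_simp

theorem isSquare_rat [IsAlgClosed k] {f : RatFunc k} (h0 : f ≠ 0)
    (h : ∀ c, Even ((ordC c).v f)) : IsSquare f := by
  apply isSquare_frac
  apply isSquare_poly
  intro c
  have := h c
  rw [rootMultiplicity_mul (mul_ne_zero (RatFunc.num_ne_zero h0) f.denom_ne_zero)]
  change Even ((rootMultiplicity c f.num : ℤ) - rootMultiplicity c f.denom) at this
  rcases this with ⟨w, hw⟩
  exact ⟨(w + rootMultiplicity c f.denom).toNat, by omega⟩

theorem isSquare_rat' [IsAlgClosed k] {f : RatFunc k} (h0 : f ≠ 0)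
    (h : ∀ c, c ≠ 0 → Even ((ordC c).v f)) (hi : Even (ordInf.v f)) : IsSquare f := by
  apply isSquare_frac
  apply isSquare_poly' (mul_ne_zero (RatFunc.num_ne_zero h0) f.denom_ne_zero)
  · intro c hc
    have := h c hc
    rw [rootMultiplicity_mul (mul_ne_zero (RatFunc.num_ne_zero h0) f.denom_ne_zero)]
    change Even ((rootMultiplicity c f.num : ℤ) - rootMultiplicity c f.denom) at this
    rcases this with ⟨w, hw⟩
    exact ⟨(w + rootMultiplicity c f.denom).toNat, by omega⟩
  · rw [natDegree_mul (RatFunc.num_ne_zero h0) f.denom_ne_zero]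
    change Even (-((f.num.natDegree : ℤ) - f.denom.natDegree)) at hi
    rcases hi with ⟨w, hw⟩
    exact ⟨(- w + f.denom.natDegree).toNat, by omega⟩
end
end Ulm


namespace Ulm
open WeierstrassCurve WeierstrassCurve.Affine

section
variable {F : Type*} [Field F]

open Classical in
/-- The descent quantity `x + 1`, suitably modified at `(-1, 0)`. -/
noncomputable def dlt (s : F) : (Leg s).toAffine.Point → F
  | .zero => 1
  | .some x _ _ => if x + 1 = 0 then 1 - s else x + 1

theorem dlt_zero (s : F) : dlt s 0 = 1 := rfl

theorem dlt_some {s x y : F} (h : (Leg s).toAffine.Nonsingular x y) (hx : x + 1 ≠ 0) :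
    dlt s (.some x y h) = x + 1 := by simp [dlt, hx]

theorem dlt_some' {s x y : F} (h : (Leg s).toAffine.Nonsingular x y) (hx : x + 1 = 0) :
    dlt s (.some x y h) = 1 - s := by simp [dlt, hx]

theorem even_cast {n : ℤ} : (n : ZMod 2) = 0 ↔ Even n := by
  rw [even_iff_two_dvd]; exact ZMod.intCast_zmod_eq_zero_iff_dvd n 2

variable [DecidableEq F]

theorem desc_aux (o : OrdVal F) {s x₁ y₁ x₂ y₂ x₃ y₃ : F} (hs1 : s ≠ 1) 
    (h₁ : (Leg s).toAffine.Nonsingular x₁ y₁)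
    (h₂ : (Leg s).toAffine.Nonsingular x₂ y₂) (h₃ : (Leg s).toAffine.Nonsingular x₃ y₃)
    (h : Point.some _ _ h₁ + Point.some _ _ h₂ + Point.some _ _ h₃ = 0) (hx : x₁ + 1 = 0) :
    Even (o.v (dlt s (.some _ _ h₁)) + o.v (dlt s (.some _ _ h₂)) + o.v (dlt s (.some _ _ h₃))) := by
  obtain ⟨l, n, e1, e2, e3, k1, k2, k3⟩ := coll_of_sum h
  simp only [Leg] at k1 k2 k3
  have hs : 1 - s ≠ 0 := sub_ne_zero.mpr hs1.symm
  have hnl : n = l := by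
    have : (n - l) ^ 2 = 0 := by
      linear_combination -k3 - k2 - k1 + (x₂ * x₃ + (x₂ + x₃) + 1) * hx
    exact sub_eq_zero.mp (pow_eq_zero_iff (two_ne_zero) |>.mp this)
  have hx1 : x₁ = -1 := eq_neg_of_add_eq_zero_left hx
  have hb : (x₂ + 1) * (x₃ + 1) = 1 - s := by
    subst hnl hx1; linear_combination k2 + 2 * k1
  have hx2 : x₂ + 1 ≠ 0 := by
    intro h0; rw [h0, zero_mul] at hb; exact hs hb.symm
  have hx3 : x₃ + 1 ≠ 0 := by
    intro h0; rw [h0, mul_zero] at hb; exact hs hb.symm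
  rw [dlt_some' h₁ hx, dlt_some h₂ hx2, dlt_some h₃ hx3, ← hb, o.mul hx2 hx3]
  exact ⟨_, add_assoc _ _ _⟩

theorem desc_hom (o : OrdVal F) {s : F} (hs1 : s ≠ 1) (P Q : (Leg s).toAffine.Point) :
    ((o.v (dlt s (P + Q)) : ℤ) : ZMod 2) = (o.v (dlt s P) : ℤ) + (o.v (dlt s Q) : ℤ) := by
  refine hom_of (fun P => ((o.v (dlt s P) : ℤ) : ZMod 2)) ?_ ?_ ?_ P Q
  · simp [dlt_zero, o.one]
  · intro P
    rw [ZMod.neg_eq_self_mod_two]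
    rcases P with _ | ⟨x, y, h⟩
    · rfl
    · rw [Point.neg_some]; rfl
  clear P Q
  intro P Q R hP hQ hR h
  rcases P with _ | ⟨x₁, y₁, h₁⟩
  · exact absurd rfl hP
  rcases Q with _ | ⟨x₂, y₂, h₂⟩
  · exact absurd rfl hQ
  rcases R with _ | ⟨x₃, y₃, h₃⟩
  · exact absurd rfl hR
  have key : Even (o.v (dlt s (.some _ _ h₁)) + o.v (dlt s (.some _ _ h₂))
      + o.v (dlt s (.some _ _ h₃))) := by
    by_cases hx1 : x₁ + 1 = 0
    · exact desc_aux o hs1 h₁ h₂ h₃ h hx1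
    by_cases hx2 : x₂ + 1 = 0
    · have := desc_aux o hs1 h₂ h₁ h₃ (by rw [← h]; abel) hx2
      convert this using 1; ring
    by_cases hx3 : x₃ + 1 = 0
    · have := desc_aux o hs1 h₃ h₁ h₂ (by rw [← h]; abel) hx3
      convert this using 1; ring
    obtain ⟨l, n, e1, e2, e3, k1, k2, k3⟩ := coll_of_sum h
    simp only [Leg] at k1 k2 k3
    have : (x₁ + 1) * (x₂ + 1) * (x₃ + 1) = (n - l) ^ 2 := by
      linear_combination k3 + k2 + k1
    have hn : n - l ≠ 0 := by
      intro h0; rw [h0] at this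
      exact mul_ne_zero (mul_ne_zero hx1 hx2) hx3 (by rw [this]; ring)
    have e := congrArg o.v this
    rw [o.mul (mul_ne_zero hx1 hx2) hx3, o.mul hx1 hx2, o.sq hn] at e
    rw [dlt_some h₁ hx1, dlt_some h₂ hx2, dlt_some h₃ hx3, e]
    exact even_two_mul _
  rw [← even_cast] at key
  exact_mod_cast key

/-- The local descent homomorphism. -/
noncomputable def desc (o : OrdVal F) {s : F} (hs1 : s ≠ 1) :
    (Leg s).toAffine.Point →+ ZMod 2 :=
  AddMonoidHom.mk' (fun P => ((o.v (dlt s P) : ℤ) : ZMod 2)) (desc_hom o hs1)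

theorem loc1 (o : OrdVal F) {s x y : F} (e : y ^ 2 = x * (x + 1) * (x + s)) (h0 : x ≠ 0)
    (h1 : x + 1 ≠ 0) (h2 : x + s ≠ 0) (hs : s - 1 ≠ 0) (hs0 : s ≠ 0)
    (v0 : 0 ≤ o.v s) (v1 : o.v (s - 1) = 0) : Even (o.v (x + 1)) := by
  have hy : y ≠ 0 := by
    rintro rfl
    exact mul_ne_zero (mul_ne_zero h0 h1) h2 (by rw [← e]; ring)
  have E := congrArg o.v e
  rw [o.mul (mul_ne_zero h0 h1) h2, o.mul h0 h1, o.sq hy] at E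
  have one := o.one
  rcases lt_or_ge (o.v x) 0 with h | h
  · have a := (o.add_lt h0 (y := 1) (fun _ => by omega)).2
    have b := (o.add_lt h0 (y := s) (fun _ => by omega)).2
    exact ⟨o.v y - o.v x, by omega⟩
  · rcases le_or_gt (o.v (x + 1)) 0 with h' | h'
    · have := o.add' x 1 h0 one_ne_zero h1
      exact ⟨0, by omega⟩
    · have a := (o.add_lt' (x := -1) (y := x + 1) (neg_ne_zero.mpr one_ne_zero)
        (fun _ => by rw [o.neg_one]; omega)).2
      have b := (o.add_lt' (x := s - 1) (y := x + 1) hs (fun _ => by omega)).2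
      rw [show x + 1 + -1 = x by ring, o.neg_one] at a
      rw [show x + 1 + (s - 1) = x + s by ring] at b
      exact ⟨o.v y, by omega⟩

theorem loc0 (o : OrdVal F) {s x y : F} (e : y ^ 2 = x * (x + 1) * (x + s)) (h0 : x ≠ 0)
    (h1 : x + 1 ≠ 0) (h2 : x + s ≠ 0) (hs0 : s ≠ 0)
    (v0 : o.v s = 0) : Even (o.v x) := by
  have hy : y ≠ 0 := by
    rintro rfl
    exact mul_ne_zero (mul_ne_zero h0 h1) h2 (by rw [← e]; ring)
  have E := congrArg o.v e
  rw [o.mul (mul_ne_zero h0 h1) h2, o.mul h0 h1, o.sq hy] at E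
  have one := o.one
  rcases lt_trichotomy (o.v x) 0 with h | h | h
  · have a := (o.add_lt h0 (y := 1) (fun _ => by omega)).2
    have b := (o.add_lt h0 (y := s) (fun _ => by omega)).2
    exact ⟨o.v y - o.v x, by omega⟩
  · simp [h]
  · have a := (o.add_lt' (one_ne_zero) (y := x) (fun _ => by omega)).2
    have b := (o.add_lt' hs0 (y := x) (fun _ => by omega)).2
    exact ⟨o.v y, by omega⟩

theorem locInf (o : OrdVal F) {s x y : F} (e : y ^ 2 = x * (x + 1) * (x + s)) (h0 : x ≠ 0)
    (h1 : x + 1 ≠ 0) (h2 : x + s ≠ 0) (hs0 : s ≠ 0)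
    (v0 : Even (o.v s)) (v1 : o.v s < 0) (v2 : Even (o.v (x + 1))) : Even (o.v x) := by
  have hy : y ≠ 0 := by
    rintro rfl
    exact mul_ne_zero (mul_ne_zero h0 h1) h2 (by rw [← e]; ring)
  have E := congrArg o.v e
  rw [o.mul (mul_ne_zero h0 h1) h2, o.mul h0 h1, o.sq hy] at E
  have one := o.one
  obtain ⟨a, ha⟩ := v0
  obtain ⟨b, hb⟩ := v2
  rcases lt_trichotomy (o.v x) (o.v s) with h | h | h
  · have b := (o.add_lt h0 (y := s) (fun _ => by omega)).2
    rw [b, hb] at E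
    have a := (o.add_lt h0 (y := 1) (fun _ => by omega)).2
    exact ⟨o.v y - o.v x, by omega⟩
  · exact ⟨a, by omega⟩
  · have c := (o.add_lt' hs0 (y := x) (fun _ => by omega)).2
    exact ⟨o.v y - b - a, by omega⟩
end

section
variable {k : Type*} [Field k] [IsAlgClosed k] [DecidableEq (RatFunc k)]

theorem halving (h2 : (2 : RatFunc k) ≠ 0) {s r : RatFunc k} (hs0 : s ≠ 0) (hs1 : s ≠ 1)
    (hsq : s = r ^ 2) (hi : ordInf.v s < 0)
    (v0 : ∀ c : k, 0 ≤ (ordC c).v s) (v0' : ∀ c : k, c ≠ 0 → (ordC c).v s = 0)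
    (v1 : ∀ c : k, (ordC c).v (s - 1) = 0 ∨ (ordC c).v (s - 1) = 1)
    (hex : ∃ c : k, (ordC c).v (s - 1) = 1)
    (P : (Leg s).toAffine.Point)
    (hP : ∀ c : k, (ordC c).v (s - 1) = 1 → desc (ordC c) hs1 P = 0) : ∃ Q, Q + Q = P := by
  rcases P with _ | ⟨x, y, h⟩
  · exact ⟨0, add_zero _⟩
  have e := leg_eq.mp h.1
  have hP' : ∀ c : k, (ordC c).v (s - 1) = 1 → Even ((ordC c).v (dlt s (.some x y h))) :=
    fun c hc => even_cast.mp (hP c hc)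
  have hs' : s - 1 ≠ 0 := sub_ne_zero.mpr hs1
  have hr : r ≠ 0 := by rintro rfl; simp at hsq; exact hs0 hsq
  have hodd : ∀ c : k, (ordC c).v (s - 1) = 1 → ¬ Even ((ordC c).v (1 - s)) := by
    intro c hc; rw [← neg_sub, OrdVal.neg, hc]; decide
  obtain ⟨c0, hc0⟩ := hex
  by_cases h1 : x + 1 = 0
  · exfalso
    have := hP' c0 hc0
    rw [dlt_some' h h1] at this
    exact hodd _ hc0 this
  by_cases h0 : x = 0
  · refine leg_half h2 hs0 hs1 h (a := 0) (b := 1) (c := r) (by simp [h0]) (by simp [h0])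
      (by simp [h0, hsq]) ?_
    rw [h0] at e
    simpa using e
  by_cases hxs : x + s = 0
  · exfalso
    have := hP' c0 hc0
    rw [dlt_some h h1, eq_neg_of_add_eq_zero_left hxs, neg_add_eq_sub] at this
    exact hodd _ hc0 this
  have sq1 : IsSquare (x + 1) := by
    apply isSquare_rat h1
    intro c
    rcases v1 c with hc | hc
    · exact loc1 _ e h0 h1 hxs hs' hs0 (v0 c) hc
    · have := hP' c hc; rwa [dlt_some h h1] at this
  obtain ⟨b, hb⟩ := sq1
  have hb0 : b ≠ 0 := by rintro rfl; simp at hb; exact h1 hb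
  have sq0 : IsSquare x := by
    apply isSquare_rat' h0
    · intro c hc
      exact loc0 _ e h0 h1 hxs hs0 (v0' c hc)
    · refine locInf _ e h0 h1 hxs hs0 ?_ hi ?_
      · rw [hsq, OrdVal.sq _ hr]; exact even_two_mul _
      · rw [hb, OrdVal.mul _ hb0 hb0]; exact ⟨_, rfl⟩
  obtain ⟨a, ha⟩ := sq0
  have ha0 : a ≠ 0 := by rintro rfl; simp at ha; exact h0 ha
  refine leg_half h2 hs0 hs1 h (a := a) (b := b) (c := y / (a * b)) (by rw [ha, pow_two])
    (by rw [hb, pow_two]) ?_ (by field_simp)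
  rw [div_pow, e, hb, mul_pow, pow_two a, ← ha]; field_simp
end
end Ulm


namespace Ulm

theorem exists_rep {A κ : Type*} [Zero A] (m : A → κ) :
    ∃ r : κ → A, ∀ P, m (r (m P)) = m P := by
  classical
  refine ⟨fun i => if h : ∃ P', m P' = i then h.choose else 0, fun P => ?_⟩
  have h : ∃ P', m P' = m P := ⟨P, rfl⟩
  simp only [h, dif_pos]
  exact h.choose_spec

theorem fg_of_height {A : Type*} {ι κ : Type} [AddCommGroup A] [Finite ι] [Finite κ] (h : A → ℕ) (C : ℕ)
    (A0 : Set A) (m : A → ι) (hm : ∀ P P', m P = m P' → ∃ S, P - P' = S + S)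
    (c : A → κ) (hc : ∀ P P', c P = c P' → P - P' ∈ A0)
    (h1 : ∀ P Q, h (P - Q) ≤ 2 * h P + 2 * h Q + C)
    (h2 : ∀ R ∈ A0, R ≠ 0 → R + R ∈ A0 ∧ R + R ≠ 0 ∧ 4 * h R ≤ h (R + R) ∧ 1 ≤ h R) :
    AddGroup.FG A := by
  classical
  obtain ⟨r, hr⟩ := exists_rep m
  choose S hS using fun P => hm P (r (m P)) (hr P).symm
  have claim1 : ∀ n : ℕ, ∃ (κ' : Type) (_ : Finite κ') (g : A → κ'), ∀ P P', g P = g P' →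
      ∃ R ∈ A0, P - P' = (2 ^ n) • R := by
    intro n
    induction n with
    | zero => exact ⟨κ, inferInstance, c, fun P P' e => ⟨_, hc P P' e, by simp⟩⟩
    | succ n ih =>
      obtain ⟨κ', hf, g, hg⟩ := ih
      refine ⟨ι × κ', inferInstance, fun P => (m P, g (S P)), fun P P' e => ?_⟩
      simp only [Prod.mk.injEq] at e
      obtain ⟨R, hR, e2⟩ := hg _ _ e.2
      refine ⟨R, hR, ?_⟩
      have a := hS P
      have b := hS P'
      rw [e.1] at a
      rw [pow_succ, mul_smul, smul_comm, ← e2, two_smul]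
      have : P - P' = (S P + S P) - (S P' + S P') := by rw [← a, ← b]; abel
      rw [this]; abel
  have pw : ∀ n : ℕ, ∀ R ∈ A0, R ≠ 0 → (2 ^ n) • R ∈ A0 ∧ (2 ^ n) • R ≠ 0 ∧
      4 ^ n * h R ≤ h ((2 ^ n) • R) := by
    intro n R hR h0
    induction n with
    | zero => simp [hR, h0]
    | succ n ih =>
      obtain ⟨a, b, e⟩ := ih
      obtain ⟨a', b', e', -⟩ := h2 _ a b
      rw [pow_succ, mul_smul, smul_comm, two_smul]
      refine ⟨a', b', ?_⟩
      calc 4 ^ (n + 1) * h R = 4 * (4 ^ n * h R) := by ring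
        _ ≤ _ := by omega
  have fin : ∀ B : ℕ, {P | h P ≤ B}.Finite := by
    intro B
    obtain ⟨κ', hf, g, hg⟩ := claim1 (4 * B + C)
    refine Set.Finite.of_finite_image (f := g) (Set.toFinite _) ?_
    intro P hP P' hP' e
    obtain ⟨R, hR, e⟩ := hg _ _ e
    by_contra hne
    have h0 : R ≠ 0 := by
      rintro rfl; rw [smul_zero, sub_eq_zero] at e; exact hne e
    obtain ⟨-, -, x⟩ := pw (4 * B + C) R hR h0
    rw [← e] at x
    have y := h1 P P'
    have z := (h2 R hR h0).2.2.2
    have w : 4 * B + C < 4 ^ (4 * B + C) := Nat.lt_pow_self (by norm_num)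
    simp only [Set.mem_ofPred_eq] at hP hP'
    nlinarith
  obtain ⟨κ', hf, g, hg⟩ := claim1 1
  obtain ⟨r', hr'⟩ := exists_rep g
  obtain ⟨D, hD⟩ : ∃ D, ∀ i, h (r' i) ≤ D := by
    have := Fintype.ofFinite κ'
    exact ⟨∑ i, h (r' i), fun i => Finset.single_le_sum (f := fun i => h (r' i))
      (fun _ _ => Nat.zero_le _) (Finset.mem_univ i)⟩
  have hfin : (Set.range r' ∪ {P | h P ≤ 2 * D + C}).Finite :=
    (Set.finite_range r').union (fin _)
  rw [AddGroup.fg_iff]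
  refine ⟨_, ?_, hfin⟩
  rw [eq_top_iff]
  rintro P -
  induction hn : h P using Nat.strong_induction_on generalizing P with
  | _ n ih =>
    by_cases hP : h P ≤ 2 * D + C
    · exact AddSubgroup.subset_closure (Or.inr hP)
    obtain ⟨R, hR, e⟩ := hg P (r' (g P)) (hr' P).symm
    have eP : P = r' (g P) + (R + R) := by
      rw [pow_one, two_smul] at e; rw [← e]; abel
    rw [eP]
    refine add_mem (AddSubgroup.subset_closure (Or.inl ⟨_, rfl⟩)) ?_
    by_cases h0 : R = 0
    · simp [h0]
    have := (h2 R hR h0).2.2.1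
    have e1 := h1 P (r' (g P))
    rw [e, pow_one, two_smul] at e1
    have := hD (g P)
    have := ih (h R) (by omega) rfl
    exact add_mem this this
end Ulm


namespace Ulm
open WeierstrassCurve WeierstrassCurve.Affine

section
variable {F : Type*} [Field F]

/-- local data at a bad place -/
structure LocDat (o : OrdVal F) (c g σ : F) (D : ℕ) : Prop where
  c0 : c ≠ 0
  g0 : g ≠ 0
  σ0 : σ ≠ 0
  two : (2 : F) ≠ 0
  vc : o.v c = 0
  vg : o.v g = 0
  vσ : o.v σ = D
  D0 : 0 < D
  v2 : o.v 2 = 0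
  gc : g ^ 2 = c

variable {o : OrdVal F} {c g σ : F} {D : ℕ} (L : LocDat o c g σ D)

theorem vprod1 (L : LocDat o c g σ D) {a : F} (ha : a ≠ 0) (h : o.v a ≤ 0) :
    a - c * σ ≠ 0 ∧ o.v (a - c * σ) = o.v a := by
  rw [sub_eq_add_neg]
  apply o.add_lt ha
  intro _
  rw [o.neg, o.mul L.c0 L.σ0, L.vc, L.vσ]
  have := L.D0
  omega

theorem vprod2 (L : LocDat o c g σ D) {a : F} (h : 2 * (D : ℤ) ≤ o.v a) :
    a - c * σ ≠ 0 ∧ o.v (a - c * σ) = D := by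
  have e : o.v (-(c * σ)) = D := by rw [o.neg, o.mul L.c0 L.σ0, L.vc, L.vσ]; ring
  have := o.add_lt' (x := -(c * σ)) (y := a) (neg_ne_zero.mpr (mul_ne_zero L.c0 L.σ0)) (by
    intro _; rw [e]; have := L.D0; omega)
  rw [sub_eq_add_neg]
  exact ⟨this.1, this.2.trans e⟩

theorem vw (L : LocDat o c g σ D) {z w : F} (hz : z ≠ 0) (hc : z + c ≠ 0) (hσ : z + σ ≠ 0)
    (e : w ^ 2 * z = (z + c) * (z + σ)) :
    w ≠ 0 ∧ 2 * o.v w + o.v z = o.v (z + c) + o.v (z + σ) := by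
  have hw : w ≠ 0 := by
    rintro rfl
    exact mul_ne_zero hc hσ (by rw [← e]; ring)
  refine ⟨hw, ?_⟩
  have := congrArg o.v e
  rwa [o.mul (pow_ne_zero 2 hw) hz, o.sq hw, o.mul hc hσ] at this

theorem vw1 (L : LocDat o c g σ D) {z w : F} (hz : z ≠ 0) (hc : z + c ≠ 0) (hσ : z + σ ≠ 0)
    (e : w ^ 2 * z = (z + c) * (z + σ)) (h : o.v z ≤ 0) : o.v z ≤ 2 * o.v w := by
  have a := (vw L hz hc hσ e).2
  have b := (o.add_lt (y := σ) hz (fun _ => by rw [L.vσ]; have := L.D0; omega)).2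
  have d := o.add' z c hz L.c0 hc
  rw [L.vc] at d
  omega

theorem vw2 (L : LocDat o c g σ D) {z w : F} (hz : z ≠ 0) (hc : z + c ≠ 0) (hσ : z + σ ≠ 0)
    (e : w ^ 2 * z = (z + c) * (z + σ)) (h : D ≤ o.v z) : D - o.v z ≤ 2 * o.v w := by
  have a := (vw L hz hc hσ e).2
  have b := (o.add_lt' (y := z) L.c0 (fun _ => by rw [L.vc]; have := L.D0; omega)).2
  have d := o.add' z σ hz L.σ0 hσ
  rw [L.vc] at b
  rw [L.vσ] at d
  omega

/-- sign in the middle range -/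
def Sg (o : OrdVal F) (g w : F) : Prop := w - g ≠ 0 → 0 < o.v (w - g)

theorem sg_not (L : LocDat o c g σ D) {z w : F} (hz : z ≠ 0) (hc : z + c ≠ 0) (hσ : z + σ ≠ 0)
    (e : w ^ 2 * z = (z + c) * (z + σ)) (h : 0 < o.v z) (h' : o.v z < D)
    (hs : ¬ Sg o g w) : w + g ≠ 0 → 0 < o.v (w + g) := by
  intro hw
  unfold Sg at hs
  push Not at hs
  obtain ⟨hs1, hs2⟩ := hs
  have key : (w - g) * (w + g) = z + (σ + c * σ / z) := by
    have : z * ((w - g) * (w + g)) = z * (z + (σ + c * σ / z)) := by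
      field_simp
      linear_combination e - z * L.gc
    exact mul_left_cancel₀ hz this
  have hne := mul_ne_zero hs1 hw
  rw [key] at hne
  have a : 1 ≤ o.v (z + (σ + c * σ / z)) := by
    refine o.add_ge (fun _ => by omega) (fun hh => ?_) hne
    refine o.add_ge (fun _ => ?_) (fun _ => ?_) hh
    · rw [L.vσ]; have := L.D0; omega
    · rw [o.div (mul_ne_zero L.c0 L.σ0) hz, o.mul L.c0 L.σ0, L.vc, L.vσ]; omega
  rw [← key, o.mul hs1 hw] at a
  omega

theorem sg_sum {g' : F} (L : LocDat o c g' σ D) {g w₁ w₂ : F} (h : g ≠ 0) (vg : o.v g = 0)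
    (h1 : w₁ - g ≠ 0 → 0 < o.v (w₁ - g)) (h2 : w₂ - g ≠ 0 → 0 < o.v (w₂ - g)) :
    w₁ + w₂ ≠ 0 ∧ o.v (w₁ + w₂) = 0 := by
  have e : o.v (2 * g) = 0 := by rw [o.mul L.two h, L.v2, vg]; rfl
  have := o.add_lt (x := 2 * g) (y := (w₁ - g) + (w₂ - g)) (mul_ne_zero L.two h) (by
    intro hh
    rw [e]
    have : 1 ≤ o.v ((w₁ - g) + (w₂ - g)) := o.add_ge (fun h => h1 h) (fun h => h2 h) hh
    omega)
  rw [show 2 * g + ((w₁ - g) + (w₂ - g)) = w₁ + w₂ by ring, e] at this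
  exact this

open Classical in
/-- local colour -/
noncomputable def lc (o : OrdVal F) (g : F) (D : ℕ) (z w : F) : ℕ :=
  if o.v z ≤ 0 then 0 else if D ≤ o.v z then 1 else
    2 + 2 * (o.v z).toNat + (if Sg o g w then 1 else 0)

theorem lc_le (z w : F) : lc o g D z w ≤ 2 * D + 3 := by
  unfold lc; split_ifs <;> omega

theorem lc_cases {z₁ w₁ z₂ w₂ : F} (h : lc o g D z₁ w₁ = lc o g D z₂ w₂) :
    (o.v z₁ ≤ 0 ∧ o.v z₂ ≤ 0) ∨ (D ≤ o.v z₁ ∧ D ≤ o.v z₂) ∨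
    (0 < o.v z₁ ∧ o.v z₁ < D ∧ o.v z₂ = o.v z₁ ∧ (Sg o g w₁ ↔ Sg o g w₂)) := by
  classical
  unfold lc at h
  by_cases hs : (Sg o g w₁ ↔ Sg o g w₂)
  · simp only [hs] at h
    generalize (if Sg o g w₂ then 1 else 0) = u at h
    simp only [hs, and_true]
    split_ifs at h <;> omega
  · by_cases s1 : Sg o g w₁ <;> by_cases s2 : Sg o g w₂ <;>
      simp only [s1, s2, if_true, if_false, iff_true, iff_false, not_true, not_false_iff] at h hs <;>
      split_ifs at h <;> omega

theorem mid_sum (L : LocDat o c g σ D) {z₁ w₁ z₂ w₂ : F} (hz1 : z₁ ≠ 0) (hc1 : z₁ + c ≠ 0)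
    (hσ1 : z₁ + σ ≠ 0) (e1 : w₁ ^ 2 * z₁ = (z₁ + c) * (z₁ + σ))
    (hz2 : z₂ ≠ 0) (hc2 : z₂ + c ≠ 0)
    (hσ2 : z₂ + σ ≠ 0) (e2 : w₂ ^ 2 * z₂ = (z₂ + c) * (z₂ + σ))
    (h : 0 < o.v z₁ ∧ o.v z₁ < D ∧ o.v z₂ = o.v z₁ ∧ (Sg o g w₁ ↔ Sg o g w₂)) :
    w₁ + w₂ ≠ 0 ∧ o.v (w₁ + w₂) = 0 := by
  obtain ⟨a, b, d, e⟩ := h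
  by_cases hs : Sg o g w₁
  · exact sg_sum L L.g0 L.vg hs (e.mp hs)
  · have s1 := sg_not L hz1 hc1 hσ1 e1 a b hs
    have s2 := sg_not L hz2 hc2 hσ2 e2 (by omega) (by omega) (fun h => hs (e.mpr h))
    refine sg_sum L (g := -g) (neg_ne_zero.mpr L.g0) ?_ ?_ ?_
    · rw [o.neg, L.vg]
    · rwa [sub_neg_eq_add]
    · rwa [sub_neg_eq_add]

theorem loc_diff (L : LocDat o c g σ D) {z₁ w₁ z₂ w₂ Z : F} (hz1 : z₁ ≠ 0) (hc1 : z₁ + c ≠ 0)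
    (hσ1 : z₁ + σ ≠ 0) (e1 : w₁ ^ 2 * z₁ = (z₁ + c) * (z₁ + σ))
    (hz2 : z₂ ≠ 0) (hc2 : z₂ + c ≠ 0)
    (hσ2 : z₂ + σ ≠ 0) (e2 : w₂ ^ 2 * z₂ = (z₂ + c) * (z₂ + σ))
    (h : lc o g D z₁ w₁ = lc o g D z₂ w₂) (hne : z₁ ≠ z₂)
    (hZ : Z * (z₁ - z₂) ^ 2 = z₁ * z₂ * (w₁ + w₂) ^ 2) : Z ≠ 0 ∧ o.v Z ≤ 0 := by
  have hd : z₁ - z₂ ≠ 0 := sub_ne_zero.mpr hne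
  have hp : z₁ * z₂ ≠ 0 := mul_ne_zero hz1 hz2
  have vp := o.mul hz1 hz2
  have D0 := L.D0
  have key : (w₁ - w₂) * (w₁ + w₂) * (z₁ * z₂) = (z₁ - z₂) * (z₁ * z₂ - c * σ) := by
    linear_combination z₂ * e1 - z₁ * e2
  -- from nonvanishing of the sum
  have fin : w₁ + w₂ ≠ 0 → Z ≠ 0 ∧
      o.v Z + 2 * o.v (z₁ - z₂) = o.v z₁ + o.v z₂ + 2 * o.v (w₁ + w₂) := by
    intro hw
    have hZ0 : Z ≠ 0 := by
      rintro rfl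
      exact mul_ne_zero hp (pow_ne_zero 2 hw) (by rw [← hZ]; ring)
    refine ⟨hZ0, ?_⟩
    have := congrArg o.v hZ
    rwa [o.mul hZ0 (pow_ne_zero 2 hd), o.sq hd, o.mul hp (pow_ne_zero 2 hw), o.sq hw, vp] at this
  have aux : z₁ * z₂ - c * σ ≠ 0 → w₁ - w₂ ≠ 0 ∧ w₁ + w₂ ≠ 0 ∧
      o.v (w₁ - w₂) + o.v (w₁ + w₂) + (o.v z₁ + o.v z₂) =
        o.v (z₁ - z₂) + o.v (z₁ * z₂ - c * σ) := by
    intro hq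
    have h0 := mul_ne_zero hd hq
    rw [← key] at h0
    have hm := left_ne_zero_of_mul (left_ne_zero_of_mul h0)
    have hs := right_ne_zero_of_mul (left_ne_zero_of_mul h0)
    refine ⟨hm, hs, ?_⟩
    have := congrArg o.v key
    rwa [o.mul (mul_ne_zero hm hs) hp, o.mul hm hs, o.mul hd hq, vp] at this
  rcases lc_cases h with ⟨a, b⟩ | ⟨a, b⟩ | hm
  · obtain ⟨q, vq⟩ := vprod1 L hp (by rw [vp]; omega)
    obtain ⟨i, j, e⟩ := aux q
    obtain ⟨f0, f⟩ := fin j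
    refine ⟨f0, ?_⟩
    have u1 := vw1 L hz1 hc1 hσ1 e1 a
    have u2 := vw1 L hz2 hc2 hσ2 e2 b
    have w10 := (vw L hz1 hc1 hσ1 e1).1
    have w20 := (vw L hz2 hc2 hσ2 e2).1
    have := o.add' w₁ (-w₂) w10 (neg_ne_zero.mpr w20) (by rwa [← sub_eq_add_neg])
    rw [← sub_eq_add_neg, o.neg] at this
    omega
  · obtain ⟨q, vq⟩ := vprod2 L (a := z₁ * z₂) (by rw [vp]; omega)
    obtain ⟨i, j, e⟩ := aux q
    obtain ⟨f0, f⟩ := fin j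
    refine ⟨f0, ?_⟩
    have u1 := vw2 L hz1 hc1 hσ1 e1 a
    have u2 := vw2 L hz2 hc2 hσ2 e2 b
    have w10 := (vw L hz1 hc1 hσ1 e1).1
    have w20 := (vw L hz2 hc2 hσ2 e2).1
    have := o.add' w₁ (-w₂) w10 (neg_ne_zero.mpr w20) (by rwa [← sub_eq_add_neg])
    rw [← sub_eq_add_neg, o.neg] at this
    omega
  · obtain ⟨i, j⟩ := mid_sum L hz1 hc1 hσ1 e1 hz2 hc2 hσ2 e2 hm
    obtain ⟨f0, f⟩ := fin i
    refine ⟨f0, ?_⟩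
    have := o.add' z₁ (-z₂) hz1 (neg_ne_zero.mpr hz2) (by rwa [← sub_eq_add_neg])
    rw [← sub_eq_add_neg, o.neg] at this
    omega

theorem loc_dbl (L : LocDat o c g σ D) {z w Z : F} (hz : z ≠ 0) (hc : z + c ≠ 0)
    (hσ : z + σ ≠ 0) (e : w ^ 2 * z = (z + c) * (z + σ))
    (h : lc o g D z w = lc o g D z (-w))
    (hZ : Z * (4 * (z * (z + c) * (z + σ))) = (z ^ 2 - c * σ) ^ 2) : Z ≠ 0 ∧ o.v Z ≤ 0 := by
  have D0 := L.D0
  have n4 : (4 : F) ≠ 0 := by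
    rw [show (4 : F) = 2 * 2 by norm_num]; exact mul_ne_zero L.two L.two
  have v4 : o.v (4 : F) = 0 := by
    rw [show (4 : F) = 2 * 2 by norm_num, o.mul L.two L.two, L.v2]; rfl
  have hzz := mul_ne_zero hz hc
  have hzz' := mul_ne_zero hzz hσ
  have fin : z ^ 2 - c * σ ≠ 0 → Z ≠ 0 ∧
      o.v Z + (o.v z + o.v (z + c) + o.v (z + σ)) = 2 * o.v (z ^ 2 - c * σ) := by
    intro hw
    have hZ0 : Z ≠ 0 := by
      rintro rfl
      exact (pow_ne_zero 2 hw) (by rw [← hZ]; ring)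
    refine ⟨hZ0, ?_⟩
    have := congrArg o.v hZ
    rwa [o.mul hZ0 (mul_ne_zero n4 hzz'), o.mul n4 hzz', v4, o.mul hzz hσ, o.mul hz hc, zero_add,
      o.sq hw] at this
  rcases lc_cases h with ⟨a, b⟩ | ⟨a, b⟩ | hm
  · obtain ⟨q, vq⟩ := vprod1 L (pow_ne_zero 2 hz) (by rw [o.sq hz]; omega)
    obtain ⟨f0, f⟩ := fin q
    refine ⟨f0, ?_⟩
    have b := (o.add_lt (y := σ) hz (fun _ => by rw [L.vσ]; have := L.D0; omega)).2
    have d := o.add' z c hz L.c0 hc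
    rw [L.vc] at d
    rw [vq, o.sq hz] at f
    omega
  · obtain ⟨q, vq⟩ := vprod2 L (a := z ^ 2) (by rw [o.sq hz]; omega)
    obtain ⟨f0, f⟩ := fin q
    refine ⟨f0, ?_⟩
    have b := (o.add_lt' (y := z) L.c0 (fun _ => by rw [L.vc]; have := L.D0; omega)).2
    have d := o.add' z σ hz L.σ0 hσ
    rw [L.vc] at b
    rw [L.vσ] at d
    omega
  · have := (mid_sum L hz hc hσ e hz hc hσ (w₂ := -w) (by rw [neg_sq]; exact e) hm).1
    simp at this

/-- Condition of good reduction type at a place. -/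
def Good (o : OrdVal F) {s : F} (e μ : F) : (Leg s).toAffine.Point → Prop
  | .zero => True
  | .some X _ _ => X - e ≠ 0 ∧ o.v ((X - e) / μ ^ 2) ≤ 0

open Classical in
/-- global colour at a place -/
noncomputable def col (o : OrdVal F) (g : F) (D : ℕ) {s : F} (e μ : F) :
    (Leg s).toAffine.Point → ℕ
  | .zero => 0
  | .some x y _ => if x = 0 then 1 else if x = -1 then 2 else if x = -s then 3 else
      4 + lc o g D ((x - e) / μ ^ 2) (y / (μ * (x - e)))

theorem col_le {s e μ : F} (P : (Leg s).toAffine.Point) : col o g D e μ P ≤ 2 * D + 7 := by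
  rcases P with _ | ⟨x, y, h⟩
  · simp [col]
  · have := lc_le (o := o) (g := g) (D := D) ((x - e) / μ ^ 2) (y / (μ * (x - e)))
    simp only [col]; split_ifs <;> omega

theorem col_diff [DecidableEq F] {s e μ : F} (L : LocDat o c g σ D) (hμ : μ ≠ 0)
    (hpoly : ∀ x, x * (x + 1) * (x + s) = (x - e) * (x - e + c * μ ^ 2) * (x - e + σ * μ ^ 2))
    (he : e * (e + 1) * (e + s) = 0)
    (hdbl : ∀ x X, X * (4 * (x * (x + 1) * (x + s))) = (x ^ 2 - s) ^ 2 →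
      (X - e) * (4 * (x * (x + 1) * (x + s))) =
        ((x - e) ^ 2 - (c * μ ^ 2) * (σ * μ ^ 2)) ^ 2)
    (P P' : (Leg s).toAffine.Point) (h : col o g D e μ P = col o g D e μ P') :
    Good o e μ (P - P') := by
  by_cases hPP : P = P'
  · subst hPP
    rw [sub_self]; trivial
  rcases P with _ | ⟨x₁, y₁, h₁⟩ <;> rcases P' with _ | ⟨x₂, y₂, h₂⟩
  · exact absurd rfl hPP
  · simp only [col] at h; split_ifs at h <;> omega
  · simp only [col] at h; split_ifs at h <;> omega
  have E1 := leg_eq.mp h₁.1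
  have E2 := leg_eq.mp h₂.1
  have tors : ∀ a, a * (a + 1) * (a + s) = 0 → x₁ = a → x₂ = a → False := by
    intro a ha e1 e2
    subst e1; subst e2
    rw [ha] at E1 E2
    have b1 := pow_eq_zero_iff two_ne_zero |>.mp E1
    have b2 := pow_eq_zero_iff two_ne_zero |>.mp E2
    apply hPP
    simp only [Point.some.injEq, true_and]
    rw [b1, b2]
  have hh : x₁ ≠ 0 ∧ x₁ ≠ -1 ∧ x₁ ≠ -s ∧ x₂ ≠ 0 ∧ x₂ ≠ -1 ∧ x₂ ≠ -s ∧
      lc o g D ((x₁ - e) / μ ^ 2) (y₁ / (μ * (x₁ - e))) =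
      lc o g D ((x₂ - e) / μ ^ 2) (y₂ / (μ * (x₂ - e))) := by
    have t0 := tors 0 (by ring)
    have t1 := tors (-1) (by ring)
    have t2 := tors (-s) (by ring)
    simp only [col] at h
    split_ifs at h <;> first | omega | exact (t0 ‹_› ‹_›).elim | exact (t1 ‹_› ‹_›).elim |
      exact (t2 ‹_› ‹_›).elim | exact ⟨‹_›, ‹_›, ‹_›, ‹_›, ‹_›, ‹_›, by omega⟩
  obtain ⟨a1, a2, a3, b1, b2, b3, hl⟩ := hh
  have nz : ∀ x y, x ≠ 0 → x ≠ -1 → x ≠ -s → y ^ 2 = x * (x + 1) * (x + s) → 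
      y ≠ 0 ∧ (x - e) ≠ 0 ∧ (x - e) / μ ^ 2 ≠ 0 ∧ (x - e) / μ ^ 2 + c ≠ 0 ∧
      (x - e) / μ ^ 2 + σ ≠ 0 ∧ 
      (y / (μ * (x - e))) ^ 2 * ((x - e) / μ ^ 2) = 
        ((x - e) / μ ^ 2 + c) * ((x - e) / μ ^ 2 + σ) := by
    intro x y h0 h1 h2 hy
    have n0 : x * (x + 1) * (x + s) ≠ 0 := mul_ne_zero (mul_ne_zero h0
      (fun h => h1 (eq_neg_of_add_eq_zero_left h))) (fun h => h2 (eq_neg_of_add_eq_zero_left h))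
    have y0 : y ≠ 0 := by
      rintro rfl; apply n0; rw [← hy]; ring
    rw [hpoly] at n0 hy
    have m0 := left_ne_zero_of_mul (left_ne_zero_of_mul n0)
    have m1 := right_ne_zero_of_mul (left_ne_zero_of_mul n0)
    have m2 := right_ne_zero_of_mul n0
    refine ⟨y0, m0, div_ne_zero m0 (pow_ne_zero 2 hμ), ?_, ?_, ?_⟩
    · intro h; apply m1; field_simp at h; linear_combination h
    · intro h; apply m2; field_simp at h; linear_combination h
    · rw [div_pow, hy]; field_simp
  obtain ⟨y10, c0, c1, c2, c3, c4⟩ := nz x₁ y₁ a1 a2 a3 E1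
  obtain ⟨y20, d0, d1, d2, d3, d4⟩ := nz x₂ y₂ b1 b2 b3 E2
  rw [sub_eq_add_neg, Point.neg_some]
  by_cases hx : x₁ = x₂
  · subst hx
    have hy : y₂ = -y₁ := by
      have : (y₂ - y₁) * (y₂ + y₁) = 0 := by linear_combination E2 - E1
      rcases mul_eq_zero.mp this with h | h
      · exfalso; apply hPP; simp only [Point.some.injEq, true_and]
        exact (sub_eq_zero.mp h).symm
      · exact eq_neg_of_add_eq_zero_left h
    subst hy
    have e3 : Point.some x₁ _ ((nonsingular_neg ..).mpr h₂) = Point.some x₁ y₁ h₁ := by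
      simp only [Point.some.injEq, leg_negY, neg_neg, true_and]
    rw [e3]
    obtain ⟨X, Y, h', e4, e5⟩ := leg_dbl L.two h₁ y10
    rw [e4]
    rw [neg_div] at hl
    have := loc_dbl L c1 c2 c3 c4 hl (Z := (X - e) / μ ^ 2) (by
      have := hdbl _ _ e5
      rw [hpoly] at this
      field_simp
      linear_combination this)
    refine ⟨?_, this.2⟩
    intro h0; apply this.1; rw [h0, zero_div]
  · obtain ⟨X, Y, h', e4, -, e5⟩ := leg_add h₁ ((nonsingular_neg ..).mpr h₂) hx
    rw [e4]
    have := loc_diff L c1 c2 c3 c4 d1 d2 d3 d4 hl (by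
      intro h; apply hx; field_simp at h; linear_combination h) (Z := (X - e) / μ ^ 2) (by
      have := e5 e he
      rw [leg_negY] at this
      field_simp
      linear_combination this)
    refine ⟨?_, this.2⟩
    intro h0; apply this.1; rw [h0, zero_div]
end
end Ulm


namespace Ulm
open WeierstrassCurve WeierstrassCurve.Affine Polynomial

section
variable {k : Type*} [Field k]

/-- height of a rational function -/
noncomputable def hx (f : RatFunc k) : ℕ := max f.num.natDegree f.denom.natDegree

theorem frac_cross {f : RatFunc k} {a b : k[X]} (hb : b ≠ 0)
    (h : f = algebraMap _ (RatFunc k) a / algebraMap _ (RatFunc k) b) :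
    f.num * b = a * f.denom := by
  have hb' : algebraMap _ (RatFunc k) b ≠ 0 := by simpa using hb
  have hd : algebraMap _ (RatFunc k) f.denom ≠ 0 := by simpa using f.denom_ne_zero
  apply RatFunc.algebraMap_injective k
  have := f.num_div_denom
  rw [h, div_eq_div_iff (by rw [← h]; exact hd) hb'] at this
  rw [map_mul, map_mul, h]; exact this

theorem hx_zero : hx (0 : RatFunc k) = 0 := by simp [hx]

theorem hx_le {f : RatFunc k} {a b : k[X]} (hb : b ≠ 0)
    (h : f = algebraMap _ (RatFunc k) a / algebraMap _ (RatFunc k) b) {n : ℕ}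
    (na : a.natDegree ≤ n) (nb : b.natDegree ≤ n) : hx f ≤ n := by
  by_cases ha : a = 0
  · have : f = 0 := by rw [h, ha]; simp
    rw [this, hx_zero]; omega
  have e := frac_cross hb h
  have c := f.isCoprime_num_denom
  have d1 : f.num ∣ a := c.dvd_of_dvd_mul_right (Dvd.intro _ e)
  have d2 : f.denom ∣ b := c.symm.dvd_of_dvd_mul_left (Dvd.intro_left _ e.symm)
  exact max_le ((natDegree_le_of_dvd d1 ha).trans na) ((natDegree_le_of_dvd d2 hb).trans nb)

theorem le_hx {f : RatFunc k} {a b : k[X]} (ha : a ≠ 0) (hb : b ≠ 0) (hc : IsCoprime a b)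
    (h : f = algebraMap _ (RatFunc k) a / algebraMap _ (RatFunc k) b) : a.natDegree ≤ hx f := by
  have e := frac_cross hb h
  have d1 : a ∣ f.num := hc.dvd_of_dvd_mul_right (Dvd.intro _ e.symm)
  have hf : f.num ≠ 0 := by
    intro h0; rw [h0, zero_mul] at e
    exact mul_ne_zero ha f.denom_ne_zero e.symm
  exact (natDegree_le_of_dvd d1 hf).trans (le_max_left _ _)

theorem eval_of_ord {c : k} {f : RatFunc k} {a b : k[X]} (ha : a ≠ 0) (hb : b ≠ 0)
    (hc : IsCoprime a b)
    (h : f = algebraMap _ (RatFunc k) a / algebraMap _ (RatFunc k) b)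
    (hv : (ordC c).v f ≤ 0) : a.eval c ≠ 0 := by
  intro h0
  rw [ordC_eq c ha hb h] at hv
  have p1 := (rootMultiplicity_pos ha).mpr h0
  have p2 : 0 < rootMultiplicity c b := by omega
  have r := (rootMultiplicity_pos hb).mp p2
  obtain ⟨u, w, e⟩ := hc
  have := congrArg (eval c) e
  simp [h0, r.eq_zero] at this

theorem ord_of_eval {c : k} {f : RatFunc k} {a b : k[X]} (hb : b ≠ 0)
    (h : f = algebraMap _ (RatFunc k) a / algebraMap _ (RatFunc k) b)
    (h0 : a.eval c ≠ 0) : f ≠ 0 ∧ (ordC c).v f ≤ 0 := by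
  have ha : a ≠ 0 := by rintro rfl; simp at h0
  constructor
  · rw [h]; apply div_ne_zero <;> simpa
  · rw [ordC_eq c ha hb h, rootMultiplicity_eq_zero (p := a) h0]; omega

theorem ordInf_frac {f : RatFunc k} {a b : k[X]} (ha : a ≠ 0) (hb : b ≠ 0)
    (h : f = algebraMap _ (RatFunc k) a / algebraMap _ (RatFunc k) b) :
    ordInf.v f = b.natDegree - a.natDegree := by
  have hb' : algebraMap _ (RatFunc k) b ≠ 0 := by simpa using hb
  have ha' : algebraMap _ (RatFunc k) a ≠ 0 := by simpa using ha
  rw [h, OrdVal.div _ ha' hb']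
  simp only [ordInf, RatFunc.intDegree_polynomial]; ring

theorem dadd {p q : k[X]} {n : ℕ} (h1 : p.natDegree ≤ n) (h2 : q.natDegree ≤ n) :
    (p + q).natDegree ≤ n := natDegree_add_le_of_degree_le h1 h2

theorem dsub {p q : k[X]} {n : ℕ} (h1 : p.natDegree ≤ n) (h2 : q.natDegree ≤ n) :
    (p - q).natDegree ≤ n := (natDegree_sub_le p q).trans (max_le h1 h2)

theorem dmul {p q : k[X]} {m n l : ℕ} (h1 : p.natDegree ≤ m) (h2 : q.natDegree ≤ n)
    (h : m + n ≤ l) : (p * q).natDegree ≤ l := (natDegree_mul_le_of_le h1 h2).trans h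

theorem dsq {p : k[X]} {m l : ℕ} (h1 : p.natDegree ≤ m)
    (h : 2 * m ≤ l) : (p ^ 2).natDegree ≤ l := (natDegree_pow_le_of_le 2 h1).trans h

theorem hx_quad {S a₁ b₁ a₂ b₂ : k[X]} {h1 h2 D : ℕ} {X' : RatFunc k}
    (u1 : a₁.natDegree ≤ h1) (u2 : b₁.natDegree ≤ h1) (u3 : a₂.natDegree ≤ h2)
    (u4 : b₂.natDegree ≤ h2) (uS : S.natDegree ≤ D)
    (b10 : b₁ ≠ 0) (b20 : b₂ ≠ 0) {x₁ x₂ : RatFunc k}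
    (e1 : x₁ = algebraMap _ (RatFunc k) a₁ / algebraMap _ (RatFunc k) b₁)
    (e2 : x₂ = algebraMap _ (RatFunc k) a₂ / algebraMap _ (RatFunc k) b₂)
    (hne : x₁ ≠ x₂)
    (h : (x₁ - x₂) ^ 2 * X' ^ 2 - 2 * ((x₁ + x₂) * (x₁ * x₂ + algebraMap _ (RatFunc k) S)
        + 2 * (1 + algebraMap _ (RatFunc k) S) * x₁ * x₂) * X'
        + (x₁ * x₂ - algebraMap _ (RatFunc k) S) ^ 2 = 0) :
    hx X' ≤ 2 * h1 + 2 * h2 + 2 * D := by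
  obtain ⟨M, hM⟩ : ∃ M, M = a₁ * b₂ - a₂ * b₁ := ⟨_, rfl⟩
  obtain ⟨N, hN⟩ : ∃ N, N = a₁ * a₂ - S * (b₁ * b₂) := ⟨_, rfl⟩
  obtain ⟨T, hT⟩ : ∃ T, T = 2 * ((a₁ * b₂ + a₂ * b₁) * (a₁ * a₂ + S * (b₁ * b₂)) +
    2 * ((1 + S) * ((a₁ * a₂) * (b₁ * b₂)))) := ⟨_, rfl⟩
  have dM : M.natDegree ≤ h1 + h2 := by
    rw [hM]; exact dsub (dmul u1 u4 le_rfl) (dmul u3 u2 (by omega))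
  have da : (a₁ * a₂).natDegree ≤ h1 + h2 := dmul u1 u3 le_rfl
  have db : (b₁ * b₂).natDegree ≤ h1 + h2 := dmul u2 u4 le_rfl
  have dSb : (S * (b₁ * b₂)).natDegree ≤ D + h1 + h2 := dmul uS db (by omega)
  have dN : N.natDegree ≤ D + h1 + h2 := by
    rw [hN]; exact dsub (da.trans (by omega)) dSb
  have d2 : (2 : k[X]).natDegree ≤ 0 := by simp
  have d1S : (1 + S).natDegree ≤ D := dadd (by simp) uS
  have dT : T.natDegree ≤ D + 2 * (h1 + h2) := by
    rw [hT]
    refine dmul d2 (dadd (dmul (m := h1 + h2) (dadd (dmul u1 u4 le_rfl) (dmul u3 u2 (by omega)))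
      (dadd (da.trans (by omega)) dSb) le_rfl) ?_) (by omega)
    exact dmul d2 (dmul d1S (dmul da db le_rfl) le_rfl) (by omega)
  have nb1 : algebraMap _ (RatFunc k) b₁ ≠ 0 := by simpa using b10
  have nb2 : algebraMap _ (RatFunc k) b₂ ≠ 0 := by simpa using b20
  have hM0 : M ≠ 0 := by
    intro h0; apply hne
    rw [e1, e2, div_eq_div_iff nb1 nb2, ← map_mul, ← map_mul]
    congr 1
    exact sub_eq_zero.mp (hM ▸ h0)
  have hd : algebraMap _ (RatFunc k) X'.denom ≠ 0 := by simpa using X'.denom_ne_zero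
  obtain ⟨α, hα⟩ : ∃ α, α = X'.num := ⟨_, rfl⟩
  obtain ⟨β, hβ⟩ : ∃ β, β = X'.denom := ⟨_, rfl⟩
  have cop := X'.isCoprime_num_denom
  have key : M ^ 2 * α ^ 2 - T * (α * β) + N ^ 2 * β ^ 2 = 0 := by
    apply RatFunc.algebraMap_injective k
    have hX := X'.num_div_denom.symm
    rw [← hα, ← hβ] at hX
    rw [← hβ] at hd
    rw [hX, e1, e2] at h
    field_simp at h
    rw [hM, hN, hT]
    simp only [map_add, map_mul, map_sub, map_pow, map_one, map_zero, map_ofNat]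
    linear_combination h
  rw [← hα, ← hβ] at cop
  have dβ : β ∣ M ^ 2 := by
    have : β ∣ M ^ 2 * α ^ 2 := ⟨T * α - N ^ 2 * β, by linear_combination key⟩
    exact (cop.symm.pow_right (n := 2)).dvd_of_dvd_mul_right this
  have hβd : β.natDegree ≤ 2 * h1 + 2 * h2 + 2 * D :=
    (natDegree_le_of_dvd dβ (pow_ne_zero 2 hM0)).trans (dsq dM (by omega))
  have hαd : α.natDegree ≤ 2 * h1 + 2 * h2 + 2 * D := by
    by_cases hN0 : N = 0
    · by_cases hα0 : α = 0
      · rw [hα0]; simp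
      have : M ^ 2 * α = T * β := by
        apply mul_left_cancel₀ hα0
        rw [hN0] at key; linear_combination key
      have hT0 : T ≠ 0 := by
        rintro rfl
        rw [zero_mul] at this
        exact mul_ne_zero (pow_ne_zero 2 hM0) hα0 this
      have : α ∣ T := cop.dvd_of_dvd_mul_right (Dvd.intro_left _ this)
      exact (natDegree_le_of_dvd this hT0).trans (dT.trans (by omega))
    · have : α ∣ N ^ 2 * β ^ 2 := ⟨T * β - M ^ 2 * α, by linear_combination key⟩
      have : α ∣ N ^ 2 := (cop.pow_right (n := 2)).dvd_of_dvd_mul_right this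
      exact (natDegree_le_of_dvd this (pow_ne_zero 2 hN0)).trans (dsq dN (by omega))
  unfold hx
  rw [← hα, ← hβ]
  exact max_le hαd hβd

/-- height of a point -/
noncomputable def ht {s : RatFunc k} : (Leg s).toAffine.Point → ℕ
  | .zero => 0
  | .some x _ _ => hx x

theorem dbl_frac {S a b : k[X]} {x X' : RatFunc k} (h2 : (2 : RatFunc k) ≠ 0)
    (hb : b ≠ 0)
    (e : x = algebraMap _ (RatFunc k) a / algebraMap _ (RatFunc k) b)
    (hx0 : x * (x + 1) * (x + algebraMap _ (RatFunc k) S) ≠ 0)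
    (h : X' * (4 * (x * (x + 1) * (x + algebraMap _ (RatFunc k) S)))
      = (x ^ 2 - algebraMap _ (RatFunc k) S) ^ 2) :
    4 * (a * b) * ((a + b) * (a + S * b)) ≠ 0 ∧
    X' = algebraMap _ (RatFunc k) ((a ^ 2 - S * b ^ 2) ^ 2) /
      algebraMap _ (RatFunc k) (4 * (a * b) * ((a + b) * (a + S * b))) := by
  have hb' : algebraMap _ (RatFunc k) b ≠ 0 := by simpa using hb
  have n4 : (4 : RatFunc k) ≠ 0 := by
    rw [show (4 : RatFunc k) = 2 * 2 by norm_num]; exact mul_ne_zero h2 h2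
  have E : algebraMap _ (RatFunc k) (4 * (a * b) * ((a + b) * (a + S * b))) =
      4 * (x * (x + 1) * (x + algebraMap _ (RatFunc k) S)) * (algebraMap _ (RatFunc k) b) ^ 4 := by
    simp only [map_add, map_mul, map_ofNat]
    rw [e]; field_simp
  have E0 : algebraMap _ (RatFunc k) (4 * (a * b) * ((a + b) * (a + S * b))) ≠ 0 := by
    rw [E]; exact mul_ne_zero (mul_ne_zero n4 hx0) (pow_ne_zero 4 hb')
  refine ⟨fun h0 => E0 (by rw [h0, map_zero]), ?_⟩
  rw [eq_div_iff E0, E, ← mul_assoc, h]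
  simp only [map_pow, map_sub, map_mul]
  rw [e]; field_simp

variable [DecidableEq (RatFunc k)]

theorem ht_sub {S : k[X]} (h2 : (2 : RatFunc k) ≠ 0)
    (P Q : (Leg (algebraMap _ (RatFunc k) S)).toAffine.Point) :
    ht (P - Q) ≤ 2 * ht P + 2 * ht Q + 2 * S.natDegree := by
  by_cases hPQ : P = Q
  · rw [hPQ, sub_self]; exact Nat.zero_le _
  rcases P with _ | ⟨x₁, y₁, h₁⟩
  · change ht (0 - Q) ≤ _
    rw [zero_sub]
    have : ht (-Q) = ht Q := by
      rcases Q with _ | ⟨x₂, y₂, h₂⟩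
      · rfl
      · rfl
    omega
  rcases Q with _ | ⟨x₂, y₂, h₂⟩
  · change ht (_ - 0) ≤ _
    rw [sub_zero]; omega
  change _ ≤ 2 * hx x₁ + 2 * hx x₂ + 2 * S.natDegree
  have E1 := leg_eq.mp h₁.1
  have E2 := leg_eq.mp h₂.1
  rw [sub_eq_add_neg, Point.neg_some]
  by_cases hx : x₁ = x₂
  · subst hx
    have hy : y₂ = -y₁ := by
      have : (y₂ - y₁) * (y₂ + y₁) = 0 := by linear_combination E2 - E1
      rcases mul_eq_zero.mp this with h | h
      · exfalso; apply hPQ; simp only [Point.some.injEq, true_and]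
        exact (sub_eq_zero.mp h).symm
      · exact eq_neg_of_add_eq_zero_left h
    subst hy
    have e3 : Point.some x₁ _ ((nonsingular_neg ..).mpr h₂) = Point.some x₁ y₁ h₁ := by
      simp only [leg_negY, neg_neg]
    rw [e3]
    by_cases hy : y₁ = 0
    · rw [leg_dbl_zero h₁ hy]; exact Nat.zero_le _
    obtain ⟨X', Y, h', e4, e5⟩ := leg_dbl h2 h₁ hy
    rw [e4]
    obtain ⟨n0, e6⟩ := dbl_frac h2 x₁.denom_ne_zero x₁.num_div_denom.symm
      (by rw [← E1]; exact pow_ne_zero 2 hy) e5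
    have da : x₁.num.natDegree ≤ Ulm.hx x₁ := le_max_left _ _
    have db : x₁.denom.natDegree ≤ Ulm.hx x₁ := le_max_right _ _
    have d4 : (4 : k[X]).natDegree ≤ 0 := by simp
    refine hx_le n0 e6 ?_ ?_
    · refine dsq (m := 2 * Ulm.hx x₁ + S.natDegree)
        (dsub (dsq da (by omega)) (dmul le_rfl (dsq db le_rfl) (by omega))) (by omega)
    · refine dmul (m := 2 * Ulm.hx x₁) (n := 2 * Ulm.hx x₁ + S.natDegree)
        (dmul d4 (dmul da db le_rfl) (by omega)) (dmul (dadd da db)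
        (dadd (da.trans (le_add_of_nonneg_right (Nat.zero_le (S.natDegree))))
          (dmul le_rfl db (by omega))) (by omega)) (by omega)
  · obtain ⟨X', Y, h', e4, e5, -⟩ := leg_add h₁ ((nonsingular_neg ..).mpr h₂) hx
    rw [e4]
    exact hx_quad (le_max_left _ _) (le_max_right _ _) (le_max_left _ _) (le_max_right _ _) le_rfl
      x₁.denom_ne_zero x₂.denom_ne_zero x₁.num_div_denom.symm x₂.num_div_denom.symm hx e5

/-- The good subset. -/
def A0 (S : k[X]) (μ : RatFunc k) : Set (Leg (algebraMap _ (RatFunc k) S)).toAffine.Point :=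
  {P | Good (ordC 0) 0 1 P ∧ (∀ c, S.eval c = 1 → Good (ordC c) (-1) 1 P) ∧ Good ordInf 0 μ P}

theorem a0_dbl [IsAlgClosed k] {S : k[X]} {μ : RatFunc k} (h2 : (2 : RatFunc k) ≠ 0)
    (h2' : (2 : k) ≠ 0)
    (hμ : μ ^ 2 = algebraMap _ (RatFunc k) S) (S0 : S.eval 0 = 0)
    (S0' : ∀ c, S.eval c = 0 → c = 0) (SD : 0 < S.natDegree)
    (P : (Leg (algebraMap _ (RatFunc k) S)).toAffine.Point) (hP : P ∈ A0 S μ) (hP0 : P ≠ 0) :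
    P + P ∈ A0 S μ ∧ P + P ≠ 0 ∧ 4 * ht P ≤ ht (P + P) ∧ 1 ≤ ht P := by
  rcases P with _ | ⟨x, y, h⟩
  · exact absurd rfl hP0
  obtain ⟨⟨g1, g2⟩, g3, g4, g5⟩ := hP
  rw [sub_zero] at g1 g4
  rw [sub_zero, one_pow, div_one] at g2
  rw [sub_zero] at g5
  have g6 : ∀ c, S.eval c = 1 → x + 1 ≠ 0 ∧ (ordC c).v (x + 1) ≤ 0 := by
    intro c hc
    have := g3 c hc
    simp only [Good, sub_neg_eq_add, one_pow, div_one] at this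
    exact this
  have hS0 : S ≠ 0 := by rintro rfl; simp at SD
  have hS0' : algebraMap _ (RatFunc k) S ≠ 0 := by simpa using hS0
  obtain ⟨a, ha⟩ : ∃ a, a = x.num := ⟨_, rfl⟩
  obtain ⟨b, hb⟩ : ∃ b, b = x.denom := ⟨_, rfl⟩
  have ex : x = algebraMap _ (RatFunc k) a / algebraMap _ (RatFunc k) b := by
    rw [ha, hb]; exact x.num_div_denom.symm
  have cop : IsCoprime a b := by rw [ha, hb]; exact x.isCoprime_num_denom
  have b0 : b ≠ 0 := by rw [hb]; exact x.denom_ne_zero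
  have a0 : a ≠ 0 := by rw [ha]; exact RatFunc.num_ne_zero g1
  have b0' : algebraMap _ (RatFunc k) b ≠ 0 := by simpa using b0
  have ncr : ∀ c, a.eval c = 0 → b.eval c = 0 → False := by
    intro c h1 h2
    obtain ⟨u, w, e⟩ := cop
    have := congrArg (eval c) e
    simp [h1, h2] at this
  have ea0 : a.eval 0 ≠ 0 := eval_of_ord a0 b0 cop ex g2
  -- x + 1 ≠ 0 : existence of a root of S - 1
  obtain ⟨c1, hc1⟩ : ∃ c, S.eval c = 1 := by
    obtain ⟨c, hc⟩ := IsAlgClosed.exists_root (S - C 1) (by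
      rw [degree_sub_C (natDegree_pos_iff_degree_pos.mp SD)]
      exact (natDegree_pos_iff_degree_pos.mp SD).ne')
    exact ⟨c, by simpa [sub_eq_zero] using hc⟩
  have x1 : x + 1 ≠ 0 := (g6 c1 hc1).1
  have ex1 : x + 1 = algebraMap _ (RatFunc k) (a + b) / algebraMap _ (RatFunc k) b := by
    rw [map_add, ex]; field_simp
  have ab0 : a + b ≠ 0 := by
    intro h0; rw [h0] at ex1; simp at ex1; exact x1 ex1
  have cop1 : IsCoprime (a + b) b := by
    have := cop.add_mul_left_left 1; rwa [mul_one] at this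
  have eab : ∀ c, S.eval c = 1 → (a + b).eval c ≠ 0 := fun c hc =>
    eval_of_ord ab0 b0 cop1 ex1 (g6 c hc).2
  have deg : b.natDegree + S.natDegree ≤ a.natDegree := by
    have e := ordInf_frac (f := x / μ ^ 2) (a := a) (b := b * S) a0 (mul_ne_zero b0 hS0) (by
      rw [hμ, ex, map_mul]; field_simp)
    rw [e, natDegree_mul b0 hS0] at g5
    push_cast at g5; omega
  have hax : ht (.some x y h) = a.natDegree := by
    change hx x = _
    unfold hx; rw [← ha, ← hb]; omega
  have xs : x + algebraMap _ (RatFunc k) S ≠ 0 := by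
    intro h0
    have : a = - S * b := by
      apply RatFunc.algebraMap_injective k
      rw [ex] at h0
      field_simp at h0
      rw [map_mul, map_neg]; linear_combination h0
    apply ea0; rw [this]; simp [S0]
  have E := leg_eq.mp h.1
  have hne := mul_ne_zero (mul_ne_zero g1 x1) xs
  have hy : y ≠ 0 := by
    rintro rfl; apply hne; rw [← E]; ring
  obtain ⟨X', Y, h', e4, e5⟩ := leg_dbl h2 h hy
  obtain ⟨G0, e6⟩ := dbl_frac h2 b0 ex hne e5
  rw [e4]
  have dSb : (S * b ^ 2).natDegree < (a ^ 2).natDegree := by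
    rw [natDegree_mul hS0 (pow_ne_zero 2 b0), natDegree_pow, natDegree_pow]; omega
  have dF1 : (a ^ 2 - S * b ^ 2).natDegree = 2 * a.natDegree := by
    rw [natDegree_sub_eq_left_of_natDegree_lt dSb, natDegree_pow]
  have F0 : a ^ 2 - S * b ^ 2 ≠ 0 := by
    intro h0; rw [h0, natDegree_zero] at dF1; omega
  have dF : ((a ^ 2 - S * b ^ 2) ^ 2).natDegree = 4 * a.natDegree := by
    rw [natDegree_pow, dF1]; ring
  have copF : IsCoprime ((a ^ 2 - S * b ^ 2) ^ 2) (4 * (a * b) * ((a + b) * (a + S * b))) := by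
    rw [isCoprime_iff_aeval_ne_zero_of_isAlgClosed k k]
    intro c
    by_contra hcon
    push Not at hcon
    obtain ⟨r1, r2⟩ := hcon
    simp only [coe_aeval_eq_eval, eval_pow, eval_sub, eval_mul, eval_add, eval_ofNat] at r1 r2
    have r1' := pow_eq_zero_iff two_ne_zero |>.mp r1
    have n4 : (4 : k) ≠ 0 := by
      rw [show (4 : k) = 2 * 2 by norm_num]; exact mul_ne_zero h2' h2'
    have hca : eval c a ≠ 0 := by
      intro h0
      have hbc : eval c b ≠ 0 := fun h => ncr c h0 h
      rw [h0] at r1'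
      have : eval c S = 0 := by
        have : eval c S * eval c b ^ 2 = 0 := by linear_combination -r1'
        exact (mul_eq_zero.mp this).resolve_right (pow_ne_zero 2 hbc)
      have := S0' c this
      subst this
      exact ea0 h0
    have hcb : eval c b ≠ 0 := by
      intro h0
      rw [h0] at r1'
      apply hca
      apply pow_eq_zero_iff two_ne_zero |>.mp
      linear_combination r1'
    have hcab : eval c a + eval c b ≠ 0 := by
      intro h0
      have : eval c S = 1 := by
        apply mul_right_cancel₀ (pow_ne_zero 2 hcb)
        linear_combination -r1' + (eval c a - eval c b) * h0
      apply eab c this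
      rw [eval_add, h0]
    have hcs : eval c a + eval c S * eval c b ≠ 0 := by
      intro h0
      have hS' : eval c S * (eval c S - 1) * eval c b ^ 2 = 0 := by
        linear_combination r1' + (eval c S * eval c b - eval c a) * h0
      rcases mul_eq_zero.mp ((mul_eq_zero.mp hS').resolve_right (pow_ne_zero 2 hcb)) with h3 | h3
      · rw [h3] at h0; apply hca; linear_combination h0
      · apply hcab; linear_combination h0 - eval c b * h3
    exact mul_ne_zero (mul_ne_zero n4 (mul_ne_zero hca hcb)) (mul_ne_zero hcab hcs) r2
  have FF0 := pow_ne_zero 2 F0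
  refine ⟨⟨?_, ?_, ?_⟩, Point.some_ne_zero _, ?_, ?_⟩
  · simp only [Good, sub_zero, one_pow, div_one]
    refine ord_of_eval G0 e6 ?_
    simp only [eval_pow, eval_sub, eval_mul, S0, zero_mul, sub_zero]
    exact pow_ne_zero 2 (pow_ne_zero 2 ea0)
  · intro c hc
    simp only [Good, sub_neg_eq_add, one_pow, div_one]
    refine ord_of_eval (a := (a ^ 2 + 2 * a * b + S * b ^ 2) ^ 2) G0 ?_ ?_
    · have G0' : algebraMap _ (RatFunc k) (4 * (a * b) * ((a + b) * (a + S * b))) ≠ 0 := by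
        simpa only [ne_eq, FaithfulSMul.algebraMap_eq_zero_iff] using G0
      rw [e6, eq_div_iff G0', add_mul, div_mul_cancel₀ _ G0', one_mul, ← map_add]
      congr 1
      ring
    · have := eab c hc
      rw [eval_add] at this
      simp only [eval_pow, eval_add, eval_mul, eval_ofNat, hc]
      have e : eval c a ^ 2 + 2 * eval c a * eval c b + 1 * eval c b ^ 2 =
        (eval c a + eval c b) ^ 2 := by ring
      rw [e]
      exact pow_ne_zero 2 (pow_ne_zero 2 this)
  · simp only [Good, sub_zero]
    constructor
    · rw [e6]
      apply div_ne_zero <;> simpa only [ne_eq, FaithfulSMul.algebraMap_eq_zero_iff]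
    have e := ordInf_frac (f := X' / μ ^ 2) (a := (a ^ 2 - S * b ^ 2) ^ 2)
      (b := (4 * (a * b) * ((a + b) * (a + S * b))) * S) FF0 (mul_ne_zero G0 hS0) (by
      rw [hμ, e6, div_div, ← map_mul])
    rw [e, dF, natDegree_mul G0 hS0]
    have d4 : (4 : k[X]).natDegree ≤ 0 := by simp
    have : (4 * (a * b) * ((a + b) * (a + S * b))).natDegree ≤ 3 * a.natDegree + b.natDegree := by
      refine dmul (m := a.natDegree + b.natDegree) (n := a.natDegree + a.natDegree)
        (dmul d4 (dmul le_rfl le_rfl le_rfl) (by omega)) (dmul (dadd le_rfl (by omega))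
        (dadd le_rfl (dmul le_rfl le_rfl (by omega))) (by omega)) (by omega)
    push_cast; omega
  · rw [hax, ← dF]
    exact le_hx FF0 G0 copF e6
  · rw [hax]; omega
end
end Ulm


namespace Ulm
open WeierstrassCurve WeierstrassCurve.Affine Polynomial

set_option linter.unusedSectionVars false
section
variable {k : Type*} [Field k]

/-- the polynomial `16 X^d` -/
noncomputable def SP (k : Type*) [Field k] (d : ℕ) : k[X] := C 16 * X ^ d

/-- `16 X^d` as a rational function -/
noncomputable def sR (k : Type*) [Field k] (d : ℕ) : RatFunc k := algebraMap _ (RatFunc k) (SP k d)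

variable {d : ℕ} (h2 : (2 : k) ≠ 0) (hd : 0 < d) (hdk : (d : k) ≠ 0)

include h2 in
theorem n16 : (16 : k) ≠ 0 := by
  have : (16 : k) = 2 ^ 4 := by norm_num
  rw [this]; exact pow_ne_zero 4 h2

include h2 in
theorem two_R : (2 : RatFunc k) ≠ 0 := by
  have : (2 : RatFunc k) = RatFunc.C 2 := (map_ofNat RatFunc.C 2).symm
  rw [this]; simpa using h2

include h2 in
theorem SP_ne : SP k d ≠ 0 := mul_ne_zero (by simpa using n16 h2) (pow_ne_zero _ X_ne_zero)

include h2 in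
theorem SP_deg : (SP k d).natDegree = d := by
  rw [SP, natDegree_C_mul_X_pow _ _ (n16 h2)]

include h2 in
theorem sR_ne : sR k d ≠ 0 := by
  simpa [sR] using SP_ne (d := d) h2

theorem sR_eq : sR k d = 16 * RatFunc.X ^ d := by
  rw [sR, SP, map_mul, map_pow, RatFunc.algebraMap_C, RatFunc.algebraMap_X, map_ofNat]

include hd in
theorem SP_eval0 : (SP k d).eval 0 = 0 := by simp [SP, hd.ne']

include h2 in
theorem SP_eval {c : k} (h : (SP k d).eval c = 0) : c = 0 := by
  simp only [SP, eval_mul, eval_C, eval_pow, eval_X, mul_eq_zero, n16 h2, false_or] at h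
  by_contra hc
  exact pow_ne_zero _ hc h

include h2 hd in
theorem SP1_ne : SP k d - 1 ≠ 0 := by
  intro h
  have := congrArg (eval 0) h
  simp [SP_eval0 hd] at this

theorem sR1_eq : sR k d - 1 = algebraMap _ (RatFunc k) (SP k d - 1) := by simp [sR]

include h2 hd in
theorem sR1_ne : sR k d ≠ 1 := by
  rw [← sub_ne_zero, sR1_eq]; simpa only [ne_eq, FaithfulSMul.algebraMap_eq_zero_iff] using SP1_ne h2 hd

include h2 in
theorem sR_ord0 : (ordC 0).v (sR k d) = d := by
  rw [sR, ordC_poly _ (SP_ne h2), SP, rootMultiplicity_mul (SP_ne h2), rootMultiplicity_C]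
  have := rootMultiplicity_X_sub_C_pow (0 : k) d
  rw [C_0, sub_zero] at this
  rw [this]; simp

include h2 in
theorem sR_ordc {c : k} (hc : c ≠ 0) : (ordC c).v (sR k d) = 0 := by
  rw [sR, ordC_poly _ (SP_ne h2), rootMultiplicity_eq_zero]; simp
  intro h
  exact hc (SP_eval h2 h)

include h2 in
theorem sR_ordI : ordInf.v (sR k d) = -d := by
  change - (sR k d).intDegree = _
  rw [sR, RatFunc.intDegree_polynomial, SP_deg h2]

include h2 hd in
theorem sR1_ord {c : k} (hc : (SP k d).eval c ≠ 1) : (ordC c).v (sR k d - 1) = 0 := by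
  rw [sR1_eq, ordC_poly _ (SP1_ne h2 hd), rootMultiplicity_eq_zero]; simp
  intro h
  apply hc
  simpa [sub_eq_zero] using h

include h2 hd hdk in
theorem sR1_ord' {c : k} (hc : (SP k d).eval c = 1) : (ordC c).v (sR k d - 1) = 1 := by
  rw [sR1_eq, ordC_poly _ (SP1_ne h2 hd)]
  have h1 : 0 < rootMultiplicity c (SP k d - 1) := by
    rw [rootMultiplicity_pos (SP1_ne h2 hd)]; simp [hc]
  have h3 : ¬ 1 < rootMultiplicity c (SP k d - 1) := by
    rw [one_lt_rootMultiplicity_iff_isRoot (SP1_ne h2 hd)]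
    rintro ⟨-, h⟩
    have c0 : c ≠ 0 := by
      rintro rfl
      rw [SP_eval0 hd] at hc
      exact zero_ne_one hc
    have : eval c (derivative (SP k d - 1)) = 0 := h
    simp only [SP, derivative_sub, derivative_C_mul, derivative_X_pow, derivative_one] at this
    simp [n16 h2, hdk, c0] at this
  omega

end

section
variable {k : Type*} [Field k] [IsAlgClosed k] [DecidableEq (RatFunc k)]
variable {d : ℕ} (h2 : (2 : k) ≠ 0) (hd : 0 < d) (hdk : (d : k) ≠ 0)
  {α : Fin d → k} (hα : ∀ c, (SP k d).eval c = 1 ↔ ∃ j, c = α j)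

theorem ord_const {c a : k} (h : a ≠ 0) : (ordC c).v (RatFunc.C a) = 0 := by
  rw [← RatFunc.algebraMap_C, ordC_poly _ (by simpa using h), rootMultiplicity_C]; simp

theorem ordI_const {a : k} : ordInf.v (RatFunc.C a) = 0 := by
  change - (RatFunc.C a).intDegree = _
  simp

include h2 hd in
theorem loc_0 : LocDat (ordC 0) 1 1 (sR k d) d where
  c0 := one_ne_zero
  g0 := one_ne_zero
  σ0 := sR_ne h2
  two := two_R h2
  vc := OrdVal.one _
  vg := OrdVal.one _
  vσ := sR_ord0 h2
  D0 := hd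
  v2 := by rw [show (2 : RatFunc k) = RatFunc.C 2 from (map_ofNat RatFunc.C 2).symm]; exact ord_const h2
  gc := one_pow 2

include h2 hd in
theorem loc_I : LocDat ordInf 1 1 ((sR k d)⁻¹) d where
  c0 := one_ne_zero
  g0 := one_ne_zero
  σ0 := inv_ne_zero (sR_ne h2)
  two := two_R h2
  vc := OrdVal.one _
  vg := OrdVal.one _
  vσ := by rw [OrdVal.inv _ (sR_ne h2), sR_ordI h2]; simp
  D0 := hd
  v2 := by rw [show (2 : RatFunc k) = RatFunc.C 2 from (map_ofNat RatFunc.C 2).symm]; exact ordI_const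
  gc := one_pow 2

include h2 hd hdk in
theorem loc_a {c i : k} (hi : i ^ 2 = -1) (hc : (SP k d).eval c = 1) :
    LocDat (ordC c) (-1) (RatFunc.C i) (sR k d - 1) 1 where
  c0 := by simp
  g0 := by
    rw [ne_eq, map_eq_zero]
    rintro rfl
    norm_num at hi
  σ0 := sub_ne_zero.mpr (sR1_ne h2 hd)
  two := two_R h2
  vc := OrdVal.neg_one _
  vg := ord_const (by rintro rfl; norm_num at hi)
  vσ := sR1_ord' h2 hd hdk hc
  D0 := one_pos
  v2 := by rw [show (2 : RatFunc k) = RatFunc.C 2 from (map_ofNat RatFunc.C 2).symm]; exact ord_const h2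
  gc := by rw [← map_pow, hi]; simp

include h2 hd hdk hα in
theorem halv (hev : Even d) (P : (Leg (sR k d)).toAffine.Point)
    (hP : ∀ j, desc (ordC (α j)) (sR1_ne h2 hd) P = 0) : ∃ Q, Q + Q = P := by
  obtain ⟨e, he⟩ := hev
  refine halving (two_R h2) (r := 4 * RatFunc.X ^ e) (sR_ne h2) (sR1_ne h2 hd) ?_ ?_ ?_ ?_ ?_ ?_ P ?_
  · rw [sR_eq, he, ← two_mul, mul_pow, ← pow_mul, mul_comm e]; norm_num
  · rw [sR_ordI h2]; omega
  · intro c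
    by_cases hc : c = 0
    · rw [hc, sR_ord0 h2]; omega
    · rw [sR_ordc h2 hc]
  · intro c hc
    exact sR_ordc h2 hc
  · intro c
    by_cases hc : (SP k d).eval c = 1
    · exact Or.inr (sR1_ord' h2 hd hdk hc)
    · exact Or.inl (sR1_ord h2 hd hc)
  · exact ⟨α ⟨0, hd⟩, sR1_ord' h2 hd hdk ((hα _).mpr ⟨_, rfl⟩)⟩
  · intro c hc
    by_cases h : (SP k d).eval c = 1
    · obtain ⟨j, rfl⟩ := (hα c).mp h
      exact hP j
    · rw [sR1_ord h2 hd h] at hc; omega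

/-- the descent map -/
noncomputable def dm (hs : sR k d ≠ 1) (α : Fin d → k) :
    (Leg (sR k d)).toAffine.Point →+ (Fin d → ZMod 2) :=
  AddMonoidHom.pi fun j => desc (ordC (α j)) hs

include h2 hd hdk hα in
theorem leg_fg (hev : Even d) : AddGroup.FG (Leg (sR k d)).toAffine.Point := by
  obtain ⟨e, he⟩ := id hev
  set μ : RatFunc k := 4 * RatFunc.X ^ e with hμ
  have hμ2 : μ ^ 2 = sR k d := by
    rw [sR_eq, he, ← two_mul, mul_pow, ← pow_mul, mul_comm e]; norm_num
  have hμ0 : μ ≠ 0 := by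
    intro h
    rw [h] at hμ2
    exact sR_ne (d := d) h2 (by rw [← hμ2]; simp)
  obtain ⟨i, hi⟩ := IsAlgClosed.exists_pow_nat_eq (-1 : k) (n := 2) two_pos
  have hs := sR1_ne (k := k) h2 hd
  refine fg_of_height (ι := Fin d → ZMod 2) (κ := Fin (2 * d + 8) × (Fin d → Fin (2 * 1 + 8)) × Fin (2 * d + 8))
    ht (2 * (SP k d).natDegree) (A0 (SP k d) μ) (dm hs α) ?_
    (fun P => (⟨col (ordC 0) 1 d 0 1 P, Nat.lt_succ_of_le (col_le P)⟩,
      fun j => ⟨col (ordC (α j)) (RatFunc.C i) 1 (-1) 1 P, Nat.lt_succ_of_le (col_le P)⟩,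
      ⟨col ordInf 1 d 0 μ P, Nat.lt_succ_of_le (col_le P)⟩)) ?_ ?_ ?_
  · intro P P' h
    obtain ⟨Q, hQ⟩ := halv h2 hd hdk hα hev (P - P') (by
      intro j
      have := congrFun h j
      rw [map_sub, sub_eq_zero]
      exact this)
    exact ⟨Q, hQ.symm⟩
  · intro P P' h
    simp only [Prod.mk.injEq, Fin.mk.injEq, funext_iff] at h
    obtain ⟨a, b, c⟩ := h
    refine ⟨?_, ?_, ?_⟩
    · refine col_diff (loc_0 h2 hd) one_ne_zero ?_ ?_ ?_ P P' a
      · intro x; ring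
      · ring
      · intro x X h
        change X * (4 * (x * (x + 1) * (x + sR k d))) = (x ^ 2 - sR k d) ^ 2 at h
        linear_combination h
    · intro c hc
      obtain ⟨j, rfl⟩ := (hα c).mp hc
      refine col_diff (loc_a h2 hd hdk hi hc) one_ne_zero ?_ ?_ ?_ P P' (b j)
      · intro x; change _ * (x + sR k d) = _; ring
      · change _ * (-1 + sR k d) = _; ring
      · intro x X h
        change X * (4 * (x * (x + 1) * (x + sR k d))) = (x ^ 2 - sR k d) ^ 2 at h
        linear_combination h
    · have hi : (sR k d)⁻¹ * sR k d = 1 := inv_mul_cancel₀ (sR_ne h2)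
      refine col_diff (loc_I h2 hd) hμ0 ?_ ?_ ?_ P P' c
      · intro x; change _ * (x + sR k d) = _
        rw [hμ2, hi]; ring
      · ring
      · intro x X h
        change X * (4 * (x * (x + 1) * (x + sR k d))) = (x ^ 2 - sR k d) ^ 2 at h
        rw [hμ2, hi]
        linear_combination h
  · intro P Q
    exact ht_sub (two_R h2) P Q
  · intro R hR hR0
    exact a0_dbl (two_R h2) h2 hμ2 (SP_eval0 hd) (fun c hc => SP_eval h2 hc) (by rw [SP_deg h2]; exact hd) R hR hR0

end
end Ulm


namespace Ulm
open WeierstrassCurve WeierstrassCurve.Affine Polynomial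

set_option linter.unusedSectionVars false
section
variable {F : Type*} [Field F]

theorem q_eqn {t v y : F} {q e : ℕ} (he : q + 1 = 2 * e) (ht : t = v ^ (q + 1))
    (hF : (1 + 4 * v) ^ q = 1 + 4 * v ^ q) (hy : y = 4 * v * (1 + 4 * v) ^ e) :
    y ^ 2 = (4 * v) * (4 * v + 1) * (4 * v + 16 * t) := by
  have : ((1 + 4 * v) ^ e) ^ 2 = (1 + 4 * v ^ q) * (1 + 4 * v) := by
    rw [← hF, ← pow_succ, ← pow_mul, he, mul_comm e 2]
  rw [hy, ht, mul_pow, this, pow_succ]; ring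

theorem iso_Q [DecidableEq F] (h20 : (2 : F) ≠ 0) {t v Y y : F} (ht0 : t ≠ 0) (ht1 : 16 * t ≠ 1) {q e : ℕ}
    (he : q + 1 = 2 * e) (hv : v ≠ 0)
    (h1 : 1 + 4 * v ≠ 0) (ht : t = v ^ (q + 1)) (hF : (1 + 4 * v) ^ q = 1 + 4 * v ^ q)
    (hP : (UE t).toAffine.Nonsingular (ulmerX q v) Y) (hy : y = 4 * v * (1 + 4 * v) ^ e)
    (hQ : (Leg (16 * t)).toAffine.Nonsingular (4 * v) y) :
    iso h20 ht0 ht1 (.some _ _ hP) = .some _ _ hQ + .some _ _ hQ ∨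
    iso h20 ht0 ht1 (.some _ _ hP) = -(.some _ _ hQ + .some _ _ hQ) := by
  have n4 : (4 : F) ≠ 0 := by rw [show (4 : F) = 2 * 2 by norm_num]; exact mul_ne_zero h20 h20
  have hy0 : y ≠ 0 := by
    rw [hy]; exact mul_ne_zero (mul_ne_zero n4 hv) (pow_ne_zero _ h1)
  have hb : (1 + 4 * v ^ q) ≠ 0 := by rw [← hF]; exact pow_ne_zero _ h1
  have hw : v ^ q ≠ 0 := pow_ne_zero _ hv
  have eX : ulmerX q v = v ^ q * (v ^ q - v) / (1 + 4 * v ^ q) := by rw [ulmerX, hF]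
  have ht' : t = v ^ q * v := by rw [ht, pow_succ]
  generalize ulmerX q v = x at *
  have e1 : x + t = (v ^ q) ^ 2 * (1 + 4 * v) / (1 + 4 * v ^ q) := by
    have hgen : ∀ w : F, 1 + 4 * w ≠ 0 → w * (w - v) / (1 + 4 * w) + w * v =
        w ^ 2 * (1 + 4 * v) / (1 + 4 * w) := by
      intro w hw; rw [div_add' _ _ _ hw]; congr 1; ring
    rw [eX, ht']; exact hgen _ hb
  have hx : x + t ≠ 0 := by
    rw [e1]; exact div_ne_zero (mul_ne_zero (pow_ne_zero _ hw) h1) hb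
  obtain ⟨h', e2⟩ := iso_some h20 ht0 ht1 hP hx rfl rfl
  obtain ⟨X, Y', h'', e3, e4⟩ := leg_dbl h20 hQ hy0
  rw [e2, e3]
  apply Point.X_eq_iff.mp
  rw [ue_g h20 hP.1 hx]
  have e5 : 4 * (x + t + (1 / 4 - 2 * t) + t ^ 2 / (x + t)) - 1 = 4 * x ^ 2 / (x + t) := by
    field_simp; ring
  rw [e5, e1, eX]
  rw [← q_eqn he ht hF hy, q_eqn he ht hF hy, ht'] at e4
  clear hQ h'' h' e2 e3 hP
  generalize v ^ q = w at *
  have e6 : X * ((1 + 4 * v) * (1 + 4 * w)) = 4 * (w - v) ^ 2 := by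
    have : (64 : F) * v ^ 2 ≠ 0 := mul_ne_zero (by
      rw [show (64 : F) = 2 ^ 6 by norm_num]; exact pow_ne_zero _ h20) (pow_ne_zero _ hv)
    apply mul_left_cancel₀ this
    linear_combination e4
  field_simp
  linear_combination -e6
end

section
variable {k : Type*} [Field k] [IsAlgClosed k] [DecidableEq (RatFunc k)]

/-- `ζ^i u` -/
noncomputable def vv (ζ : k) (i : ℕ) : RatFunc k := RatFunc.C (ζ ^ i) * RatFunc.X

/-- `α_j` -/
noncomputable def al (ζ : k) (d : ℕ) (j : Fin d) : k := -1 / (4 * ζ ^ (j : ℕ))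

variable {d : ℕ} {ζ : k}

theorem al_iff (h2 : (2 : k) ≠ 0) (hd : 0 < d) (hev : Even d) (h4 : (4 : k) ^ d = 16)
    (hζ : IsPrimitiveRoot ζ d) (c : k) : (SP k d).eval c = 1 ↔ ∃ j, c = al ζ d j := by
  have n4 : (4 : k) ≠ 0 := by rw [show (4 : k) = 2 * 2 by norm_num]; exact mul_ne_zero h2 h2
  have hz : ζ ≠ 0 := hζ.ne_zero hd.ne'
  have : NeZero d := ⟨hd.ne'⟩
  simp only [SP, eval_mul, eval_C, eval_pow, eval_X]
  constructor
  · intro h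
    have c0 : c ≠ 0 := by
      rintro rfl
      simp [hd.ne'] at h
    obtain ⟨i, hi, e⟩ := hζ.eq_pow_of_pow_eq_one (ξ := -1 / (4 * c)) (by
      rw [div_pow, mul_pow, hev.neg_one_pow, h4, h, div_one])
    refine ⟨⟨i, hi⟩, ?_⟩
    simp only [al, e]
    field_simp
  · rintro ⟨j, rfl⟩
    rw [al, div_pow, mul_pow, hev.neg_one_pow, h4, ← pow_mul, mul_comm _ d, pow_mul, hζ.pow_eq_one]
    simp [n16 h2]

theorem vv1_eq (i : ℕ) : 4 * vv ζ i + 1 = algebraMap _ (RatFunc k) (1 + C (4 * ζ ^ i) * X) := by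
  rw [vv, map_add, map_mul, RatFunc.algebraMap_C, RatFunc.algebraMap_X, map_one, map_mul, map_ofNat]
  ring

theorem vv1_pne (i : ℕ) : (1 + C (4 * ζ ^ i) * X) ≠ 0 := by
  intro h
  have := congrArg (eval 0) h
  simp at this

theorem vv1_ne (i : ℕ) : 4 * vv ζ i + 1 ≠ 0 := by
  rw [vv1_eq]
  simpa only [ne_eq, FaithfulSMul.algebraMap_eq_zero_iff] using vv1_pne i

theorem vv1_ord (h2 : (2 : k) ≠ 0) (hd : 0 < d) (hζ : IsPrimitiveRoot ζ d) (i j : Fin d) :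
    (ordC (al ζ d j)).v (4 * vv ζ i + 1) = if i = j then 1 else 0 := by
  have n4 : (4 : k) ≠ 0 := by rw [show (4 : k) = 2 * 2 by norm_num]; exact mul_ne_zero h2 h2
  have hz : ζ ≠ 0 := hζ.ne_zero hd.ne'
  have hzi : ∀ i : ℕ, ζ ^ i ≠ 0 := fun i => pow_ne_zero i hz
  rw [vv1_eq, ordC_poly _ (vv1_pne _)]
  split_ifs with h
  · subst h
    have h1 : 0 < rootMultiplicity (al ζ d i) (1 + C (4 * ζ ^ (i : ℕ)) * X) := by
      rw [rootMultiplicity_pos (vv1_pne _)]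
      simp only [IsRoot, al, eval_add, eval_one, eval_mul, eval_C, eval_X]
      have := hzi i
      field_simp; ring
    have h3 : ¬ 1 < rootMultiplicity (al ζ d i) (1 + C (4 * ζ ^ (i : ℕ)) * X) := by
      rw [one_lt_rootMultiplicity_iff_isRoot (vv1_pne _)]
      rintro ⟨-, h⟩
      have h' : eval (al ζ d i) (derivative (1 + C (4 * ζ ^ (i : ℕ)) * X)) = 0 := h
      rw [derivative_add, derivative_one, derivative_C_mul, derivative_X, mul_one, zero_add, eval_C] at h'
      exact mul_ne_zero n4 (hzi _) h'
    omega
  · rw [rootMultiplicity_eq_zero]; simp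
    intro h'
    apply h
    simp only [IsRoot, al, eval_add, eval_one, eval_mul, eval_C, eval_X] at h'
    have := hzi j
    field_simp at h'
    apply Fin.ext
    apply hζ.pow_inj i.2 j.2
    linear_combination -h'

theorem leg_main (h2 : (2 : k) ≠ 0) (hd : 0 < d) (hdk : (d : k) ≠ 0) (hev : Even d) (h4 : (4 : k) ^ d = 16)
    (hζ : IsPrimitiveRoot ζ d) : AddGroup.FG (Leg (16 * RatFunc.X ^ d : RatFunc k)).toAffine.Point ∧
    ∃ m : (Leg (16 * RatFunc.X ^ d : RatFunc k)).toAffine.Point →+ (Fin d → ZMod 2),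
      (∀ P, m P = 0 → ∃ Q, Q + Q = P) ∧ 
      ∀ (i : Fin d) y (h : (Leg (16 * RatFunc.X ^ d : RatFunc k)).toAffine.Nonsingular (4 * vv ζ i) y),
        m (.some _ _ h) = Pi.single i 1 := by
  rw [← sR_eq]
  have hα := al_iff h2 hd hev h4 hζ
  refine ⟨leg_fg h2 hd hdk hα hev, dm (sR1_ne h2 hd) (al ζ d), ?_, ?_⟩
  · intro P hP
    exact halv h2 hd hdk hα hev P (fun j => congrFun hP j)
  · intro i y h
    ext j
    change (((ordC (al ζ d j)).v (dlt _ (.some _ _ h)) : ℤ) : ZMod 2) = _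
    rw [dlt_some _ (vv1_ne _), vv1_ord h2 hd hζ, Pi.single_apply]
    by_cases hij : i = j
    · simp [hij]
    · simp [hij, Ne.symm hij]
end
end Ulm


namespace Ulm

section
open Module

theorem finrank_eq_of {M N : Type*} [AddCommGroup M] [AddCommGroup N] [Module.Finite ℤ M]
    [Module.Finite ℤ N] (f : M →+ N) (hk : ∀ x, f x = 0 → ∃ n : ℕ, n ≠ 0 ∧ n • x = 0)
    (hc : ∀ y, ∃ n : ℕ, n ≠ 0 ∧ ∃ x, f x = n • y) : finrank ℤ M = finrank ℤ N := by
  let g := f.toIntLinearMap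
  have h1 := Submodule.finrank_quotient_add_finrank (LinearMap.ker g)
  have h2 := Submodule.finrank_quotient_add_finrank (LinearMap.range g)
  have h3 := g.quotKerEquivRange.finrank_eq
  have h4 : finrank ℤ (LinearMap.ker g) = 0 := by
    rw [finrank_eq_zero_iff_isTorsion]
    rintro ⟨x, hx⟩
    obtain ⟨n, hn, e⟩ := hk x hx
    refine ⟨⟨(n : ℤ), by simpa using hn⟩, ?_⟩
    apply Subtype.ext
    change (n : ℤ) • x = 0
    simpa using e
  have h5 : finrank ℤ (N ⧸ LinearMap.range g) = 0 := by
    rw [finrank_eq_zero_iff_isTorsion]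
    rintro ⟨y⟩
    obtain ⟨n, hn, x, e⟩ := hc y
    refine ⟨⟨(n : ℤ), by simpa using hn⟩, ?_⟩
    change (n : ℤ) • (Submodule.Quotient.mk y : N ⧸ LinearMap.range g) = 0
    rw [← Submodule.Quotient.mk_smul, Submodule.Quotient.mk_eq_zero]
    exact ⟨x, by rw [natCast_zsmul]; exact e⟩
  omega

/-- doubling -/
def D (G : Type*) [AddCommGroup G] : G →+ G := nsmulAddMonoidHom 2

theorem D_apply {G : Type*} [AddCommGroup G] (x : G) : D G x = x + x := two_nsmul x

theorem D_index_equiv {G G' : Type*} [AddCommGroup G] [AddCommGroup G'] (e : G ≃+ G') :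
    (D G).range.index = (D G').range.index ∧ Nat.card (D G).ker = Nat.card (D G').ker := by
  constructor
  · rw [← AddSubgroup.index_map_equiv (D G).range e]
    congr 1
    ext y
    constructor
    · rintro ⟨_, ⟨x, rfl⟩, rfl⟩
      exact ⟨e x, by simp [D_apply]⟩
    · rintro ⟨x, rfl⟩
      exact ⟨D G (e.symm x), ⟨_, rfl⟩, by simp [D_apply]⟩
  · refine Nat.card_congr (e.toEquiv.subtypeEquiv ?_)
    intro a
    change D G a = 0 ↔ D G' (e a) = 0
    rw [D_apply, D_apply, ← map_add, EmbeddingLike.map_eq_zero_iff]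

theorem D_prod {G G' : Type*} [AddCommGroup G] [AddCommGroup G'] :
    (D (G × G')).range.index = (D G).range.index * (D G').range.index ∧
    Nat.card (D (G × G')).ker = Nat.card (D G).ker * Nat.card (D G').ker := by
  constructor
  · rw [← AddSubgroup.index_prod]
    congr 1
    ext ⟨a, b⟩
    rw [AddSubgroup.mem_prod]
    constructor
    · rintro ⟨⟨x, y⟩, h⟩
      rw [D_apply, Prod.mk_add_mk, Prod.mk.injEq] at h
      exact ⟨⟨x, by rw [D_apply]; exact h.1⟩, ⟨y, by rw [D_apply]; exact h.2⟩⟩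
    · rintro ⟨⟨x, h⟩, ⟨y, h'⟩⟩
      exact ⟨(x, y), by rw [D_apply] at *; exact Prod.ext h h'⟩
  · rw [← Nat.card_prod]
    refine Nat.card_congr ⟨fun x => ⟨⟨x.1.1, ?_⟩, ⟨x.1.2, ?_⟩⟩, fun x => ⟨(x.1.1, x.2.1), ?_⟩, ?_, ?_⟩
    · exact congrArg Prod.fst x.2
    · exact congrArg Prod.snd x.2
    · exact Prod.ext x.1.2 x.2.2
    · intro x; rfl
    · intro x; rfl

theorem D_fin {G : Type*} [AddCommGroup G] [Finite G] :
    (D G).range.index = Nat.card (D G).ker := AddSubgroup.index_range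

theorem D_free (n : ℕ) : (D (Fin n → ℤ)).range.index = 2 ^ n ∧
    Nat.card (D (Fin n → ℤ)).ker = 1 := by
  constructor
  · let f : (Fin n → ℤ) →+ (Fin n → ZMod 2) := (Int.castAddHom (ZMod 2)).compLeft (Fin n)
    have hs : Function.Surjective f := by
      intro y
      exact ⟨fun i => (y i).val, by ext i; simp [f]⟩
    have : (D (Fin n → ℤ)).range = f.ker := by
      ext x
      rw [AddMonoidHom.mem_ker]
      constructor
      · rintro ⟨y, rfl⟩
        rw [D_apply, map_add]
        ext i
        exact CharTwo.add_self_eq_zero _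
      · intro h
        have : ∀ i, ∃ y, x i = y + y := by
          intro i
          exact even_cast.mp (congrFun h i)
        choose y hy using this
        exact ⟨y, by rw [D_apply]; ext i; exact (hy i).symm⟩
    rw [this, AddSubgroup.index_ker, AddMonoidHom.range_eq_top.mpr hs]
    simp
  · rw [Nat.card_eq_one_iff_unique]
    refine ⟨⟨fun a b => ?_⟩, ⟨0⟩⟩
    have : ∀ a : (D (Fin n → ℤ)).ker, a = 0 := by
      rintro ⟨a, ha⟩
      apply Subtype.ext
      have : a + a = 0 := by rw [← D_apply]; exact ha
      ext i
      have := congrFun this i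
      simp only [Pi.add_apply, Pi.zero_apply] at this
      change a i = 0
      omega
    rw [this a, this b]

theorem herb_aux (A T : Type*) [AddCommGroup A] [AddGroup.FG A] [AddCommGroup T] [Finite T] (n : ℕ)
    (φ : A ≃+ (Fin n → ℤ) × T) :
    (D A).range.index = 2 ^ (finrank ℤ A) * Nat.card (D A).ker := by
  have : Module.Finite ℤ A := Module.Finite.iff_addGroup_fg.mpr inferInstance
  have hr : finrank ℤ A = n := by
    rw [finrank_eq_of ((AddMonoidHom.fst (Fin n → ℤ) T).comp φ.toAddMonoidHom)]
    · simp
    · intro x hx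
      refine ⟨Nat.card T, Nat.card_pos.ne', ?_⟩
      apply φ.injective
      rw [map_nsmul, map_zero]
      refine Prod.ext ?_ ?_
      · have : (φ x).1 = 0 := hx
        simp [this]
      · simp
    · intro y
      exact ⟨1, one_ne_zero, φ.symm (y, 0), by simp⟩
  rw [hr, (D_index_equiv φ).1, (D_index_equiv φ).2, D_prod.1, D_prod.2, (D_free n).1, (D_free n).2,
    D_fin, one_mul]

theorem herb (A : Type*) [AddCommGroup A] [AddGroup.FG A] :
    (D A).range.index = 2 ^ (finrank ℤ A) * Nat.card (D A).ker := by
  obtain ⟨n, ι, _, p, hp, e, ⟨φ⟩⟩ := AddCommGroup.equiv_free_prod_directSum_zmod A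
  classical
  have hfin : Finite (DirectSum ι fun i => ZMod (p i ^ e i)) := by
    have : ∀ i, NeZero (p i ^ e i) := fun i => ⟨pow_ne_zero _ (hp i).ne_zero⟩
    have : ∀ i, Finite (ZMod (p i ^ e i)) := fun i => inferInstance
    exact Finite.of_equiv _ (DirectSum.addEquivProd fun i => ZMod (p i ^ e i)).symm.toEquiv
  exact herb_aux A (DirectSum ι fun i => ZMod (p i ^ e i)) n
    (φ.trans (AddEquiv.prodCongr (Finsupp.linearEquivFunOnFinite ℤ ℤ (Fin n)).toAddEquiv
      (AddEquiv.refl _)))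

theorem alg_main {E A : Type*} [AddCommGroup E] [AddCommGroup A] [AddGroup.FG A] {d : ℕ}
    (φ : E →+ A) (m : A →+ (Fin d → ZMod 2)) (hm : ∀ a, m a = 0 → ∃ b, b + b = a)
    (Q : Fin d → A) (hQ : ∀ i, m (Q i) = Pi.single i 1) (P : Fin d → E)
    (hP : ∀ i, φ (P i) = Q i + Q i ∨ φ (P i) = -(Q i + Q i)) (hk : Finite φ.ker)
    (h4 : Nat.card (D A).ker = 4) (H : AddSubgroup E)
    (hH : H = AddSubgroup.closure (Set.range P)) : H.FiniteIndex ∧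
      Nonempty ((H ⧸ AddCommGroup.torsion H) ≃+ (Fin (d - 2) → ℤ)) := by
  have fA : Module.Finite ℤ A := Module.Finite.iff_addGroup_fg.mpr inferInstance
  have fH : AddGroup.FG H := by
    rw [AddGroup.fg_iff_addSubgroup_fg]
    exact hH ▸ ⟨(Set.finite_range P).toFinset, by simp⟩
  have fH' : Module.Finite ℤ H := Module.Finite.iff_addGroup_fg.mpr inferInstance
  have dbl0 : ∀ z : Fin d → ZMod 2, z + z = 0 := fun z => by
    ext i; exact CharTwo.add_self_eq_zero _
  have hsum : ∀ z : Fin d → ZMod 2, m (∑ i, (z i).val • Q i) = z := by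
    intro z
    simp only [map_sum, map_nsmul, hQ]
    ext j
    rw [Finset.sum_apply, Finset.sum_eq_single j]
    · rw [Pi.smul_apply, Pi.single_eq_same, nsmul_one, ZMod.natCast_zmod_val]
    · intro i _ hij
      rw [Pi.smul_apply, Pi.single_eq_of_ne hij.symm, smul_zero]
    · intro h; exact absurd (Finset.mem_univ j) h
  -- rank of A
  have hsurj : Function.Surjective m := by
    intro z
    exact ⟨∑ i, (z i).val • Q i, hsum z⟩
  have hker : (D A).range = m.ker := by
    ext x
    rw [AddMonoidHom.mem_ker]
    constructor
    · rintro ⟨y, rfl⟩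
      rw [D_apply, map_add, dbl0]
    · intro h
      obtain ⟨b, hb⟩ := hm x h
      exact ⟨b, by rw [D_apply, hb]⟩
  have hrk : finrank ℤ A = d - 2 := by
    have := herb A
    rw [hker, AddSubgroup.index_ker, AddMonoidHom.range_eq_top.mpr hsurj, h4] at this
    simp only [AddSubgroup.card_top, Nat.card_eq_fintype_card, Fintype.card_pi, ZMod.card,
      Finset.prod_const, Finset.card_univ, Fintype.card_fin] at this
    have h : 2 ^ d = 2 ^ (finrank ℤ A + 2) := by rw [this, pow_add]; norm_num
    have := Nat.pow_right_injective le_rfl h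
    omega
  -- torsion of the cokernel
  obtain ⟨r, hr, hrH⟩ : ∃ r : ℤ, r ≠ 0 ∧ ∀ a, r • a ∈ AddSubgroup.closure (Set.range Q) := by
    set N := AddSubgroup.toIntSubmodule (AddSubgroup.closure (Set.range Q)) with hN
    obtain ⟨r, h1, h2⟩ := Submodule.exists_sub_one_mem_and_smul_eq_zero_of_fg_of_le_smul
      (R := ℤ) (M := A ⧸ N) (Ideal.span {2}) ⊤ (Module.Finite.fg_top) (by
      rintro ⟨a⟩ -
      obtain ⟨b, hb⟩ := hm (a - ∑ i, ((m a) i).val • Q i) (by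
        rw [map_sub, hsum, sub_self])
      have : (Submodule.Quotient.mk a : A ⧸ N) = (2 : ℤ) • Submodule.Quotient.mk b := by
        rw [← Submodule.Quotient.mk_smul, Submodule.Quotient.eq, two_smul, hb, sub_sub_cancel]
        refine sum_mem fun i _ => nsmul_mem ?_ _
        have : Q i ∈ AddSubgroup.closure (Set.range Q) := AddSubgroup.subset_closure ⟨i, rfl⟩
        exact this
      change (Submodule.Quotient.mk a : A ⧸ N) ∈ _
      rw [this]
      exact Submodule.smul_mem_smul (Ideal.mem_span_singleton_self 2) trivial)
    refine ⟨r, ?_, ?_⟩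
    · rintro rfl
      rw [Ideal.mem_span_singleton] at h1
      omega
    · intro a
      have := h2 (Submodule.Quotient.mk a) trivial
      rw [← Submodule.Quotient.mk_smul, Submodule.Quotient.mk_eq_zero] at this
      exact this
  have hdbl : ∀ a ∈ AddSubgroup.closure (Set.range Q), a + a ∈ H.map φ := by
    have : AddSubgroup.closure (Set.range Q) ≤ (H.map φ).comap (D A) := by
      rw [AddSubgroup.closure_le]
      rintro _ ⟨i, rfl⟩
      change D A (Q i) ∈ H.map φ
      have hPi : φ (P i) ∈ H.map φ := ⟨P i, by
        rw [hH]; exact AddSubgroup.subset_closure ⟨i, rfl⟩, rfl⟩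
      rw [D_apply]
      rcases hP i with h | h
      · rwa [h] at hPi
      · rw [h] at hPi
        simpa only [neg_neg] using neg_mem hPi
    intro a ha
    have := this ha
    rw [← D_apply]; exact this
  have htor : ∀ a, (2 * r.natAbs) • a ∈ H.map φ := by
    intro a
    rw [mul_smul, two_smul]
    apply hdbl
    rcases Int.natAbs_eq r with h | h
    · have := hrH a
      rw [h, natCast_zsmul] at this
      exact this
    · have := hrH a
      rw [h, neg_smul, natCast_zsmul] at this
      simpa only [neg_neg] using neg_mem this
  have hr' : 2 * r.natAbs ≠ 0 := by omega
  have hfin1 : Finite (A ⧸ H.map φ) := by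
    apply AddCommGroup.finite_of_fg_isAddTorsion
    intro a'
    obtain ⟨a, rfl⟩ := QuotientAddGroup.mk_surjective a'
    rw [isOfFinAddOrder_iff_nsmul_eq_zero]
    refine ⟨2 * r.natAbs, Nat.pos_of_ne_zero hr', ?_⟩
    change (2 * r.natAbs) • (QuotientAddGroup.mk a : A ⧸ H.map φ) = 0
    rw [← QuotientAddGroup.mk_nsmul, QuotientAddGroup.eq_zero_iff]
    exact htor a
  have hidx : (H.map φ).index ≠ 0 := AddSubgroup.index_ne_zero_of_finite
  constructor
  · constructor
    rw [AddSubgroup.index_map] at hidx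
    rw [← AddSubgroup.relIndex_mul_index (le_sup_left : H ≤ H ⊔ φ.ker)]
    refine mul_ne_zero ?_ (left_ne_zero_of_mul hidx)
    rw [AddSubgroup.relIndex_sup_left]
    exact AddSubgroup.index_ne_zero_of_finite
  · have rH : finrank ℤ H = d - 2 := by
      rw [← hrk]
      refine finrank_eq_of (φ.comp H.subtype) ?_ ?_
      · rintro ⟨x, hx⟩ h
        refine ⟨Nat.card φ.ker, Nat.card_pos.ne', ?_⟩
        have h' : (Nat.card φ.ker) • (⟨x, h⟩ : φ.ker) = 0 := card_nsmul_eq_zero'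
        have := congrArg Subtype.val h'
        apply Subtype.ext
        exact this
      · intro y
        obtain ⟨x, hx, e⟩ := htor y
        exact ⟨_, hr', ⟨x, hx⟩, e⟩
    have fT : AddGroup.FG (H ⧸ AddCommGroup.torsion H) := inferInstance
    have fT' : Module.Finite ℤ (H ⧸ AddCommGroup.torsion H) :=
      Module.Finite.iff_addGroup_fg.mpr inferInstance
    have rT : finrank ℤ (H ⧸ AddCommGroup.torsion H) = d - 2 := by
      rw [← rH]
      symm
      refine finrank_eq_of (QuotientAddGroup.mk' _) ?_ ?_
      · intro x hx
        rw [QuotientAddGroup.mk'_apply, QuotientAddGroup.eq_zero_iff] at hx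
        obtain ⟨n, hn, e⟩ := isOfFinAddOrder_iff_nsmul_eq_zero.mp hx
        exact ⟨n, hn.ne', e⟩
      · intro y'
        obtain ⟨y, rfl⟩ := QuotientAddGroup.mk_surjective y'
        exact ⟨1, one_ne_zero, y, by rw [one_smul]; rfl⟩
    rw [← rT]
    exact ⟨(Module.finBasis ℤ (H ⧸ AddCommGroup.torsion H)).equivFun.toAddEquiv⟩
end
end Ulm


namespace Ulm
open WeierstrassCurve WeierstrassCurve.Affine

theorem two_tors {F : Type*} [Field F] [DecidableEq F] (h2 : (2 : F) ≠ 0) {s : F} (hs0 : s ≠ 0)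
    (hs1 : s ≠ 1) : Nat.card (D (Leg s).toAffine.Point).ker = 4 := by
  classical
  have ha : (Leg s).toAffine.Nonsingular 0 0 := leg_ns h2 hs0 hs1 (by ring)
  have hb : (Leg s).toAffine.Nonsingular (-1) 0 := leg_ns h2 hs0 hs1 (by ring)
  have hc : (Leg s).toAffine.Nonsingular (-s) 0 := leg_ns h2 hs0 hs1 (by ring)
  have key : ((D (Leg s).toAffine.Point).ker : Set (Leg s).toAffine.Point) =
      (({0, .some _ _ ha, .some _ _ hb, .some _ _ hc} : Finset (Leg s).toAffine.Point) : Set _) := by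
    ext P
    simp only [SetLike.mem_coe, AddMonoidHom.mem_ker, D_apply, Finset.mem_insert,
      Finset.mem_singleton]
    constructor
    · intro h
      rcases P with _ | ⟨x, y, hP⟩
      · exact Or.inl rfl
      by_cases hy : y = 0
      · subst hy
        have := leg_eq.mp hP.1
        have h0 : x * (x + 1) * (x + s) = 0 := by rw [← this]; ring
        rcases mul_eq_zero.mp h0 with h1 | h1
        · rcases mul_eq_zero.mp h1 with h1 | h1
          · subst h1; exact Or.inr (Or.inl rfl)
          · have := eq_neg_of_add_eq_zero_left h1
            subst this; exact Or.inr (Or.inr (Or.inl rfl))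
        · have := eq_neg_of_add_eq_zero_left h1
          subst this; exact Or.inr (Or.inr (Or.inr rfl))
      · obtain ⟨X, Y, h', e, -⟩ := leg_dbl h2 hP hy
        rw [e] at h
        exact absurd h (Point.some_ne_zero _)
    · rintro (rfl | rfl | rfl | rfl)
      · exact add_zero _
      · exact leg_dbl_zero ha rfl
      · exact leg_dbl_zero hb rfl
      · exact leg_dbl_zero hc rfl
  have : Nat.card (D (Leg s).toAffine.Point).ker =
      ((D (Leg s).toAffine.Point).ker : Set (Leg s).toAffine.Point).ncard := rfl
  rw [this, key, Set.ncard_coe_finset]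
  rw [Finset.card_insert_of_notMem, Finset.card_insert_of_notMem, Finset.card_insert_of_notMem,
    Finset.card_singleton]
  · simp only [Finset.mem_singleton, Point.some.injEq, neg_inj, and_true]
    exact fun h => hs1 h.symm
  · simp only [Finset.mem_insert, Finset.mem_singleton, Point.some.injEq, and_true, zero_eq_neg,
      not_or]
    exact ⟨one_ne_zero, hs0⟩
  · simp only [Finset.mem_insert, Finset.mem_singleton, not_or]
    exact ⟨(Point.some_ne_zero _).symm, (Point.some_ne_zero _).symm, (Point.some_ne_zero _).symm⟩

theorem iso_ker_fin {F : Type*} [Field F] [DecidableEq F] (h2 : (2 : F) ≠ 0) {t : F} (ht0 : t ≠ 0)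
    (ht1 : 16 * t ≠ 1) (φ : (UE t).toAffine.Point →+ (Leg (16 * t)).toAffine.Point)
    (hφ : ∀ P, φ P = iso h2 ht0 ht1 P) : Finite φ.ker := by
  have : ((φ.ker : Set (UE t).toAffine.Point)).Finite := by
    by_cases hn : (UE t).toAffine.Nonsingular (-t) 0
    · refine Set.Finite.subset (Set.toFinite {0, .some _ _ hn}) ?_
      intro P hP
      have hP' : iso h2 ht0 ht1 P = 0 := by rw [← hφ]; exact hP
      rcases iso_ker h2 ht0 ht1 hP' with h | ⟨y, hh, rfl, hy⟩
      · exact Or.inl h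
      · have : y = 0 := (mul_eq_zero.mp hy).resolve_left h2
        subst this
        exact Or.inr rfl
    · refine Set.Finite.subset (Set.toFinite {0}) ?_
      intro P hP
      have hP' : iso h2 ht0 ht1 P = 0 := by rw [← hφ]; exact hP
      rcases iso_ker h2 ht0 ht1 hP' with h | ⟨y, hh, rfl, hy⟩
      · exact h
      · have : y = 0 := (mul_eq_zero.mp hy).resolve_left h2
        subst this
        exact absurd hh hn
  exact this

theorem frob4 {R : Type*} [CommRing R] {p : ℕ} [Fact p.Prime] [CharP R p] (f : ℕ) :
    (4 : R) ^ p ^ f = 4 := by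
  rw [← iterateFrobenius_def p f, map_ofNat]
end Ulm

open scoped Classical in
theorem ulmer_points_finite_index_rank
    (p f q d : ℕ) (hp : p.Prime) (hodd : Odd p) (hf : 1 ≤ f)
    (hq : q = p ^ f) (hd : d = q + 1)
    (k : Type*) [Field k] [IsAlgClosed k] [CharP k p]
    (ζ : k) (hζ : IsPrimitiveRoot ζ d)
    (W : WeierstrassCurve (RatFunc k))
    (hW : W = ⟨1, RatFunc.X ^ d, RatFunc.X ^ d, 0, 0⟩)
    (hns : ∀ i : Fin d, W.toAffine.Nonsingular
      (ulmerX q (RatFunc.C (ζ ^ (i : ℕ)) * RatFunc.X))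
      (ulmerY q (RatFunc.C (ζ ^ (i : ℕ)) * RatFunc.X)))
    (H : AddSubgroup W.toAffine.Point)
    (hH : H = AddSubgroup.closure
      (Set.range fun i : Fin d => WeierstrassCurve.Affine.Point.some _ _ (hns i))) :
    H.FiniteIndex ∧
      Nonempty ((H ⧸ AddCommGroup.torsion H) ≃+ (Fin (d - 2) → ℤ)) := by
  have : Fact p.Prime := ⟨hp⟩
  have cR : CharP (RatFunc k) p := charP_of_injective_algebraMap
    (FaithfulSMul.algebraMap_injective k (RatFunc k)) p
  have hqodd : Odd q := hq ▸ hodd.pow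
  obtain ⟨e', he'⟩ := hqodd
  obtain ⟨e, he⟩ : ∃ e, q + 1 = 2 * e := ⟨e' + 1, by omega⟩
  have hev : Even d := ⟨e, by omega⟩
  have hd0 : 0 < d := by omega
  have h2 : (2 : k) ≠ 0 := by
    intro h
    have : p ∣ 2 := (CharP.cast_eq_zero_iff k p 2).mp (by exact_mod_cast h)
    have h3 := (Nat.prime_dvd_prime_iff_eq hp Nat.prime_two).mp this
    rw [h3] at hodd
    exact absurd hodd (by decide)
  have hdk : (d : k) ≠ 0 := by
    have : (q : k) = 0 := by
      rw [hq, Nat.cast_pow, CharP.cast_eq_zero, zero_pow (by omega)]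
    rw [hd, Nat.cast_succ, this, zero_add]
    exact one_ne_zero
  have h4 : (4 : k) ^ d = 16 := by
    rw [hd, pow_succ, hq, Ulm.frob4]; norm_num
  have h2R : (2 : RatFunc k) ≠ 0 := Ulm.two_R h2
  have ht0 : (RatFunc.X : RatFunc k) ^ d ≠ 0 := pow_ne_zero _ RatFunc.X_ne_zero
  have ht1 : 16 * (RatFunc.X : RatFunc k) ^ d ≠ 1 := by
    rw [← Ulm.sR_eq]; exact Ulm.sR1_ne h2 hd0
  have hs0 : 16 * (RatFunc.X : RatFunc k) ^ d ≠ 0 := by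
    rw [← Ulm.sR_eq]; exact Ulm.sR_ne h2
  obtain ⟨hfg, m, hm, hmQ⟩ := Ulm.leg_main h2 hd0 hdk hev h4 hζ
  subst hW
  have hvd : ∀ i : ℕ, (RatFunc.X : RatFunc k) ^ d = Ulm.vv ζ i ^ (q + 1) := by
    intro i
    rw [Ulm.vv, mul_pow, ← hd, ← map_pow, ← pow_mul, mul_comm i d, pow_mul, hζ.pow_eq_one, one_pow,
      map_one, one_mul]
  have hv0 : ∀ i : ℕ, Ulm.vv ζ i ≠ 0 := by
    intro i h
    apply ht0
    rw [hvd i, h, zero_pow (by omega)]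
  have hF : ∀ v : RatFunc k, (1 + 4 * v) ^ q = 1 + 4 * v ^ q := by
    intro v
    rw [hq, add_pow_char_pow, one_pow, mul_pow, Ulm.frob4]
  have h1 : ∀ i : ℕ, 1 + 4 * Ulm.vv ζ i ≠ 0 := by
    intro i; rw [add_comm]; exact Ulm.vv1_ne i
  have hQns : ∀ i : Fin d, (Ulm.Leg (16 * RatFunc.X ^ d : RatFunc k)).toAffine.Nonsingular
      (4 * Ulm.vv ζ i) (4 * Ulm.vv ζ i * (1 + 4 * Ulm.vv ζ i) ^ e) := fun i =>
    Ulm.leg_ns h2R hs0 ht1 (Ulm.q_eqn he (hvd i) (hF _) rfl)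
  let φ : (Ulm.UE (RatFunc.X ^ d : RatFunc k)).toAffine.Point →+
      (Ulm.Leg (16 * RatFunc.X ^ d : RatFunc k)).toAffine.Point :=
    AddMonoidHom.mk' (Ulm.iso h2R ht0 ht1) (Ulm.iso_add h2R ht0 ht1)
  exact Ulm.alg_main φ m hm (fun i => .some _ _ (hQns i)) (fun i => hmQ i _ (hQns i)) _
    (fun i => Ulm.iso_Q h2R ht0 ht1 he (hv0 i) (h1 i) (hvd i) (hF _) (hns i) rfl (hQns i))
    (Ulm.iso_ker_fin h2R ht0 ht1 φ (fun _ => rfl)) (Ulm.two_tors h2R hs0 ht1) H hH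
end

section
/- Let K be a field of characteristic different from 2 and let t, X, Y ∈ K with t ≠ 0, X ≠ 0, and X ≠ t. Set x = (X + t)/(X − t) and y = −Y/(2tX); then x² − 1 = 4tX/(X − t)² is nonzero, and Y² + 2tXY = X³ − t²X holds if and only if x/(x² − 1) = t·y(y − 1) holds. (This is the change of coordinates showing that the curve f(x) = t·g(y) with f(x) = x/(x²−1) and g(y) = y(y−1) is birational to the Weierstrass curve y² + 2txy = x³ − t²x.) -/
/-- Change of coordinates between the curve `f(x) = t·g(y)` with `f(x) = x/(x²−1)`,
`g(y) = y(y−1)` and the Weierstrass curve `y² + 2txy = x³ − t²x`:  over a field of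
characteristic `≠ 2`, if `t ≠ 0`, `X ≠ 0` and `X ≠ t`, setting `x = (X + t)/(X − t)` and
`y = −Y/(2tX)`, one has `x² − 1 = 4tX/(X − t)²`, which is nonzero, and the equation
`Y² + 2tXY = X³ − t²X` holds if and only if `x/(x² − 1) = t·y(y − 1)` holds. -/
theorem change_of_coords_second_example
    (K : Type*) [Field K] (hchar : (2 : K) ≠ 0)
    (t X Y : K) (ht : t ≠ 0) (hX : X ≠ 0) (hXt : X ≠ t)
    (x y : K) (hx : x = (X + t) / (X - t)) (hy : y = -Y / (2 * t * X)) :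
    (x ^ 2 - 1 = 4 * t * X / (X - t) ^ 2 ∧ x ^ 2 - 1 ≠ 0) ∧
      (Y ^ 2 + 2 * t * X * Y = X ^ 3 - t ^ 2 * X ↔ x / (x ^ 2 - 1) = t * (y * (y - 1))) := by
  have hd : X - t ≠ 0 := sub_ne_zero.mpr hXt
  have h4 : (4 : K) ≠ 0 := by
    have h : (4 : K) = 2 * 2 := by norm_num
    rw [h]; exact mul_ne_zero hchar hchar
  have h1 : x ^ 2 - 1 = 4 * t * X / (X - t) ^ 2 := by
    rw [hx, div_pow, eq_div_iff (pow_ne_zero 2 hd), sub_mul, div_mul_cancel₀ _ (pow_ne_zero 2 hd)]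
    ring
  have h2 : x ^ 2 - 1 ≠ 0 := by
    rw [h1]
    exact div_ne_zero (mul_ne_zero (mul_ne_zero h4 ht) hX) (pow_ne_zero 2 hd)
  have hD : 4 * t * X ^ 2 ≠ 0 := mul_ne_zero (mul_ne_zero h4 ht) (pow_ne_zero 2 hX)
  have hxd : x * (X - t) = X + t := by rw [hx, div_mul_cancel₀ _ hd]
  have hyd : y * (2 * t * X) = -Y := by
    rw [hy, div_mul_cancel₀ _ (mul_ne_zero (mul_ne_zero hchar ht) hX)]
  have h3 : x / (x ^ 2 - 1) = (X ^ 3 - t ^ 2 * X) / (4 * t * X ^ 2) := by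
    rw [div_eq_div_iff h2 hD]
    have h1' : (x ^ 2 - 1) * (X - t) ^ 2 = 4 * t * X := by
      rw [h1, div_mul_cancel₀ _ (pow_ne_zero 2 hd)]
    apply mul_right_cancel₀ (pow_ne_zero 2 hd)
    linear_combination (4 * t * X ^ 2 * (X - t)) * hxd - (X ^ 3 - t ^ 2 * X) * h1'
  have h5 : t * (y * (y - 1)) = (Y ^ 2 + 2 * t * X * Y) / (4 * t * X ^ 2) := by
    rw [eq_div_iff hD]
    have hY : Y = -(y * (2 * t * X)) := by rw [hyd, neg_neg]
    rw [hY]; ring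
  refine ⟨⟨h1, h2⟩, ?_⟩
  rw [h3, h5, div_left_inj' hD]
  exact eq_comm
end

section
/- Let p > 2 be prime, k an algebraic closure of 𝔽_p, f ≥ 1, and d = 2p^f − 1. Let K_d = k(u) and let E be the elliptic curve over K_d defined by y² + 2u^d xy = x³ − u^{2d} x (the curve y² + 2txy = x³ − t²x with t = u^d). Then E(K_d) contains a free abelian subgroup of rank d − 1; that is, there exist points Q_1, …, Q_{d−1} ∈ E(K_d) that are linearly independent over ℤ, so the rank of E(K_d) is at least d − 1. -/
/-- squares in the unit group -/
abbrev RkSq (L : Type*) [Field L] : Subgroup Lˣ := (powMonoidHom 2 : Lˣ →* Lˣ).range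

/-- units modulo squares -/
def RkG (L : Type*) [Field L] : Type _ := Lˣ ⧸ RkSq L

noncomputable instance (L : Type*) [Field L] : CommGroup (RkG L) :=
  inferInstanceAs (CommGroup (Lˣ ⧸ RkSq L))

/-- the quotient map -/
noncomputable def rkMk {L : Type*} [Field L] : Lˣ →* RkG L := QuotientGroup.mk' (RkSq L)

lemma rk_mk_eq_one {L : Type*} [Field L] (a : Lˣ) :
    rkMk a = 1 ↔ IsSquare (a : L) := by
  refine (QuotientGroup.eq_one_iff (N := RkSq L) a).trans ?_
  constructor
  · rintro ⟨b, hb⟩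
    exact ⟨b, by rw [← hb]; simp [pow_two]⟩
  · rintro ⟨b, hb⟩
    have hb0 : b ≠ 0 := by
      rintro rfl
      exact a.ne_zero (by rw [hb, mul_zero])
    exact ⟨Units.mk0 b hb0, by ext; simp [pow_two, hb]⟩

lemma rk_sq_eq_one {L : Type*} [Field L] (a : RkG L) : a * a = 1 := by
  obtain ⟨z, rfl⟩ : ∃ z, rkMk z = a := QuotientGroup.mk'_surjective _ a
  rw [← map_mul, rk_mk_eq_one]
  exact ⟨z, by simp⟩

open WeierstrassCurve in
theorem rk_hom_exists {K L : Type*} [Field K] [Field L] [Algebra K L] [DecidableEq K]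
    (W : WeierstrassCurve K) (t : K)
    (hW : W = { a₁ := 2 * t, a₂ := 0, a₃ := 0, a₄ := -t ^ 2, a₆ := 0 })
    (e : L) (he : e ^ 2 + (algebraMap K L t) ^ 2 * e - (algebraMap K L t) ^ 2 = 0)
    (hne : ∀ x : K, algebraMap K L x - e ≠ 0) :
    ∃ g : W.toAffine.Point →+ Additive (RkG L), ∀ x y h,
      g (Affine.Point.some x y h) =
        Additive.ofMul (rkMk (Units.mk0 (algebraMap K L x - e) (hne x))) := by
  let g0 : W.toAffine.Point → Additive (RkG L) := fun P => match P with
    | .zero => 0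
    | .some x y h => Additive.ofMul (rkMk (Units.mk0 (algebraMap K L x - e) (hne x)))
  have hz : g0 0 = 0 := rfl
  refine ⟨AddMonoidHom.mk' g0 ?_, fun x y h => rfl⟩
  intro P Q
  rcases P with _ | ⟨x₁, y₁, h₁⟩
  · rw [← Affine.Point.zero_def, zero_add, hz, zero_add]
  rcases Q with _ | ⟨x₂, y₂, h₂⟩
  · rw [← Affine.Point.zero_def, add_zero, hz, add_zero]
  by_cases hxy : x₁ = x₂ ∧ y₁ = W.toAffine.negY x₂ y₂
  · rw [Affine.Point.add_of_Y_eq hxy.1 hxy.2, hz]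
    obtain ⟨rfl, -⟩ := hxy
    exact (congrArg Additive.ofMul (rk_sq_eq_one _)).symm
  · rw [Affine.Point.add_some hxy]
    set x₃ := W.toAffine.addX x₁ x₂ (W.toAffine.slope x₁ x₂ y₁ y₂) with hx₃
    have key := congrArg (Polynomial.aeval e) (Affine.addPolynomial_slope h₁.1 h₂.1 hxy)
    rw [← hx₃] at key
    have key2 : (algebraMap K L x₁ - e) * (algebraMap K L x₂ - e) * (algebraMap K L x₃ - e)
      = (algebraMap K L (W.toAffine.slope x₁ x₂ y₁ y₂) * (e - algebraMap K L x₁)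
          + algebraMap K L y₁ + algebraMap K L t * e) ^ 2 := by
      have h1 : Polynomial.aeval e (W.toAffine.addPolynomial x₁ y₁ (W.toAffine.slope x₁ x₂ y₁ y₂))
        = (algebraMap K L (W.toAffine.slope x₁ x₂ y₁ y₂) * (e - algebraMap K L x₁)
          + algebraMap K L y₁) ^ 2 + 2 * algebraMap K L t * e *
          (algebraMap K L (W.toAffine.slope x₁ x₂ y₁ y₂) * (e - algebraMap K L x₁)
          + algebraMap K L y₁) - (e ^ 3 - algebraMap K L t ^ 2 * e) := by
        generalize W.toAffine.slope x₁ x₂ y₁ y₂ = l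
        rw [Affine.addPolynomial, Affine.polynomial, Affine.linePolynomial, hW]
        simp
        rw [map_ofNat]
        ring
      rw [h1] at key
      simp only [map_neg, map_mul, map_sub, Polynomial.aeval_X, Polynomial.aeval_C] at key
      linear_combination (-1) * key - e * he
    have h3 : (rkMk (Units.mk0 (algebraMap K L x₁ - e) (hne x₁)) : RkG L) *
        rkMk (Units.mk0 (algebraMap K L x₂ - e) (hne x₂)) *
        rkMk (Units.mk0 (algebraMap K L x₃ - e) (hne x₃)) = 1 := by
      rw [← map_mul, ← map_mul, rk_mk_eq_one]
      rw [pow_two] at key2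
      exact ⟨_, key2⟩
    have h4 := mul_eq_one_iff_eq_inv.1 h3
    have h5 : (rkMk (Units.mk0 (algebraMap K L x₃ - e) (hne x₃)) : RkG L)⁻¹ =
      rkMk (Units.mk0 (algebraMap K L x₃ - e) (hne x₃)) :=
      inv_eq_of_mul_eq_one_left (rk_sq_eq_one _)
    rw [h5] at h4
    exact congrArg Additive.ofMul h4.symm

theorem rk_descent {A L K ι : Type*} [AddCommGroup A] [Field L] [Field K] [Algebra K L]
    [Finite ι] (g : A →+ Additive (RkG L)) (Q : ι → A) (T : A) (c : ι → K)
    (hc : ∀ i, algebraMap K L (c i) ≠ 0) (τ : L) (hτ : τ ≠ 0)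
    (hQ : ∀ i, g (Q i) = Additive.ofMul (rkMk (Units.mk0 _ (hc i))))
    (hT : g T = Additive.ofMul (rkMk (Units.mk0 _ hτ)))
    (hA : ∀ S : Finset ι, IsSquare (algebraMap K L (∏ i ∈ S, c i)) → S = ∅)
    (hB : ∀ S : Finset ι, ¬ IsSquare (algebraMap K L (∏ i ∈ S, c i) * τ))
    (hC : ∀ P : A, P + P = 0 → P = 0 ∨ P = T) : LinearIndependent ℤ Q := by
  classical
  have := Fintype.ofFinite ι
  have hsum : ∀ n : ι → ℤ, g (∑ i, n i • Q i) = Additive.ofMul (rkMk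
      (∏ i with Odd (n i), Units.mk0 _ (hc i))) := by
    intro n
    rw [map_sum]
    have h1 : ∀ i, g (n i • Q i) = Additive.ofMul
      (if Odd (n i) then (rkMk (Units.mk0 _ (hc i)) : RkG L) else 1) := by
      intro i
      rw [map_zsmul, hQ, ← ofMul_zpow]
      congr 1
      split_ifs with h
      · obtain ⟨m, hm⟩ := h
        rw [hm, zpow_add, zpow_mul, zpow_one, zpow_ofNat, pow_two, rk_sq_eq_one]; simp
      · obtain ⟨m, hm⟩ := Int.not_odd_iff_even.1 h
        rw [hm, ← two_mul, zpow_mul, zpow_ofNat, pow_two, rk_sq_eq_one]; simp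
    simp_rw [h1]
    rw [← ofMul_prod, ← Finset.prod_filter]
    congr 1
    rw [map_prod]
  have hval : ∀ S : Finset ι, ((∏ i ∈ S, Units.mk0 _ (hc i) : Lˣ) : L)
      = algebraMap K L (∏ i ∈ S, c i) := by
    intro S
    rw [map_prod, Units.coe_prod]; rfl
  have heven : ∀ n : ι → ℤ, ∑ i, n i • Q i = 0 → ∀ i, Even (n i) := by
    intro n hn i
    have h1 := hsum n
    rw [hn, map_zero] at h1
    have h2 := (rk_mk_eq_one _).1 (Additive.ofMul.injective h1).symm
    rw [hval] at h2
    have h3 := hA _ h2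
    by_contra h
    have : i ∈ (Finset.univ.filter fun i => Odd (n i)) := by
      simpa using h
    simp [h3] at this
  have hnT : ∀ n : ι → ℤ, ∑ i, n i • Q i ≠ T := by
    intro n hn
    have h1 := hsum n
    rw [hn, hT] at h1
    have h2 : (rkMk (Units.mk0 _ hτ) : RkG L) = _ :=
      Additive.ofMul.injective h1
    refine hB (Finset.univ.filter fun i => Odd (n i)) ?_
    have h3 : (rkMk ((∏ i with Odd (n i), Units.mk0 _ (hc i)) * Units.mk0 _ hτ)
      : RkG L) = 1 := by
      rw [map_mul, h2, rk_sq_eq_one]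
    have h4 := (rk_mk_eq_one _).1 h3
    rwa [Units.val_mul, hval] at h4
  have hdvd : ∀ j : ℕ, ∀ n : ι → ℤ, ∑ i, n i • Q i = 0 → ∀ i, (2 : ℤ) ^ j ∣ n i := by
    intro j
    induction j with
    | zero => intro n _ i; simp
    | succ j ih =>
      intro n hn
      choose m hm using heven n hn
      have h1 : ∑ i, m i • Q i + ∑ i, m i • Q i = 0 := by
        rw [← Finset.sum_add_distrib, ← hn]
        refine Finset.sum_congr rfl fun i _ => ?_
        rw [hm i, add_smul]
      rcases hC _ h1 with h | h
      · intro i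
        have := ih m h i
        rw [hm i, ← two_mul, pow_succ']
        exact mul_dvd_mul_left _ this
      · exact absurd h (hnT m)
  rw [Fintype.linearIndependent_iff]
  intro n hn i
  by_contra h
  have h1 := hdvd (n i).natAbs n hn i
  have h2 := Int.natAbs_dvd_natAbs.2 h1
  have h3 := Nat.le_of_dvd (Int.natAbs_pos.2 h) h2
  rw [Int.natAbs_pow] at h3
  exact absurd h3 (not_le.2 (Nat.lt_two_pow_self))

lemma rk_alg {L : Type*} [Field L] (X h v x t D s e : L) (h2 : (2 : L) ≠ 0) 
    (hh : h ≠ 0) (hv : v ≠ 0) (he : e * 2 = -t ^ 2 + t * s) (hs : s ^ 2 = D)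
    (e1 : 4 * X * x = X ^ 2 - 2 * t ^ 2 * X + t ^ 2 * D) (e2 : X * h = v ^ 2) :
    IsSquare ((x - e) * h⁻¹) := by
  refine ⟨(X - t * s) / (2 * v), ?_⟩
  field_simp
  rw [← e2]
  linear_combination h * e1 - h * t ^ 2 * hs - 2 * h * X * he

open WeierstrassCurve in
theorem rk_main {K ι : Type*} [Field K] [DecidableEq K] [Finite ι]
    (W : WeierstrassCurve K) (t D : K)
    (hW : W = { a₁ := 2 * t, a₂ := 0, a₃ := 0, a₄ := -t ^ 2, a₆ := 0 })
    (h2 : (2 : K) ≠ 0) (I : K) (hI : I ^ 2 = -1) (ht : t ≠ 0) (hD : D = t ^ 2 + 4)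
    (hDs : ¬ IsSquare D) (x y X v h : ι → K)
    (hxy : ∀ i, (y i + t * x i) ^ 2 = x i ^ 3 + t ^ 2 * x i ^ 2 - t ^ 2 * x i)
    (hX : ∀ i, X i ≠ 0) (hh : ∀ i, h i ≠ 0) (hXh : ∀ i, X i * h i = v i ^ 2)
    (hxX : ∀ i, 4 * X i * x i = X i ^ 2 - 2 * t ^ 2 * X i + t ^ 2 * D)
    (hA : ∀ S : Finset ι, IsSquare (∏ i ∈ S, h i) → S = ∅)
    (hA2 : ∀ S : Finset ι, ¬ IsSquare ((∏ i ∈ S, h i) * D))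
    (hB : ∀ S : Finset ι, ∀ j : K, j ^ 2 = -1 → ¬ IsSquare (t * (∏ i ∈ S, h i) * (t + 2 * j))) :
    ∃ Q : ι → W.toAffine.Point, LinearIndependent ℤ Q := by
  have hD0 : D ≠ 0 := by rintro rfl; exact hDs ⟨0, by simp⟩
  have hΔ : W.Δ ≠ 0 := by
    have : W.Δ = 2 ^ 4 * t ^ 6 * D := by
      rw [hW, hD]
      simp [WeierstrassCurve.Δ, WeierstrassCurve.b₂, WeierstrassCurve.b₄, WeierstrassCurve.b₆,
        WeierstrassCurve.b₈]
      ring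
    rw [this]
    exact mul_ne_zero (mul_ne_zero (pow_ne_zero _ h2) (pow_ne_zero _ ht)) hD0
  have heq : ∀ a b : K, W.toAffine.Equation a b ↔
      (b + t * a) ^ 2 = a ^ 3 + t ^ 2 * a ^ 2 - t ^ 2 * a := by
    intro a b
    rw [Affine.equation_iff, hW]
    simp only
    constructor <;> intro h <;> linear_combination h
  have hns : ∀ a b : K, (b + t * a) ^ 2 = a ^ 3 + t ^ 2 * a ^ 2 - t ^ 2 * a →
      W.toAffine.Nonsingular a b := fun a b hab =>
    (Affine.equation_iff_nonsingular_of_Δ_ne_zero hΔ).1 ((heq a b).2 hab)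
  have : Fact (∀ r : K, r ^ 2 ≠ D + 0 * r) := ⟨fun r hr => hDs ⟨r, by linear_combination -hr⟩⟩
  let L := QuadraticAlgebra K D 0
  let e : L := ⟨-t ^ 2 / 2, t / 2⟩
  have he : e ^ 2 + (algebraMap K L t) ^ 2 * e - (algebraMap K L t) ^ 2 = 0 := by
    ext
    · simp [e, L, pow_two]
      field_simp
      rw [hD]; ring
    · simp [e, L, pow_two]
      field_simp
      ring
  have hne : ∀ x : K, algebraMap K L x - e ≠ 0 := by
    intro x hx
    have := congrArg QuadraticAlgebra.im hx
    simp [e, L, ht, h2] at this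
  obtain ⟨g, hg⟩ := rk_hom_exists W t hW e he hne
  have hhL : ∀ i, algebraMap K L (h i) ≠ 0 := fun i => by
    rw [Ne, map_eq_zero]; exact hh i
  have hT : W.toAffine.Nonsingular 0 0 := hns 0 0 (by ring)
  have hτ : -e ≠ 0 := by simpa using hne 0
  refine ⟨fun i => .some (x i) (y i) (hns _ _ (hxy i)), ?_⟩
  refine rk_descent g _ (.some 0 0 hT) h hhL (-e) hτ ?_ ?_ ?_ ?_ ?_
  · intro i
    rw [hg]
    congr 1
    rw [← mul_inv_eq_one, ← map_inv, ← map_mul, rk_mk_eq_one]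
    let s : L := ⟨0, 1⟩
    have h2L : (2 : L) = algebraMap K L 2 := (map_ofNat _ 2).symm
    have hL2 : (2 : L) ≠ 0 := by
      rw [h2L, Ne, map_eq_zero]; exact h2
    have hs : e * 2 = -(algebraMap K L t) ^ 2 + algebraMap K L t * s := by
      rw [h2L]
      ext <;> simp [e, s, L, pow_two] <;> field_simp
    have hss : s ^ 2 = algebraMap K L D := by
      ext <;> simp [s, L, pow_two]
    have e1 := congrArg (algebraMap K L) (hxX i)
    have e2 := congrArg (algebraMap K L) (hXh i)
    simp only [map_mul, map_sub, map_add, map_pow, map_ofNat] at e1 e2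
    have e3 : algebraMap K L (X i) ≠ 0 := by
      rw [Ne, map_eq_zero]; exact hX i
    have e4 := hhL i
    have e5 : algebraMap K L (v i) ≠ 0 := by
      intro h0
      rw [h0] at e2
      exact mul_ne_zero e3 e4 (by rw [e2]; ring)
    simp only [Units.val_mul, Units.val_inv_eq_inv_val, Units.val_mk0]
    exact rk_alg _ _ _ _ _ _ _ _ hL2 e4 e5 hs hss e1 e2
  · rw [hg]
    simp
  · intro S hS
    obtain ⟨r, hr⟩ := hS
    have hre := congrArg QuadraticAlgebra.re hr
    have him := congrArg QuadraticAlgebra.im hr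
    generalize hc : ∏ i ∈ S, h i = c at *
    simp [L] at hre him
    have h0 : r.re * r.im = 0 := by
      have : 2 * (r.re * r.im) = 0 := by linear_combination -him
      simpa [h2] using this
    rcases mul_eq_zero.1 h0 with h0 | h0
    · exfalso
      refine hA2 S ⟨D * r.im, ?_⟩
      rw [hc, hre, h0]; ring
    · refine hA S ⟨r.re, ?_⟩
      rw [hc, hre, h0]; ring
  · intro S hS
    obtain ⟨r, hr⟩ := hS
    have hre := congrArg QuadraticAlgebra.re hr
    have him := congrArg QuadraticAlgebra.im hr
    have hBS := hB S
    generalize hc : ∏ i ∈ S, h i = c at *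
    simp [L, e] at hre him
    generalize r.re = a at *
    generalize r.im = b at *
    have k1 : 2 * (a * a + D * b * b) = c * t ^ 2 := by
      rw [← hre]; field_simp
    have k2 : 4 * (a * b) = - (c * t) := by
      have : 2 * (c * (t / 2)) = c * t := by field_simp
      linear_combination (-2) * him - this
    have k3 : (a ^ 2 - D * b ^ 2) ^ 2 = (I * t * c) ^ 2 := by
      have h4 : (4 : K) ≠ 0 := by
        have : (4 : K) = 2 * 2 := by norm_num
        rw [this]; exact mul_ne_zero h2 h2
      apply mul_left_cancel₀ h4
      rw [hD] at *
      linear_combination (2 * (a * a + (t ^ 2 + 4) * b * b) + c * t ^ 2) * k1 - (t ^ 2 + 4) * (4 * (a * b) - c * t) * k2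
        - 4 * t ^ 2 * c ^ 2 * hI
    rcases sq_eq_sq_iff_eq_or_eq_neg.1 k3 with k | k
    · exact hBS I hI ⟨2 * a, by linear_combination (-1) * k1 - 2 * k⟩
    · exact hBS (-I) (by rw [neg_sq, hI]) ⟨2 * a, by linear_combination (-1) * k1 - 2 * k⟩
  · intro P hP
    rcases P with _ | ⟨a, b, hab⟩
    · left; rfl
    right
    have hn : Affine.Point.some a b hab = - Affine.Point.some a b hab :=
      eq_neg_of_add_eq_zero_left hP
    rw [Affine.Point.neg_some] at hn
    have hb : b = W.toAffine.negY a b := by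
      injection hn
    have hb' : b + t * a = 0 := by
      rw [Affine.negY, hW] at hb
      simp only at hb
      have : 2 * (b + t * a) = 0 := by linear_combination hb
      simpa [h2] using this
    have hE := (heq a b).1 hab.1
    rw [hb'] at hE
    have ha : a = 0 := by
      by_contra ha
      have q : a ^ 2 + t ^ 2 * a - t ^ 2 = 0 := by
        apply mul_left_cancel₀ ha
        linear_combination -hE
      refine hDs ⟨(2 * a + t ^ 2) / t, ?_⟩
      field_simp
      rw [hD]
      linear_combination (-4) * q
    subst ha
    have : b = 0 := by simpa using hb'
    subst this
    rfl

lemma rk_pts {K : Type*} [Field K] (w H t : K) (n : ℕ) (hw : w ≠ 0) (hH0 : H ≠ 0)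
    (hH : H = 4 + w ^ 2) (hF : H ^ (2 * n + 1) = 4 + (w ^ 2) ^ (2 * n + 1))
    (ht : w ^ (4 * n + 1) = t) : ∃ x y X v : K,
    (y + t * x) ^ 2 = x ^ 3 + t ^ 2 * x ^ 2 - t ^ 2 * x ∧ X ≠ 0 ∧ X * H = v ^ 2 ∧
    4 * X * x = X ^ 2 - 2 * t ^ 2 * X + t ^ 2 * (t ^ 2 + 4) := by
  obtain ⟨a, ha⟩ : ∃ a, a = w ^ (2 * n) := ⟨_, rfl⟩
  obtain ⟨b, hb⟩ : ∃ b, b = H ^ n := ⟨_, rfl⟩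
  have ha0 : a ≠ 0 := by rw [ha]; exact pow_ne_zero _ hw
  have hb0 : b ≠ 0 := by rw [hb]; exact pow_ne_zero _ hH0
  have hF' : b ^ 2 * H = 4 + a ^ 2 * w ^ 2 := by
    rw [hb, ha]
    linear_combination hF
  have ht' : t = a ^ 2 * w := by rw [← ht, ha]; ring
  clear hF ht
  refine ⟨a ^ 2 / b ^ 2, a / b * (a ^ 2 * (w ^ 2 - 4 - 2 * a ^ 2 * w ^ 2)) / (b ^ 2 * H)
    - t * (a ^ 2 / b ^ 2), a ^ 2 * (b ^ 2 * H), a * b * H, ?_, ?_, ?_, ?_⟩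
  · rw [sub_add_cancel, ht']
    have e1 : (w ^ 2 - 4 - 2 * a ^ 2 * w ^ 2) ^ 2 = H ^ 2 + w ^ 2 * a ^ 2 * H * (b ^ 2 * H)
        - w ^ 2 * (b ^ 2 * H) ^ 2 := by
      rw [hF', hH]; ring
    field_simp
    linear_combination e1
  · exact mul_ne_zero (pow_ne_zero _ ha0) (mul_ne_zero (pow_ne_zero _ hb0) hH0)
  · ring
  · have e1 : 4 * (a ^ 2 * (b ^ 2 * H)) * (a ^ 2 / b ^ 2) = 4 * a ^ 4 * H := by
      field_simp
    rw [e1, hF', ht']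
    linear_combination 4 * a ^ 4 * hH

open Polynomial in
lemma rk_isSquare_of_ratFunc {k : Type*} [Field k] (P : k[X])
    (h : IsSquare (algebraMap k[X] (RatFunc k) P)) : IsSquare P := by
  obtain ⟨r, hr⟩ := h
  obtain ⟨s, rfl⟩ : ∃ s, algebraMap k[X] (RatFunc k) s = r := by
    refine IsIntegrallyClosed.exists_algebraMap_eq_of_isIntegral_pow (n := 2) (by norm_num) ?_
    rw [pow_two, ← hr]
    exact isIntegral_algebraMap
  refine ⟨s, ?_⟩
  rw [← map_mul] at hr
  exact RatFunc.algebraMap_injective k hr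

lemma rk_isSquare_cancel {K : Type*} [Field K] (a b : K) (ha : a ≠ 0) (h : IsSquare (a ^ 2 * b)) :
    IsSquare b := by
  obtain ⟨r, hr⟩ := h
  refine ⟨r / a, ?_⟩
  field_simp
  linear_combination hr

open Polynomial in
lemma rk_conc {k : Type*} [Field k] [IsAlgClosed k] (p : ℕ) [Fact p.Prime] [CharP k p]
    (f n d : ℕ) (hf : 1 ≤ f) (hn : p ^ f = 2 * n + 1) (hd : d = 4 * n + 1)
    (h2 : (2 : k) ≠ 0) [DecidableEq (RatFunc k)] (W : WeierstrassCurve (RatFunc k))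
    (hW : W = { a₁ := 2 * RatFunc.X ^ d, a₂ := 0, a₃ := 0, a₄ := -(RatFunc.X ^ d) ^ 2, a₆ := 0 }) :
    ∃ Q : Fin (d - 1) → W.toAffine.Point, LinearIndependent ℤ Q := by
  classical
  have hd0 : 0 < d := by omega
  have hdk : (d : k) = -1 := by
    have h1 : ((p ^ f : ℕ) : k) = 0 := by
      rw [Nat.cast_pow, CharP.cast_eq_zero, zero_pow (by omega)]
    rw [hn] at h1
    rw [hd]
    push_cast at h1 ⊢
    linear_combination 2 * h1
  have : NeZero (d : k) := ⟨by rw [hdk]; simp⟩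
  have h4 : (4 : k) ≠ 0 := by
    have : (4 : k) = 2 * 2 := by norm_num
    rw [this]; exact mul_ne_zero h2 h2
  obtain ⟨ζ, hζ⟩ := HasEnoughRootsOfUnity.exists_primitiveRoot k d
  have hζ' : IsPrimitiveRoot (C ζ) d := hζ.map_of_injective C_injective
  obtain ⟨I, hI⟩ := IsAlgClosed.exists_pow_nat_eq (-1 : k) (n := 2) (by norm_num)
  set N : Finset k[X] := nthRootsFinset d (1 : k[X]) with hN
  have hNc : N.card = d := hζ'.card_nthRootsFinset
  have hmem : ∀ μ ∈ N, μ ^ d = 1 := fun μ hμ => (mem_nthRootsFinset hd0 1).1 hμ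
  have h1N : (1 : k[X]) ∈ N := (mem_nthRootsFinset hd0 1).2 (one_pow d)
  let hp : k[X] → k[X] := fun μ => 4 + μ * X ^ 2
  -- Frobenius facts
  have hfr4 : (4 : k[X]) ^ (2 * n + 1) = 4 := by
    rw [← hn, ← iterateFrobenius_def]
    exact map_ofNat _ 4
  have hfr : ∀ a : k[X], (4 + a) ^ (2 * n + 1) = 4 + a ^ (2 * n + 1) := by
    intro a
    rw [← hn, add_pow_char_pow, hn, hfr4]
  have hodd : Odd d := ⟨2 * n, by omega⟩
  have h4X : (4 : k[X]) = C 4 := (map_ofNat C 4).symm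
  have h4X0 : (4 : k[X]) ≠ 0 := by rw [h4X, Ne, C_eq_zero]; exact h4
  have h4d : (4 : k[X]) ^ d = 4 := by
    apply mul_right_cancel₀ h4X0
    rw [← pow_succ, show d + 1 = (2 * n + 1) * 2 by omega, pow_mul, hfr4, pow_two]
  have hprod : ∏ μ ∈ N, hp μ = X ^ (2 * d) + 4 := by
    have := hζ'.pow_add_pow_eq_prod_add_mul 4 (X ^ 2) hodd
    rw [← this, h4d]; ring
  have hsqf : Squarefree (∏ μ ∈ N, hp μ) := by
    rw [hprod]
    have h := separable_X_pow_sub_C (n := 2 * d) (-4 : k) (by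
      push_cast; rw [hdk]; simpa using h2) (by simpa using h4)
    have h' := h.squarefree
    rwa [map_neg, sub_neg_eq_add, ← h4X] at h'
  have hpne : ∀ μ ∈ N, ¬ IsUnit (hp μ) := by
    intro μ hμ hu
    obtain ⟨c, -, hc⟩ := Polynomial.isUnit_iff.1 hu
    have hμ0 : μ ≠ 0 := by
      rintro rfl
      have := hmem 0 hμ
      rw [zero_pow hd0.ne'] at this
      exact zero_ne_one this
    have h0 := congrArg (eval 0) hc
    simp [hp, h4X] at h0
    rw [h0, ← h4X] at hc
    have : μ * X ^ 2 = 0 := by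
      have hc' : (4 : k[X]) = 4 + μ * X ^ 2 := hc
      linear_combination -hc'
    exact mul_ne_zero hμ0 (pow_ne_zero _ X_ne_zero) this
  have hp0 : ∀ μ, hp μ ≠ 0 := by
    intro μ h0
    have := congrArg (eval 0) h0
    simp [hp, h4X, h4] at this
  have hPA : ∀ S ⊆ N, IsSquare (∏ μ ∈ S, hp μ) → S = ∅ := by
    intro S hS hsq
    obtain ⟨r, hr⟩ := hsq
    have h1 : Squarefree (∏ μ ∈ S, hp μ) :=
      hsqf.squarefree_of_dvd (Finset.prod_dvd_prod_of_subset _ _ _ hS)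
    have h2 : IsUnit r := h1 r ⟨1, by rw [hr, mul_one]⟩
    by_contra hne
    obtain ⟨μ, hμ⟩ := Finset.nonempty_iff_ne_empty.2 hne
    have h3 : IsUnit (∏ μ ∈ S, hp μ) := by rw [hr]; exact h2.mul h2
    exact hpne μ (hS hμ) (isUnit_of_dvd_unit (Finset.dvd_prod_of_mem _ hμ) h3)
  let am := algebraMap k[X] (RatFunc k)
  have hinj : Function.Injective am := RatFunc.algebraMap_injective k
  have hamX : am X = RatFunc.X := RatFunc.algebraMap_X
  let ι := {μ // μ ∈ N.erase 1}
  have hιc : Fintype.card ι = d - 1 := by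
    rw [Fintype.card_coe, Finset.card_erase_of_mem h1N, hNc]
  have hprodS : ∀ S : Finset ι, ∏ i ∈ S, am (hp i) =
      am (∏ μ ∈ S.map (Function.Embedding.subtype _), hp μ) := by
    intro S
    rw [Finset.prod_map, map_prod]; rfl
  have hsub : ∀ S : Finset ι, S.map (Function.Embedding.subtype _) ⊆ N.erase 1 := by
    intro S μ hμ
    obtain ⟨i, -, rfl⟩ := Finset.mem_map.1 hμ
    exact i.2
  have hDam : (RatFunc.X ^ d) ^ 2 + 4 = am (∏ μ ∈ N, hp μ) := by
    rw [hprod, map_add, map_pow, hamX, map_ofNat]; ring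
  have hpts : ∀ i : ι, ∃ x y X v : RatFunc k,
      (y + RatFunc.X ^ d * x) ^ 2 = x ^ 3 + (RatFunc.X ^ d) ^ 2 * x ^ 2 - (RatFunc.X ^ d) ^ 2 * x
      ∧ X ≠ 0 ∧ X * am (hp i) = v ^ 2 ∧
      4 * X * x = X ^ 2 - 2 * (RatFunc.X ^ d) ^ 2 * X +
        (RatFunc.X ^ d) ^ 2 * ((RatFunc.X ^ d) ^ 2 + 4) := by
    rintro ⟨μ, hμ⟩
    have hμd := hmem μ (Finset.mem_of_mem_erase hμ)
    have hμ0 : μ ≠ 0 := by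
      rintro rfl
      rw [zero_pow hd0.ne'] at hμd
      exact zero_ne_one hμd
    have hw2 : (μ ^ (2 * n + 1) * X) ^ 2 = μ * X ^ 2 := by
      have : μ ^ (2 * (2 * n + 1)) = μ := by
        rw [show 2 * (2 * n + 1) = d + 1 by omega, pow_succ, hμd, one_mul]
      rw [mul_pow, ← pow_mul, mul_comm (2 * n + 1) 2, this]
    refine rk_pts (am (μ ^ (2 * n + 1) * X)) (am (hp μ)) _ n ?_ ?_ ?_ ?_ ?_
    · rw [Ne, map_eq_zero_iff am hinj]
      exact mul_ne_zero (pow_ne_zero _ hμ0) X_ne_zero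
    · rw [Ne, map_eq_zero_iff am hinj]; exact hp0 μ
    · rw [← map_pow, hw2, ← map_ofNat am 4, ← map_add]
    · rw [← map_pow, ← map_pow, ← map_pow, ← map_ofNat am 4, ← map_add]
      congr 1
      rw [hw2]
      exact hfr _
    · rw [← map_pow, ← hamX, ← map_pow, ← hd, mul_pow, ← pow_mul, mul_comm _ d, pow_mul, hμd,
        one_pow, one_mul]
  choose x y Z v hxy hZ hZh hxZ using hpts
  have hX0 : (RatFunc.X : RatFunc k) ≠ 0 := RatFunc.X_ne_zero
  have hmain := rk_main (ι := ι) W (RatFunc.X ^ d) ((RatFunc.X ^ d) ^ 2 + 4) hW ?_ (am (C I)) ?_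
    (pow_ne_zero _ hX0) rfl ?_ x y Z v (fun i => am (hp i)) hxy hZ ?_ hZh hxZ ?_ ?_ ?_
  · obtain ⟨Q, hQ⟩ := hmain
    let eq : Fin (d - 1) ≃ ι := (Fintype.equivFinOfCardEq hιc).symm
    exact ⟨Q ∘ eq, hQ.comp eq eq.injective⟩
  · rw [← map_ofNat am 2, Ne, map_eq_zero_iff am hinj, ← map_ofNat C 2, C_eq_zero]
    exact h2
  · rw [← map_pow, ← map_pow, hI]; simp
  · rw [hDam]
    intro h
    have := hPA N subset_rfl (rk_isSquare_of_ratFunc _ h)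
    rw [this] at h1N
    simp at h1N
  · intro i
    rw [Ne, map_eq_zero_iff am hinj]; exact hp0 _
  · intro S hS
    rw [hprodS] at hS
    have := hPA _ ((hsub S).trans (Finset.erase_subset _ _)) (rk_isSquare_of_ratFunc _ hS)
    simpa using this
  · intro S hS
    rw [hprodS, hDam] at hS
    set S' := S.map (Function.Embedding.subtype _) with hS'
    have hSN : S' ⊆ N := (hsub S).trans (Finset.erase_subset _ _)
    rw [← Finset.prod_sdiff hSN, map_mul, mul_comm, mul_assoc, ← pow_two, mul_comm] at hS
    have h3 := rk_isSquare_cancel _ _ (by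
      rw [Ne, map_eq_zero_iff am hinj]
      exact Finset.prod_ne_zero_iff.2 fun μ _ => hp0 μ) hS
    have h4 := hPA _ Finset.sdiff_subset (rk_isSquare_of_ratFunc _ h3)
    have h5 : (1 : k[X]) ∈ N \ S' := by
      rw [Finset.mem_sdiff]
      refine ⟨h1N, fun h => ?_⟩
      have := hsub S h
      simp at this
    rw [h4] at h5
    simp at h5
  · intro S j hj hS
    rw [hprodS] at hS
    set S' := S.map (Function.Embedding.subtype _) with hS'
    obtain ⟨J, hJ, rfl⟩ : ∃ J : k, J ≠ 0 ∧ am (C J) = j := by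
      have hI0 : I ≠ 0 := by
        rintro rfl
        norm_num at hI
      have hIa : am (C I) ^ 2 = -1 := by rw [← map_pow, ← map_pow, hI]; simp
      rw [← hIa] at hj
      rcases sq_eq_sq_iff_eq_or_eq_neg.1 hj with h | h
      · exact ⟨I, hI0, h.symm⟩
      · exact ⟨-I, by simpa using hI0, by rw [h]; simp⟩
    have h1 : IsSquare ((RatFunc.X ^ (2 * n)) ^ 2 *
        am (X * ((∏ μ ∈ S', hp μ) * (X ^ d + 2 * C J)))) := by
      obtain ⟨r, hr⟩ := hS
      refine ⟨r, ?_⟩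
      have e1 : am (X * ((∏ μ ∈ S', hp μ) * (X ^ d + 2 * C J))) =
          RatFunc.X * (am (∏ μ ∈ S', hp μ) * (RatFunc.X ^ d + 2 * am (C J))) := by
        rw [map_mul, map_mul, map_add, map_pow, map_mul, hamX, map_ofNat]
      have e2 : (RatFunc.X : RatFunc k) ^ d = (RatFunc.X ^ (2 * n)) ^ 2 * RatFunc.X := by
        rw [hd]; ring
      rw [e1]
      refine Eq.trans ?_ hr
      linear_combination (- am (∏ μ ∈ S', hp μ) * (RatFunc.X ^ d + 2 * am (C J))) * e2
    have h2' := rk_isSquare_of_ratFunc _ (rk_isSquare_cancel _ _ (pow_ne_zero _ hX0) h1)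
    obtain ⟨r, hr⟩ := h2'
    have h3 : X ∣ r := by
      have : X ∣ r * r := ⟨_, hr.symm⟩
      rcases prime_X.dvd_or_dvd this with h | h <;> exact h
    obtain ⟨s, rfl⟩ := h3
    have h5 : (∏ μ ∈ S', hp μ) * (X ^ d + 2 * C J) = X * (s * s) := by
      apply mul_left_cancel₀ (X_ne_zero (R := k))
      rw [hr]; ring
    have h6 := congrArg (eval 0) h5
    have h2X : (2 : k[X]) = C 2 := (map_ofNat C 2).symm
    rw [h2X] at h6
    simp [hp, h4X, eval_prod, hd0.ne', h2, hJ, h4] at h6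

open scoped Classical in
/-- Let `p > 2` be prime, `k` an algebraic closure of `𝔽_p`, `f ≥ 1`, `d = 2p^f − 1`, and
`K_d = k(u)`.  Let `E` be the elliptic curve `y² + 2u^d xy = x³ − u^{2d} x` over `K_d`
(the curve `y² + 2txy = x³ − t²x` with `t = u^d`).  Then `E(K_d)` contains `d − 1` points
that are linearly independent over `ℤ`; in particular the rank of `E(K_d)` is at least
`d − 1`. -/
theorem rank_at_least_d_sub_one
    (p : ℕ) [Fact p.Prime] (hp2 : 2 < p)
    (k : Type*) [Field k] [Algebra (ZMod p) k] [IsAlgClosure (ZMod p) k]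
    (f d : ℕ) (hf : 1 ≤ f) (hd : d = 2 * p ^ f - 1)
    (W : WeierstrassCurve (RatFunc k))
    (hW : W = { a₁ := 2 * RatFunc.X ^ d
                a₂ := 0
                a₃ := 0
                a₄ := -(RatFunc.X ^ (2 * d))
                a₆ := 0 }) :
    ∃ Q : Fin (d - 1) → W.toAffine.Point, LinearIndependent ℤ Q := by
  have : IsAlgClosed k := IsAlgClosure.isAlgClosed (ZMod p)
  have hpp : p.Prime := Fact.out
  have : CharP k p := charP_of_injective_algebraMap (algebraMap (ZMod p) k).injective p
  obtain ⟨n, hn⟩ : Odd (p ^ f) := (hpp.odd_of_ne_two (by omega)).pow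
  have h2 : (2 : k) ≠ 0 := by
    intro h
    have h' : ((2 : ℕ) : k) = 0 := by exact_mod_cast h
    rw [CharP.cast_eq_zero_iff k p] at h'
    have := Nat.le_of_dvd (by norm_num) h'
    omega
  refine rk_conc p f n d hf hn (by omega) h2 W ?_
  rw [hW, mul_comm 2 d, pow_mul]
end
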